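/- arXiv:2507.12740 — 2 statements merged into one kernel-verified Lean document; each statement's English description precedes it below -/
import Mathlib

section
/- For every α > 0 and k, s, t ∈ ℕ, there exists C = C(k, s, t, α) > 0 such that the following holds for every d ∈ [k−1]. Let F be a k-graph on s vertices with t edges, and let H = {H_1, …, H_{tn}} be any k-graph system on sn vertices with δ_d(H) ≥ (δ_{F,d}^T + α)·binom(sn−d, k−d). If p ≥ C·n^{−1/m_1(F) − 1}·log n, then with high probability the random sparsification H(p) = {H_1(p), …, H_{tn}(p)} contains a transversal F-factor. -/
/-- A transversal `F`-factor of the `k`-graph system `Hs` on `s*n` vertices. -/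
def IsTransversalFFactor {s t n : ℕ} (F : Finset (Finset (Fin s)))
    (Hs : Fin (t * n) → Finset (Finset (Fin (s * n)))) : Prop :=
  ∃ φ : Fin n → Fin s → Fin (s * n),
    (∀ j, Function.Injective (φ j)) ∧
    (∀ j j' : Fin n, j ≠ j' → ∀ a b, φ j a ≠ φ j' b) ∧
    ∃ c : Fin n × {e // e ∈ F} → Fin (t * n),
      Function.Bijective c ∧
      ∀ (j : Fin n) (e : {e // e ∈ F}), Finset.image (φ j) e.1 ∈ Hs (c (j, e))

/-- The Dirac threshold `δ_{F,d}^T` for transversal `F`-factors in `k`-graph systems. -/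
noncomputable def transversalDiracThreshold (k s t d : ℕ) (F : Finset (Finset (Fin s))) : ℝ :=
  sInf {δ : ℝ | 0 < δ ∧ ∀ α : ℝ, 0 < α → ∃ n₀ : ℕ, ∀ n : ℕ, n₀ ≤ n →
    ∀ Hs : Fin (t * n) → Finset (Finset (Fin (s * n))),
      (∀ i, ∀ e ∈ Hs i, e.card = k) →
      (∀ i (D : Finset (Fin (s * n))), D.card = d →
        (δ + α) * ((s * n - d).choose (k - d) : ℝ) ≤
          (((Hs i).filter fun e => D ⊆ e).card : ℝ)) →
      IsTransversalFFactor F Hs}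

/-- `m₁(F)`: the maximum 1-density `e(F')/(|V(F')|-1)` over subgraphs `F' ⊆ F`
with more than one vertex. -/
noncomputable def maxOneDensity {V : Type*} [Fintype V] [DecidableEq V]
    (F : Finset (Finset V)) : ℝ :=
  sSup {x : ℝ | ∃ (W : Finset V) (E' : Finset (Finset V)),
    E' ⊆ F ∧ (∀ e ∈ E', e ⊆ W) ∧ 2 ≤ W.card ∧
    x = (E'.card : ℝ) / ((W.card : ℝ) - 1)}

open Classical in
/-- The probability that the independent random sparsification (each edge of each `Hs i`
kept independently with probability `p`) satisfies the event `E`. -/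
noncomputable def sysSparsProb {M : ℕ} {V : Type*} [DecidableEq V]
    (Hs : Fin M → Finset (Finset V)) (p : ℝ)
    (E : (Fin M → Finset (Finset V)) → Prop) : ℝ :=
  ∑ σ ∈ Fintype.piFinset (fun i => (Hs i).powerset),
    if E σ then ∏ i, p ^ (σ i).card * (1 - p) ^ ((Hs i).card - (σ i).card) else 0

/-- The expectation of `f W` for the `p`-random subset `W` of `U`. -/
noncomputable def binExp {X : Type*} (p : ℝ) (U : Finset X) (f : Finset X → ℝ) : ℝ :=
  ∑ W ∈ U.powerset, p ^ W.card * (1 - p) ^ (U.card - W.card) * f W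

section BinExp

variable {X : Type*} {p : ℝ} {U : Finset X}

lemma binExp_empty (f : Finset X → ℝ) : binExp p ∅ f = f ∅ := by
  simp [binExp]

lemma binExp_insert [DecidableEq X] {a : X} (ha : a ∉ U) (f : Finset X → ℝ) :
    binExp p (insert a U) f =
      (1 - p) * binExp p U f + p * binExp p U (fun W => f (insert a W)) := by
  unfold binExp
  rw [Finset.sum_powerset_insert ha, Finset.mul_sum, Finset.mul_sum]
  congr 1
  · refine Finset.sum_congr rfl fun W hW => ?_
    have h1 := Finset.card_le_card (Finset.mem_powerset.1 hW)
    rw [Finset.card_insert_of_notMem ha, Nat.sub_add_comm h1]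
    ring
  · refine Finset.sum_congr rfl fun W hW => ?_
    have h2 : a ∉ W := fun h => ha (Finset.mem_powerset.1 hW h)
    rw [Finset.card_insert_of_notMem ha, Finset.card_insert_of_notMem h2, Nat.add_sub_add_right]
    ring

lemma binExp_mono (hp : 0 ≤ p) (hp1 : p ≤ 1) {f g : Finset X → ℝ}
    (h : ∀ W ⊆ U, f W ≤ g W) : binExp p U f ≤ binExp p U g := by
  refine Finset.sum_le_sum fun W hW => mul_le_mul_of_nonneg_left (h W (Finset.mem_powerset.1 hW)) ?_
  have : 0 ≤ 1 - p := by linarith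
  positivity

lemma binExp_add (f g : Finset X → ℝ) :
    binExp p U (fun W => f W + g W) = binExp p U f + binExp p U g := by
  simp only [binExp, mul_add, Finset.sum_add_distrib]

lemma binExp_sub (f g : Finset X → ℝ) :
    binExp p U (fun W => f W - g W) = binExp p U f - binExp p U g := by
  simp only [binExp, mul_sub, Finset.sum_sub_distrib]

lemma binExp_const_mul (c : ℝ) (f : Finset X → ℝ) :
    binExp p U (fun W => c * f W) = c * binExp p U f := by
  simp only [binExp, Finset.mul_sum]
  exact Finset.sum_congr rfl fun W _ => by ring

lemma binExp_const [DecidableEq X] (c : ℝ) : binExp p U (fun _ => c) = c := by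
  induction U using Finset.induction_on with
  | empty => simp [binExp]
  | insert a U ha ih => rw [binExp_insert ha, ih]; ring

lemma binExp_union [DecidableEq X] (p₁ p₂ : ℝ) (f : Finset X → ℝ) :
    binExp p₁ U (fun W₁ => binExp p₂ U (fun W₂ => f (W₁ ∪ W₂))) =
      binExp (1 - (1 - p₁) * (1 - p₂)) U f := by
  induction U using Finset.induction_on generalizing f with
  | empty => simp [binExp_empty]
  | insert a U ha ih =>
    rw [binExp_insert ha, binExp_insert ha]
    simp only [binExp_insert ha, Finset.insert_union, Finset.union_insert, Finset.insert_idem]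
    simp only [binExp_add, binExp_const_mul]
    rw [ih, ih (fun W => f (insert a W))]
    ring

lemma binExp_mono_prob [DecidableEq X] {p₁ p₂ : ℝ} (h0 : 0 ≤ p₁) (h : p₁ ≤ p₂) (h1 : p₂ ≤ 1)
    {f : Finset X → ℝ} (hf : ∀ A B, A ⊆ B → f A ≤ f B) :
    binExp p₁ U f ≤ binExp p₂ U f := by
  rcases eq_or_lt_of_le (h.trans h1) with h2 | h2
  · rw [le_antisymm h (h2 ▸ h1)]
  have h3 : 0 < 1 - p₁ := by linarith
  have h4 : p₂ = 1 - (1 - p₁) * (1 - (p₂ - p₁) / (1 - p₁)) := by field_simp; ring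
  rw [h4, ← binExp_union]
  refine binExp_mono h0 (h.trans h1) fun W _ => ?_
  calc f W = binExp ((p₂ - p₁) / (1 - p₁)) U (fun _ => f W) := (binExp_const _).symm
    _ ≤ _ := binExp_mono (div_nonneg (by linarith) h3.le) ((div_le_one h3).2 (by linarith))
        fun W' _ => hf _ _ Finset.subset_union_left

end BinExp

section SpreadLemma

variable {X ι : Type*} [DecidableEq X]

open Classical in
/-- The indicator of the event that `W` contains a member of the family `S`. -/
noncomputable def containsMember (I : Finset ι) (S : ι → Finset X) (W : Finset X) : ℝ :=
  if ∃ i ∈ I, S i ⊆ W then 1 else 0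

lemma containsMember_mono (I : Finset ι) (S : ι → Finset X) {A B : Finset X} (h : A ⊆ B) :
    containsMember I S A ≤ containsMember I S B := by
  unfold containsMember
  split_ifs with h1 h2
  · exact le_rfl
  · obtain ⟨i, hi, h3⟩ := h1
    exact absurd ⟨i, hi, h3.trans h⟩ h2
  · exact zero_le_one
  · exact le_rfl

/-- Minimum fragments: the expected weight of the members with a large fragment is small. -/
lemma exists_fragments {U : Finset X} {I : Finset ι} {S : ι → Finset X} (hSU : ∀ i ∈ I, S i ⊆ U)
    {μ : ι → ℝ} (hμ : ∀ i, 0 ≤ μ i) {q : ℝ} (hq : 0 ≤ q)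
    (hspread : ∀ A : Finset X, ∑ i ∈ I with A ⊆ S i, μ i ≤ q ^ A.card)
    {ℓ : ℕ} (hℓ : ∀ i ∈ I, (S i).card ≤ ℓ) {p : ℝ} (hp : 0 < p) (hp1 : p ≤ 1) :
    ∃ T : Finset X → ι → Finset X,
      (∀ W, ∀ i ∈ I, T W i ⊆ S i) ∧
      (∀ W, ∀ i ∈ I, ∃ j ∈ I, S j ⊆ W ∪ T W i) ∧
      ∀ h : ℕ, binExp p U (fun W => ∑ i ∈ I with h ≤ (T W i).card, μ i) ≤
        ∑ u ∈ Finset.Icc h ℓ, (ℓ.choose u : ℝ) * (q / p) ^ u := by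
  classical
  have key : ∀ W : Finset X, ∀ i : ι, ∃ j, i ∈ I → j ∈ I ∧ S j ⊆ W ∪ S i ∧
      ∀ j' ∈ I, S j' ⊆ W ∪ S i → (S j \ W).card ≤ (S j' \ W).card := by
    intro W i
    by_cases hi : i ∈ I
    · obtain ⟨j, hj, hmin⟩ := Finset.exists_min_image (I.filter fun j => S j ⊆ W ∪ S i)
        (fun j => (S j \ W).card) ⟨i, by simp [hi, Finset.subset_union_right]⟩
      simp only [Finset.mem_filter] at hj hmin
      exact ⟨j, fun _ => ⟨hj.1, hj.2, fun j' h1 h2 => hmin j' ⟨h1, h2⟩⟩⟩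
    · exact ⟨i, fun h => absurd h hi⟩
  choose J hJ using key
  set T : Finset X → ι → Finset X := fun W i => S (J W i) \ W with hT
  have hTS : ∀ W, ∀ i ∈ I, T W i ⊆ S i := by
    intro W i hi x hx
    obtain ⟨-, h2, -⟩ := hJ W i hi
    rw [hT, Finset.mem_sdiff] at hx
    exact (Finset.mem_union.1 (h2 hx.1)).resolve_left hx.2
  have hcover : ∀ W i, S (J W i) ⊆ W ∪ T W i := by
    intro W i x hx
    by_cases hxW : x ∈ W
    · exact Finset.mem_union_left _ hxW
    · exact Finset.mem_union_right _ (Finset.mem_sdiff.2 ⟨hx, hxW⟩)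
  refine ⟨T, hTS, fun W i hi => ⟨J W i, (hJ W i hi).1, hcover W i⟩, fun h => ?_⟩
  -- a canonical member inside each set
  have hR : ∀ Z : Finset X, ∃ R : Finset X, R.card ≤ ℓ ∧
      ((∃ j ∈ I, S j ⊆ Z) → ∃ j ∈ I, S j ⊆ Z ∧ R = S j) := by
    intro Z
    by_cases hZ : ∃ j ∈ I, S j ⊆ Z
    · obtain ⟨j, hj, hjZ⟩ := hZ
      exact ⟨S j, hℓ j hj, fun _ => ⟨j, hj, hjZ, rfl⟩⟩
    · exact ⟨∅, by simp, fun h => absurd h hZ⟩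
  choose R hRcard hR using hR
  have hTR : ∀ W, ∀ i ∈ I, T W i ⊆ R (W ∪ T W i) := by
    intro W i hi
    obtain ⟨j, hj, hjZ, hRj⟩ := hR (W ∪ T W i) ⟨J W i, (hJ W i hi).1, hcover W i⟩
    have h1 : S j \ W ⊆ T W i := by
      intro x hx
      rw [Finset.mem_sdiff] at hx
      exact (Finset.mem_union.1 (hjZ hx.1)).resolve_left hx.2
    have h2 : (T W i).card ≤ (S j \ W).card :=
      (hJ W i hi).2.2 j hj (hjZ.trans (Finset.union_subset_union_right (hTS W i hi)))
    rw [hRj, ← Finset.eq_of_subset_of_card_le h1 h2]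
    exact Finset.sdiff_subset
  set P : Finset X → ℝ := fun W => p ^ W.card * (1 - p) ^ (U.card - W.card) with hP
  have h1p : 0 ≤ 1 - p := by linarith
  have hP0 : ∀ W, 0 ≤ P W := fun W => by positivity
  have hPsum : ∑ Z ∈ U.powerset, P Z = 1 := by
    have := binExp_const (p := p) (U := U) 1
    simpa [binExp] using this
  have hPsdiff : ∀ Z ∈ U.powerset, ∀ A ⊆ Z, P (Z \ A) ≤ P Z * (1 / p) ^ A.card := by
    intro Z hZ A hA
    have c1 := Finset.card_le_card hA
    have c2 := Finset.card_le_card (Finset.mem_powerset.1 hZ)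
    simp only [hP]
    rw [Finset.card_sdiff_of_subset hA]
    have e1 : p ^ Z.card * (1 / p) ^ A.card = p ^ (Z.card - A.card) := by
      rw [pow_sub₀ _ hp.ne' c1]; simp
    calc p ^ (Z.card - A.card) * (1 - p) ^ (U.card - (Z.card - A.card))
        ≤ p ^ (Z.card - A.card) * (1 - p) ^ (U.card - Z.card) := by
          refine mul_le_mul_of_nonneg_left ?_ (by positivity)
          exact pow_le_pow_of_le_one h1p (by linarith) (by omega)
      _ = _ := by rw [← e1]; ring
  have hstep : ∀ u : ℕ, ∑ W ∈ U.powerset, P W * ∑ i ∈ I with (T W i).card = u, μ i ≤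
      (ℓ.choose u : ℝ) * (q / p) ^ u := by
    intro u
    calc ∑ W ∈ U.powerset, P W * ∑ i ∈ I with (T W i).card = u, μ i
        ≤ ∑ W ∈ U.powerset, ∑ i ∈ I, ∑ Z ∈ U.powerset, ∑ A ∈ (R Z).powersetCard u,
            if A ⊆ Z ∧ Z \ A = W ∧ A ⊆ S i then P W * μ i else 0 := by
          refine Finset.sum_le_sum fun W hW => ?_
          rw [Finset.sum_filter, Finset.mul_sum]
          refine Finset.sum_le_sum fun i hi => ?_
          have hnn : ∀ Z A, 0 ≤ (if A ⊆ Z ∧ Z \ A = W ∧ A ⊆ S i then P W * μ i else 0) := by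
            intro Z A
            split_ifs
            · exact mul_nonneg (hP0 W) (hμ i)
            · exact le_rfl
          split_ifs with hu
          · have hdisj : (W ∪ T W i) \ T W i = W := by
              rw [Finset.union_sdiff_right, Finset.sdiff_eq_self_iff_disjoint]
              exact Finset.disjoint_sdiff
            have hZU : W ∪ T W i ∈ U.powerset := by
              rw [Finset.mem_powerset] at hW ⊢
              exact Finset.union_subset hW ((hTS W i hi).trans (hSU i hi))
            refine le_trans ?_ (Finset.single_le_sum (fun Z _ => Finset.sum_nonneg
              fun A _ => hnn Z A) hZU)
            refine le_trans ?_ (Finset.single_le_sum (fun A _ => hnn _ A)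
              (Finset.mem_powersetCard.2 ⟨hTR W i hi, hu⟩))
            rw [if_pos ⟨Finset.subset_union_right, hdisj, hTS W i hi⟩]
          · rw [mul_zero]
            exact Finset.sum_nonneg fun Z _ => Finset.sum_nonneg fun A _ => hnn Z A
      _ = ∑ Z ∈ U.powerset, ∑ A ∈ (R Z).powersetCard u, ∑ W ∈ U.powerset, ∑ i ∈ I,
            if A ⊆ Z ∧ Z \ A = W ∧ A ⊆ S i then P W * μ i else 0 := by
          simp_rw [Finset.sum_comm (s := I)]
          rw [Finset.sum_comm]
          exact Finset.sum_congr rfl fun Z _ => Finset.sum_comm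
      _ ≤ ∑ Z ∈ U.powerset, ∑ A ∈ (R Z).powersetCard u, P Z * (q / p) ^ u := by
          refine Finset.sum_le_sum fun Z hZ => Finset.sum_le_sum fun A hA => ?_
          have hAu := (Finset.mem_powersetCard.1 hA).2
          by_cases hAZ : A ⊆ Z
          · have hmem : Z \ A ∈ U.powerset :=
              Finset.mem_powerset.2 (Finset.sdiff_subset.trans (Finset.mem_powerset.1 hZ))
            rw [Finset.sum_eq_single_of_mem _ hmem]
            · simp only [hAZ, true_and]
              rw [← Finset.sum_filter, ← Finset.mul_sum]
              calc P (Z \ A) * ∑ i ∈ I with A ⊆ S i, μ i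
                  ≤ (P Z * (1 / p) ^ u) * q ^ u := by
                    refine mul_le_mul (hAu ▸ hPsdiff Z hZ A hAZ) (hAu ▸ hspread A)
                      (Finset.sum_nonneg fun i _ => hμ i) ?_
                    have := hP0 Z
                    positivity
                _ = _ := by rw [mul_assoc, ← mul_pow]; congr 2; ring
            · intro W _ hne
              exact Finset.sum_eq_zero fun i _ => if_neg fun h => hne h.2.1.symm
          · simp only [hAZ, false_and, if_false, Finset.sum_const_zero]
            have := hP0 Z
            positivity
      _ ≤ ∑ Z ∈ U.powerset, P Z * ((ℓ.choose u : ℝ) * (q / p) ^ u) := by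
          refine Finset.sum_le_sum fun Z _ => ?_
          rw [Finset.sum_const, Finset.card_powersetCard, nsmul_eq_mul]
          have h3 : ((R Z).card.choose u : ℝ) ≤ ℓ.choose u := by
            exact_mod_cast Nat.choose_le_choose u (hRcard Z)
          have h4 : 0 ≤ P Z * (q / p) ^ u := by
            have := hP0 Z
            positivity
          nlinarith [mul_le_mul_of_nonneg_right h3 h4]
      _ = _ := by rw [← Finset.sum_mul, hPsum, one_mul]
  calc binExp p U (fun W => ∑ i ∈ I with h ≤ (T W i).card, μ i)
      = ∑ W ∈ U.powerset, P W * ∑ u ∈ Finset.Icc h ℓ, ∑ i ∈ I with (T W i).card = u, μ i := by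
        refine Finset.sum_congr rfl fun W _ => ?_
        simp only [hP]
        congr 1
        simp_rw [Finset.sum_filter]
        rw [Finset.sum_comm]
        refine Finset.sum_congr rfl fun i hi => ?_
        rw [Finset.sum_ite_eq]
        have := (Finset.card_le_card (hTS W i hi)).trans (hℓ i hi)
        simp [this]
    _ = ∑ u ∈ Finset.Icc h ℓ, ∑ W ∈ U.powerset, P W * ∑ i ∈ I with (T W i).card = u, μ i := by
        simp_rw [Finset.mul_sum (s := Finset.Icc h ℓ)]
        rw [Finset.sum_comm]
    _ ≤ _ := Finset.sum_le_sum fun u _ => hstep u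

/-- The density after `r` rounds of exposure with density `p₀` and one round with density `p`. -/
noncomputable def roundsDensity (p₀ p : ℝ) : ℕ → ℝ
  | 0 => p
  | r + 1 => 1 - (1 - p₀) * (1 - roundsDensity p₀ p r)

lemma roundsDensity_bounds {p₀ p : ℝ} (h₀ : 0 ≤ p₀) (h₀' : p₀ ≤ 1) (h : 0 ≤ p) (h' : p ≤ 1)
    (r : ℕ) : 0 ≤ roundsDensity p₀ p r ∧ roundsDensity p₀ p r ≤ 1 ∧
      roundsDensity p₀ p r ≤ r * p₀ + p := by
  induction r with
  | zero => simp [roundsDensity, h, h']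
  | succ r ih =>
    obtain ⟨h1, h2, h3⟩ := ih
    simp only [roundsDensity]
    push_cast
    refine ⟨?_, ?_, ?_⟩ <;> nlinarith [mul_nonneg h₀ h1]

lemma sum_sub_le_binExp_containsMember {U : Finset X} {q p₀ p : ℝ} (hq : 0 < q)
    (hp₀ : 64 * q ≤ p₀) (hp₀' : p₀ ≤ 1) (hp : 0 < p) (hp' : p ≤ 1) {m : ℕ} (hm : 0 < m)
    (μ : ι → ℝ) (hμ : ∀ i, 0 ≤ μ i) (r : ℕ) (I : Finset ι) (S : ι → Finset X)
    (hSU : ∀ i ∈ I, S i ⊆ U)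
    (hspread : ∀ A : Finset X, ∑ i ∈ I with A ⊆ S i, μ i ≤ q ^ A.card)
    (hcard : ∀ i ∈ I, (S i).card ≤ 2 ^ r * m) :
    ∑ i ∈ I, μ i - (1 / 4) ^ m * (1 - (1 / 2) ^ r) - ((1 + q / p) ^ m - 1) ≤
      binExp (roundsDensity p₀ p r) U (containsMember I S) := by
  classical
  have hp₀pos : 0 < p₀ := by linarith
  induction r generalizing I S with
  | zero =>
    obtain ⟨T, hTS, hT, hE⟩ := exists_fragments hSU hμ hq.le hspread hcard hp hp'
    have h1 := hE 1
    have h2 : ∑ u ∈ Finset.Icc 1 (2 ^ 0 * m), ((2 ^ 0 * m).choose u : ℝ) * (q / p) ^ u =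
        (1 + q / p) ^ m - 1 := by
      rw [add_comm, add_pow, Finset.range_eq_Ico, Finset.sum_eq_sum_Ico_succ_bot (by omega)]
      simp only [pow_zero, one_mul, one_pow, mul_one, Nat.choose_zero_right, Nat.cast_one,
        zero_add, add_sub_cancel_left]
      exact Finset.sum_congr rfl fun u _ => mul_comm _ _
    rw [h2] at h1
    have h3 : binExp p U (fun W => ∑ i ∈ I, μ i - ∑ i ∈ I with 1 ≤ (T W i).card, μ i) ≤
        binExp p U (containsMember I S) := by
      refine binExp_mono hp.le hp' fun W _ => ?_
      have h4 : ∑ i ∈ I, μ i - ∑ i ∈ I with 1 ≤ (T W i).card, μ i =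
          ∑ i ∈ I with ¬ 1 ≤ (T W i).card, μ i := by
        rw [← Finset.sum_filter_add_sum_filter_not I (fun i => 1 ≤ (T W i).card)]
        ring
      rw [h4]
      unfold containsMember
      split_ifs with hc
      · calc ∑ i ∈ I with ¬ 1 ≤ (T W i).card, μ i ≤ ∑ i ∈ I, μ i :=
              Finset.sum_le_sum_of_subset_of_nonneg (Finset.filter_subset _ _)
                fun i _ _ => hμ i
          _ ≤ 1 := by simpa using hspread ∅
      · refine (Finset.sum_eq_zero fun i hi => ?_).le
        rw [Finset.mem_filter] at hi
        obtain ⟨j, hj, hjW⟩ := hT W i hi.1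
        have : T W i = ∅ := by
          rw [← Finset.card_eq_zero]
          omega
        rw [this, Finset.union_empty] at hjW
        exact absurd ⟨j, hj, hjW⟩ hc
    rw [binExp_sub, binExp_const] at h3
    simp only [roundsDensity, pow_zero, sub_self, mul_zero]
    linarith
  | succ r ih =>
    obtain ⟨T, hTS, hT, hE⟩ := exists_fragments hSU hμ hq.le hspread hcard hp₀pos hp₀'
    have h1 := hE (2 ^ r * m)
    have h2 : ∑ u ∈ Finset.Icc (2 ^ r * m) (2 ^ (r + 1) * m),
        ((2 ^ (r + 1) * m).choose u : ℝ) * (q / p₀) ^ u ≤ (1 / 4) ^ (2 ^ (r + 1) * m) := by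
      have hqp : q / p₀ ≤ 1 / 64 := by
        rw [div_le_div_iff₀ hp₀pos (by norm_num)]
        linarith
      calc ∑ u ∈ Finset.Icc (2 ^ r * m) (2 ^ (r + 1) * m),
            ((2 ^ (r + 1) * m).choose u : ℝ) * (q / p₀) ^ u
          ≤ ∑ u ∈ Finset.Icc (2 ^ r * m) (2 ^ (r + 1) * m),
            ((2 ^ (r + 1) * m).choose u : ℝ) * (1 / 64) ^ (2 ^ r * m) := by
            refine Finset.sum_le_sum fun u hu => ?_
            refine mul_le_mul_of_nonneg_left ?_ (Nat.cast_nonneg _)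
            calc (q / p₀) ^ u ≤ (1 / 64) ^ u := pow_le_pow_left₀ (by positivity) hqp u
              _ ≤ _ := pow_le_pow_of_le_one (by norm_num) (by norm_num) (Finset.mem_Icc.1 hu).1
        _ ≤ ∑ u ∈ Finset.range (2 ^ (r + 1) * m + 1),
            ((2 ^ (r + 1) * m).choose u : ℝ) * (1 / 64) ^ (2 ^ r * m) := by
            refine Finset.sum_le_sum_of_subset_of_nonneg ?_ fun _ _ _ => by positivity
            intro u hu
            have := (Finset.mem_Icc.1 hu).2
            exact Finset.mem_range.2 (by omega)
        _ = _ := by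
            rw [← Finset.sum_mul, ← Nat.cast_sum, Nat.sum_range_choose]
            push_cast
            have e1 : (1 / 64 : ℝ) ^ (2 ^ r * m) = (1 / 8) ^ (2 ^ (r + 1) * m) := by
              rw [show 2 ^ (r + 1) * m = 2 * (2 ^ r * m) by ring, pow_mul (1 / 8 : ℝ) 2]
              norm_num
            rw [e1, ← mul_pow]
            norm_num
    have h2' : (1 / 4 : ℝ) ^ (2 ^ (r + 1) * m) ≤ (1 / 4) ^ m * (1 / 2) ^ (r + 1) := by
      have h5 : m + (r + 1) ≤ 2 ^ (r + 1) * m := by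
        have : r + 1 < 2 ^ (r + 1) := Nat.lt_two_pow_self
        nlinarith
      calc (1 / 4 : ℝ) ^ (2 ^ (r + 1) * m) ≤ (1 / 4) ^ (m + (r + 1)) :=
            pow_le_pow_of_le_one (by norm_num) (by norm_num) h5
        _ = (1 / 4) ^ m * (1 / 4) ^ (r + 1) := pow_add _ _ _
        _ ≤ _ := by gcongr; norm_num
    obtain ⟨b1, b2, -⟩ := roundsDensity_bounds hp₀pos.le hp₀' hp.le hp' r
    set I' : Finset X → Finset ι := fun W => I.filter fun i => ¬ 2 ^ r * m ≤ (T W i).card with hI'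
    have h3 : ∀ W, ∑ i ∈ I, μ i - ∑ i ∈ I with 2 ^ r * m ≤ (T W i).card, μ i =
        ∑ i ∈ I' W, μ i := by
      intro W
      rw [← Finset.sum_filter_add_sum_filter_not I (fun i => 2 ^ r * m ≤ (T W i).card)]
      ring
    have h4 : ∀ W, ∑ i ∈ I' W, μ i - (1 / 4) ^ m * (1 - (1 / 2) ^ r) - ((1 + q / p) ^ m - 1) ≤
        binExp (roundsDensity p₀ p r) U (fun W' => containsMember I S (W ∪ W')) := by
      intro W
      have hsub : ∀ i ∈ I' W, i ∈ I := fun i hi => (Finset.mem_filter.1 hi).1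
      refine (ih (I' W) (T W) (fun i hi => (hTS W i (hsub i hi)).trans (hSU i (hsub i hi)))
        (fun A => ?_) (fun i hi => ?_)).trans (binExp_mono b1 b2 fun W' _ => ?_)
      · refine le_trans (Finset.sum_le_sum_of_subset_of_nonneg ?_ fun i _ _ => hμ i) (hspread A)
        intro i hi
        rw [Finset.mem_filter] at hi ⊢
        exact ⟨hsub i hi.1, hi.2.trans (hTS W i (hsub i hi.1))⟩
      · have := (Finset.mem_filter.1 hi).2
        omega
      · unfold containsMember
        split_ifs with hc hc'
        · exact le_rfl
        · obtain ⟨i, hi, hiW⟩ := hc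
          obtain ⟨j, hj, hjW⟩ := hT W i (hsub i hi)
          exact absurd ⟨j, hj, hjW.trans (Finset.union_subset_union_right hiW)⟩ hc'
        · exact zero_le_one
        · exact le_rfl
    have h5 := binExp_mono (U := U) hp₀pos.le hp₀' (fun W _ => h4 W)
    rw [binExp_union] at h5
    simp only [← h3, binExp_sub, binExp_const] at h5
    simp only [roundsDensity]
    have e2 : (1 / 2 : ℝ) ^ r = 2 * (1 / 2) ^ (r + 1) := by rw [pow_succ]; ring
    rw [e2] at h5
    nlinarith [h1, h2, h2']

lemma exists_small_error (t : ℕ) {ε : ℝ} (hε : 0 < ε) :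
    ∃ n₀ : ℕ, 3 ≤ n₀ ∧ ∃ m : ℕ, 0 < m ∧ ∀ n : ℕ, n₀ ≤ n →
      (1 / 4 : ℝ) ^ m + ((1 + 1 / Real.log n) ^ m - 1) ≤ ε ∧ t ≤ n ∧ 1 ≤ Real.log n := by
  obtain ⟨m, hm⟩ := exists_pow_lt_of_lt_one (half_pos hε) (by norm_num : (1 / 4 : ℝ) < 1)
  have hm' : (1 / 4 : ℝ) ^ (m + 1) ≤ ε / 2 :=
    (pow_le_pow_of_le_one (by norm_num) (by norm_num) m.le_succ).trans hm.le
  have hlog : Filter.Tendsto (fun n : ℕ => Real.log n) Filter.atTop Filter.atTop :=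
    Real.tendsto_log_atTop.comp tendsto_natCast_atTop_atTop
  have hlim : Filter.Tendsto (fun n : ℕ => (1 + 1 / Real.log n) ^ (m + 1) - 1) Filter.atTop
      (nhds 0) := by
    have h1 : Filter.Tendsto (fun n : ℕ => 1 / Real.log n) Filter.atTop (nhds 0) := by
      simp only [one_div]
      exact hlog.inv_tendsto_atTop
    simpa using ((h1.const_add 1).pow (m + 1)).sub_const 1
  obtain ⟨n₀, h⟩ := Filter.eventually_atTop.1 ((hlim.eventually (gt_mem_nhds (half_pos hε))).and
    ((Filter.eventually_ge_atTop t).and (hlog.eventually_ge_atTop 1)))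
  refine ⟨max n₀ 3, le_max_right _ _, m + 1, by omega, fun n hn => ?_⟩
  obtain ⟨h1, h2, h3⟩ := h n ((le_max_left _ _).trans hn)
  exact ⟨by linarith, h2, h3⟩

lemma clog_mul_le_log {t n : ℕ} (ht0 : 0 < t) (ht : t ≤ n) (hn : 3 ≤ n)
    (h : 1 ≤ Real.log n) :
    1 ≤ Nat.clog 2 (t * n) ∧ (Nat.clog 2 (t * n) : ℝ) ≤ 4 * Real.log n := by
  have h1 : 2 ≤ t * n := by nlinarith
  have h2 : 0 < Nat.clog 2 (t * n) := Nat.clog_pos (by norm_num) h1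
  refine ⟨h2, ?_⟩
  have h3 : 2 ^ (Nat.clog 2 (t * n)).pred < t * n := Nat.pow_pred_clog_lt_self (by norm_num) h1
  obtain ⟨c, hc⟩ : ∃ c, Nat.clog 2 (t * n) = c + 1 := ⟨_, (Nat.succ_pred_eq_of_pos h2).symm⟩
  rw [hc, Nat.pred_succ] at h3
  have h4 : (2 : ℝ) ^ c ≤ n ^ 2 := by
    have : 2 ^ c ≤ n ^ 2 := h3.le.trans (by nlinarith)
    exact_mod_cast this
  have h5 := Real.log_le_log (by positivity) h4
  rw [Real.log_pow, Real.log_pow] at h5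
  rw [hc]
  push_cast at h5 ⊢
  have h6 := Real.log_two_gt_d9
  have h7 : (0 : ℝ) ≤ c := Nat.cast_nonneg c
  nlinarith

/-- A spread weighted family of sets of size at most `t * n`: a `p`-random subset contains a member
with probability close to one as soon as `p` exceeds the spread by a logarithmic factor. -/
lemma spread_threshold {t : ℕ} (ht : 0 < t) {ε : ℝ} (hε : 0 < ε) :
    ∃ n₀ : ℕ, 3 ≤ n₀ ∧ ∀ n : ℕ, n₀ ≤ n → ∀ {X : Type} {ι : Type} [DecidableEq X]
      {U : Finset X} {I : Finset ι} {S : ι → Finset X} {μ : ι → ℝ} {q p : ℝ},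
      (∀ i ∈ I, S i ⊆ U) → (∀ i, 0 ≤ μ i) → ∑ i ∈ I, μ i = 1 → 0 < q →
      (∀ A : Finset X, ∑ i ∈ I with A ⊆ S i, μ i ≤ q ^ A.card) →
      (∀ i ∈ I, (S i).card ≤ t * n) → 512 * q * Real.log n ≤ p → p ≤ 1 →
      1 - ε ≤ binExp p U (containsMember I S) := by
  obtain ⟨n₀, hn₀, m, hm, h⟩ := exists_small_error t hε
  refine ⟨n₀, hn₀, fun n hn X ι _ U I S μ q p hSU hμ hmass hq hspread hcard hqp hp1 => ?_⟩
  obtain ⟨herr, htn, hlog⟩ := h n hn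
  obtain ⟨hr1, hr⟩ := clog_mul_le_log ht htn (hn₀.trans hn) hlog
  set r := Nat.clog 2 (t * n) with hrdef
  have hr1' : (1 : ℝ) ≤ r := by exact_mod_cast hr1
  have hp : 0 < p := by nlinarith [mul_pos hq (zero_lt_one.trans_le hlog)]
  have h64 : 64 * q ≤ p / (2 * r) := by
    rw [le_div_iff₀ (by linarith)]
    nlinarith
  have hp₀ : p / (2 * r) ≤ 1 := by
    rw [div_le_one (by linarith)]
    linarith
  have hcard' : ∀ i ∈ I, (S i).card ≤ 2 ^ r * m := fun i hi => by
    have h1 : t * n ≤ 2 ^ r := Nat.le_pow_clog (by norm_num) _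
    exact (hcard i hi).trans (h1.trans (Nat.le_mul_of_pos_right _ hm))
  have key := sum_sub_le_binExp_containsMember hq h64 hp₀ (half_pos hp) (by linarith) hm μ hμ r I S
    hSU hspread hcard'
  obtain ⟨b1, b2, b3⟩ := roundsDensity_bounds (p₀ := p / (2 * r)) (p := p / 2) (by positivity) hp₀
    (half_pos hp).le (by linarith) r
  have b4 : r * (p / (2 * r)) + p / 2 = p := by field_simp; ring
  have hmono := binExp_mono_prob (U := U) b1 (b3.trans b4.le) hp1
    (fun A B hAB => containsMember_mono I S hAB)
  have e1 : (1 + q / (p / 2)) ^ m ≤ (1 + 1 / Real.log n) ^ m := by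
    have : q / (p / 2) ≤ 1 / Real.log n := by
      rw [div_le_div_iff₀ (by linarith) (by linarith)]
      nlinarith [mul_pos hq (zero_lt_one.trans_le hlog)]
    gcongr
  have e2 : (1 / 4 : ℝ) ^ m * (1 - (1 / 2) ^ r) ≤ (1 / 4) ^ m := by
    refine mul_le_of_le_one_right (by positivity) ?_
    have : (0 : ℝ) < (1 / 2) ^ r := by positivity
    linarith
  rw [hmass] at key
  linarith

end SpreadLemma

section Concentration

variable {X : Type*} [DecidableEq X]

/-- The density of the members of `E` contained in `Y` among all `r`-subsets of `Y`. -/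
noncomputable def subsetDensity (E : Finset (Finset X)) (r : ℕ) (Y : Finset X) : ℝ :=
  ((E.filter fun g => g ⊆ Y).card : ℝ) / (Y.card.choose r : ℝ)

variable {E : Finset (Finset X)} {r : ℕ}

lemma card_filter_subset_le_choose (hE : ∀ g ∈ E, g.card = r) (Y : Finset X) :
    (E.filter fun g => g ⊆ Y).card ≤ Y.card.choose r := by
  rw [← Finset.card_powersetCard]
  refine Finset.card_le_card fun g hg => ?_
  rw [Finset.mem_filter] at hg
  exact Finset.mem_powersetCard.2 ⟨hg.2, hE g hg.1⟩

lemma subsetDensity_mem_Icc (hE : ∀ g ∈ E, g.card = r) (Y : Finset X) :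
    0 ≤ subsetDensity E r Y ∧ subsetDensity E r Y ≤ 1 := by
  refine ⟨by unfold subsetDensity; positivity, div_le_one_of_le₀ ?_ (by positivity)⟩
  exact_mod_cast card_filter_subset_le_choose hE Y

lemma sum_subsetDensity_erase (hE : ∀ g ∈ E, g.card = r) {Y : Finset X} {N : ℕ}
    (hY : Y.card = N + 1) (hN : r ≤ N) :
    ∑ y ∈ Y, subsetDensity E r (Y.erase y) = (N + 1) * subsetDensity E r Y := by
  have h1 : ∑ y ∈ Y, ((E.filter fun g => g ⊆ Y.erase y).card : ℝ) =
      (N + 1 - r) * (E.filter fun g => g ⊆ Y).card := by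
    simp_rw [Finset.card_filter, Nat.cast_sum, Nat.cast_ite, Nat.cast_one, Nat.cast_zero]
    rw [Finset.sum_comm, Finset.mul_sum]
    refine Finset.sum_congr rfl fun g hg => ?_
    by_cases hgY : g ⊆ Y
    · have h2 : ∀ y ∈ Y, (if g ⊆ Y.erase y then (1 : ℝ) else 0) = if y ∈ Y \ g then 1 else 0 := by
        intro y hy
        simp [Finset.subset_erase, hgY, hy]
      rw [Finset.sum_congr rfl h2, Finset.sum_ite_mem,
        Finset.inter_eq_right.2 Finset.sdiff_subset, Finset.sum_const,
        Finset.card_sdiff_of_subset hgY, hE g hg, hY, if_pos hgY]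
      rw [nsmul_eq_mul, Nat.cast_sub (by omega)]
      push_cast
      ring
    · rw [if_neg hgY, mul_zero]
      exact Finset.sum_eq_zero fun y _ => if_neg fun h => hgY (h.trans (Finset.erase_subset _ _))
  have h3 : ∀ y ∈ Y, subsetDensity E r (Y.erase y) =
      ((E.filter fun g => g ⊆ Y.erase y).card : ℝ) / (N.choose r : ℝ) := by
    intro y hy
    rw [subsetDensity, Finset.card_erase_of_mem hy, hY, Nat.add_sub_cancel]
  rw [Finset.sum_congr rfl h3, ← Finset.sum_div, h1, subsetDensity, hY]
  have h4 : ((N + 1).choose r : ℝ) * (N + 1 - r) = N.choose r * (N + 1) := by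
    have := Nat.choose_mul_succ_eq N r
    rw [← Nat.cast_inj (R := ℝ)] at this
    push_cast [Nat.cast_sub (show r ≤ N + 1 by omega)] at this
    linarith
  have h5 : (0 : ℝ) < N.choose r := by exact_mod_cast Nat.choose_pos hN
  have h6 : (0 : ℝ) < (N + 1).choose r := by exact_mod_cast Nat.choose_pos (by omega)
  rw [mul_div_assoc', div_eq_div_iff h5.ne' h6.ne']
  linear_combination (E.filter fun g => g ⊆ Y).card * h4

lemma abs_subsetDensity_sub_erase_le (hE : ∀ g ∈ E, g.card = r) (hr : 1 ≤ r) {Y : Finset X} {N : ℕ}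
    (hY : Y.card = N + 1) (hN : r ≤ N) {y : X} (hy : y ∈ Y) :
    |subsetDensity E r Y - subsetDensity E r (Y.erase y)| ≤ r / (N + 1) := by
  obtain ⟨f0, f1⟩ := subsetDensity_mem_Icc hE (Y.erase y)
  have hNr : (0 : ℝ) < N + 1 := by positivity
  have h4 : ((N + 1).choose r : ℝ) * (N + 1 - r) = N.choose r * (N + 1) := by
    have := Nat.choose_mul_succ_eq N r
    rw [← Nat.cast_inj (R := ℝ)] at this
    push_cast [Nat.cast_sub (show r ≤ N + 1 by omega)] at this
    linarith
  have h5 : (0 : ℝ) < N.choose r := by exact_mod_cast Nat.choose_pos hN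
  have h6 : (0 : ℝ) < (N + 1).choose r := by exact_mod_cast Nat.choose_pos (by omega)
  have h7 : ((N + 1).choose r : ℝ) * r = N.choose (r - 1) * (N + 1) := by
    obtain ⟨r, rfl⟩ : ∃ r', r = r' + 1 := ⟨r - 1, by omega⟩
    have := Nat.add_one_mul_choose_eq N r
    rw [← Nat.cast_inj (R := ℝ)] at this
    push_cast at this ⊢
    linarith
  have hsplit : (E.filter fun g => g ⊆ Y).card =
      (E.filter fun g => g ⊆ Y.erase y).card + (E.filter fun g => g ⊆ Y ∧ y ∈ g).card := by
    rw [← Finset.card_filter_add_card_filter_not (s := E.filter fun g => g ⊆ Y) (fun g => y ∉ g),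
      Finset.filter_filter, Finset.filter_filter]
    simp only [Finset.subset_erase, not_not]
  have hdeg : (E.filter fun g => g ⊆ Y ∧ y ∈ g).card ≤ N.choose (r - 1) := by
    have : (Y.erase y).card = N := by rw [Finset.card_erase_of_mem hy, hY, Nat.add_sub_cancel]
    rw [← this, ← Finset.card_powersetCard]
    refine Finset.card_le_card_of_injOn (fun g => g.erase y) ?_ ?_
    · intro g hg
      rw [Finset.mem_coe, Finset.mem_filter] at hg
      rw [Finset.mem_coe, Finset.mem_powersetCard]
      exact ⟨Finset.erase_subset_erase _ hg.2.1,
        by rw [Finset.card_erase_of_mem hg.2.2, hE g hg.1]⟩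
    · intro g hg g' hg' h
      rw [Finset.mem_coe, Finset.mem_filter] at hg hg'
      rw [← Finset.insert_erase hg.2.2, ← Finset.insert_erase hg'.2.2]
      exact congrArg _ h
  have hdeg' : ((E.filter fun g => g ⊆ Y ∧ y ∈ g).card : ℝ) ≤ N.choose (r - 1) := by
    exact_mod_cast hdeg
  set D : ℝ := ((E.filter fun g => g ⊆ Y ∧ y ∈ g).card : ℝ) with hD
  have hD0 : 0 ≤ D := by positivity
  have e1 : subsetDensity E r Y =
      subsetDensity E r (Y.erase y) * (1 - r / (N + 1)) + D / (N + 1).choose r := by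
    have h8 : subsetDensity E r (Y.erase y) =
        ((E.filter fun g => g ⊆ Y.erase y).card : ℝ) / (N.choose r : ℝ) := by
      rw [subsetDensity, Finset.card_erase_of_mem hy, hY, Nat.add_sub_cancel]
    rw [h8, subsetDensity, hY, hsplit]
    push_cast
    rw [← hD]
    field_simp
    linear_combination ((E.filter fun g => g ⊆ Y.erase y).card : ℝ) * (-h4)
  have e2 : 0 ≤ D / (N + 1).choose r := by positivity
  have e3 : D / (N + 1).choose r ≤ r / (N + 1) := by
    rw [div_le_div_iff₀ h6 hNr]
    nlinarith
  have e4 : (0 : ℝ) ≤ r / (N + 1) := by positivity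
  rw [abs_le]
  constructor <;> nlinarith [mul_le_of_le_one_left e4 f1, mul_nonneg f0 e4]

lemma sum_powersetCard_erase (Y : Finset X) (n₁ : ℕ) (g : Finset X → ℝ) :
    ∑ y ∈ Y, ∑ Z ∈ (Y.erase y).powersetCard n₁, g Z =
      (Y.card - n₁ : ℝ) * ∑ Z ∈ Y.powersetCard n₁, g Z := by
  have h1 : ∀ y ∈ Y, ∑ Z ∈ (Y.erase y).powersetCard n₁, g Z =
      ∑ Z ∈ Y.powersetCard n₁, if y ∈ Y \ Z then g Z else 0 := by
    intro y hy
    rw [← Finset.sum_filter]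
    refine Finset.sum_congr ?_ fun _ _ => rfl
    ext Z
    simp only [Finset.mem_powersetCard, Finset.mem_filter, Finset.mem_sdiff, hy, true_and,
      Finset.subset_erase]
    tauto
  rw [Finset.sum_congr rfl h1, Finset.sum_comm, Finset.mul_sum]
  refine Finset.sum_congr rfl fun Z hZ => ?_
  obtain ⟨hZY, hZc⟩ := Finset.mem_powersetCard.1 hZ
  have := Finset.card_le_card hZY
  rw [Finset.sum_ite_mem, Finset.inter_eq_right.2 Finset.sdiff_subset, Finset.sum_const,
    Finset.card_sdiff_of_subset hZY, nsmul_eq_mul, Nat.cast_sub this, hZc]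

lemma sum_exp_subsetDensity_le (hE : ∀ g ∈ E, g.card = r) (hr : 1 ≤ r) {n₁ : ℕ} (hn : r ≤ n₁)
    {θ : ℝ} (hθ : 0 ≤ θ) (hθr : θ * r ≤ n₁) (N : ℕ) (hN : n₁ ≤ N) (Y : Finset X)
    (hY : Y.card = N) :
    ∑ Z ∈ Y.powersetCard n₁, Real.exp (θ * (subsetDensity E r Y - subsetDensity E r Z)) ≤
      N.choose n₁ * Real.exp (θ ^ 2 * r ^ 2 * (1 / n₁ - 1 / N)) := by
  induction N, hN using Nat.le_induction generalizing Y with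
  | base =>
    rw [← hY, Finset.powersetCard_self]
    simp
  | succ N hN ih =>
    have hn0 : (0 : ℝ) < n₁ := by exact_mod_cast (by omega : 0 < n₁)
    have hnN : (n₁ : ℝ) ≤ N := by exact_mod_cast hN
    have hN0 : (0 : ℝ) < N := hn0.trans_le hnN
    have hpos : (0 : ℝ) < (N : ℝ) + 1 - n₁ := by linarith
    set B : ℝ := Real.exp (θ ^ 2 * r ^ 2 * (1 / n₁ - 1 / N)) with hB
    set x : X → ℝ := fun y => θ * (subsetDensity E r Y - subsetDensity E r (Y.erase y)) with hx
    have hxabs : ∀ y ∈ Y, |x y| ≤ θ * r / (N + 1) := by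
      intro y hy
      rw [hx, abs_mul, abs_of_nonneg hθ, mul_div_assoc]
      exact mul_le_mul_of_nonneg_left
        (abs_subsetDensity_sub_erase_le hE hr hY (hn.trans hN) hy) hθ
    have hxone : θ * r / (N + 1) ≤ 1 := by
      rw [div_le_one (by linarith)]
      linarith
    have hexp : ∑ y ∈ Y, Real.exp (x y) ≤
        (N + 1) * Real.exp (θ ^ 2 * r ^ 2 * (1 / (N + 1) ^ 2)) := by
      have h1 : ∀ y ∈ Y, Real.exp (x y) ≤ 1 + x y + (θ * r / (N + 1)) ^ 2 := by
        intro y hy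
        have h2 := Real.abs_exp_sub_one_sub_id_le ((hxabs y hy).trans hxone)
        have h3 : x y ^ 2 ≤ (θ * r / (N + 1)) ^ 2 := by
          rw [← sq_abs]
          exact pow_le_pow_left₀ (abs_nonneg _) (hxabs y hy) 2
        linarith [(abs_le.1 h2).2]
      refine (Finset.sum_le_sum h1).trans ?_
      rw [Finset.sum_add_distrib, Finset.sum_add_distrib]
      have h4 : ∑ y ∈ Y, x y = 0 := by
        rw [hx, ← Finset.mul_sum, Finset.sum_sub_distrib,
          sum_subsetDensity_erase hE hY (hn.trans hN), Finset.sum_const, hY, nsmul_eq_mul]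
        push_cast
        ring
      rw [h4, Finset.sum_const, Finset.sum_const, hY, nsmul_eq_mul, nsmul_eq_mul]
      push_cast
      have h5 := Real.add_one_le_exp (θ ^ 2 * r ^ 2 * (1 / ((N : ℝ) + 1) ^ 2))
      have h6 : (θ * r / ((N : ℝ) + 1)) ^ 2 = θ ^ 2 * r ^ 2 * (1 / ((N : ℝ) + 1) ^ 2) := by
        rw [div_pow, mul_pow]; ring
      rw [h6]
      nlinarith
    have h7 : ((N : ℝ) + 1 - n₁) *
        ∑ Z ∈ Y.powersetCard n₁, Real.exp (θ * (subsetDensity E r Y - subsetDensity E r Z)) ≤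
        (N.choose n₁ * B) * ((N + 1) * Real.exp (θ ^ 2 * r ^ 2 * (1 / (N + 1) ^ 2))) := by
      have h8 := sum_powersetCard_erase Y n₁
        (fun Z => Real.exp (θ * (subsetDensity E r Y - subsetDensity E r Z)))
      rw [hY] at h8
      push_cast at h8
      rw [← h8]
      calc _ ≤ ∑ y ∈ Y, Real.exp (x y) * (N.choose n₁ * B) := by
            refine Finset.sum_le_sum fun y hy => ?_
            have h9 := ih (Y.erase y)
              (by rw [Finset.card_erase_of_mem hy, hY, Nat.add_sub_cancel])
            refine le_trans (le_of_eq ?_) (mul_le_mul_of_nonneg_left h9 (Real.exp_pos (x y)).le)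
            rw [Finset.mul_sum]
            refine Finset.sum_congr rfl fun Z _ => ?_
            rw [← Real.exp_add]
            congr 1
            simp only [hx]
            ring
        _ ≤ _ := by
            rw [← Finset.sum_mul, mul_comm]
            exact mul_le_mul_of_nonneg_left hexp (by positivity)
    have h10 : B * Real.exp (θ ^ 2 * r ^ 2 * (1 / (N + 1) ^ 2)) ≤
        Real.exp (θ ^ 2 * r ^ 2 * (1 / n₁ - 1 / ((N + 1 : ℕ) : ℝ))) := by
      rw [hB, ← Real.exp_add, ← mul_add]
      refine Real.exp_le_exp.2 (mul_le_mul_of_nonneg_left ?_ (by positivity))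
      push_cast
      have h11 : (1 : ℝ) / (N + 1) ^ 2 ≤ 1 / N - 1 / (N + 1) := by
        rw [div_sub_div _ _ hN0.ne' (by positivity), div_le_div_iff₀ (by positivity) (by positivity)]
        nlinarith
      linarith
    have h4 : ((N + 1).choose n₁ : ℝ) * (N + 1 - n₁) = N.choose n₁ * (N + 1) := by
      have := Nat.choose_mul_succ_eq N n₁
      rw [← Nat.cast_inj (R := ℝ)] at this
      push_cast [Nat.cast_sub (show n₁ ≤ N + 1 by omega)] at this
      linarith
    refine le_of_mul_le_mul_left (h7.trans ?_) hpos
    calc (N.choose n₁ * B) * ((N + 1) * Real.exp (θ ^ 2 * r ^ 2 * (1 / (N + 1) ^ 2)))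
        = (N.choose n₁ * (N + 1)) * (B * Real.exp (θ ^ 2 * r ^ 2 * (1 / (N + 1) ^ 2))) := by ring
      _ ≤ (N.choose n₁ * (N + 1)) *
          Real.exp (θ ^ 2 * r ^ 2 * (1 / n₁ - 1 / ((N + 1 : ℕ) : ℝ))) :=
          mul_le_mul_of_nonneg_left h10 (by positivity)
      _ = _ := by rw [← h4]; ring

/-- The number of `n₁`-subsets containing unusually few members of `E` is small. -/
lemma card_sparse_subsets_le (hE : ∀ g ∈ E, g.card = r) (hr : 1 ≤ r) {n₁ : ℕ} (hn : r ≤ n₁)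
    {U : Finset X} (hU : n₁ ≤ U.card) {ρ lam : ℝ} (hl0 : 0 ≤ lam) (hl1 : lam ≤ 1)
    (hρ : ρ * U.card.choose r ≤ ((E.filter fun g => g ⊆ U).card : ℝ)) :
    (((U.powersetCard n₁).filter fun Z =>
      ((E.filter fun g => g ⊆ Z).card : ℝ) < (ρ - lam) * n₁.choose r).card : ℝ) ≤
      Real.exp (-(lam ^ 2 * n₁ / (4 * r ^ 2))) * U.card.choose n₁ := by
  have hr0 : (0 : ℝ) < r := by exact_mod_cast hr
  have hr1 : (1 : ℝ) ≤ r := by exact_mod_cast hr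
  have hn0 : (0 : ℝ) < n₁ := by exact_mod_cast (by omega : 0 < n₁)
  have hUpos : (0 : ℝ) < U.card.choose r := by exact_mod_cast Nat.choose_pos (hn.trans hU)
  have hnpos : (0 : ℝ) < n₁.choose r := by exact_mod_cast Nat.choose_pos hn
  set θ : ℝ := lam * n₁ / (2 * r ^ 2) with hθ
  have hθ0 : 0 ≤ θ := by positivity
  have hθr : θ * r ≤ n₁ := by
    rw [hθ, div_mul_eq_mul_div, div_le_iff₀ (by positivity)]
    have : lam * r ≤ 2 * r ^ 2 := by nlinarith
    nlinarith
  have hmgf := sum_exp_subsetDensity_le hE hr hn hθ0 hθr U.card hU U rfl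
  have hfU : ρ ≤ subsetDensity E r U := by
    rw [subsetDensity, le_div_iff₀ hUpos]
    exact hρ
  have hlow : ∀ Z ∈ (U.powersetCard n₁).filter fun Z =>
      ((E.filter fun g => g ⊆ Z).card : ℝ) < (ρ - lam) * n₁.choose r,
      Real.exp (θ * lam) ≤ Real.exp (θ * (subsetDensity E r U - subsetDensity E r Z)) := by
    intro Z hZ
    obtain ⟨hZ1, hZ2⟩ := Finset.mem_filter.1 hZ
    have : subsetDensity E r Z < ρ - lam := by
      rw [subsetDensity, (Finset.mem_powersetCard.1 hZ1).2, div_lt_iff₀ hnpos]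
      exact hZ2
    exact Real.exp_le_exp.2 (mul_le_mul_of_nonneg_left (by linarith) hθ0)
  have h1 := Finset.card_nsmul_le_sum _ _ _ hlow
  rw [nsmul_eq_mul] at h1
  have h2 := h1.trans ((Finset.sum_le_sum_of_subset_of_nonneg (Finset.filter_subset _ _)
    fun _ _ _ => (Real.exp_pos _).le).trans hmgf)
  have h3 : θ ^ 2 * r ^ 2 * (1 / n₁ - 1 / (U.card : ℝ)) ≤ θ ^ 2 * r ^ 2 * (1 / n₁) := by
    refine mul_le_mul_of_nonneg_left ?_ (by positivity)
    have : (0 : ℝ) ≤ 1 / (U.card : ℝ) := by positivity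
    linarith
  have h4 : θ ^ 2 * r ^ 2 * (1 / n₁) = θ * lam - lam ^ 2 * n₁ / (4 * r ^ 2) := by
    rw [hθ]
    field_simp
    ring
  have h5 := h2.trans (mul_le_mul_of_nonneg_left (Real.exp_le_exp.2 (h3.trans h4.le))
    (Nat.cast_nonneg _))
  rw [sub_eq_add_neg (θ * lam), Real.exp_add] at h5
  refine le_of_mul_le_mul_right ?_ (Real.exp_pos (θ * lam))
  linarith

end Concentration

section SpreadFactor

variable {𝒱 𝒞 : Type*} {s : ℕ}

/-- A transversal `F`-factor of the system `H` induced on the vertices `V` and the colours `C`, whose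
copies of `F` are indexed by `J`: the map `σ` sends a vertex to its copy and its position therein,
the map `κ` sends a colour to its copy and its edge of `F`. -/
structure IsSlotFactor (F : Finset (Finset (Fin s))) (H : 𝒞 → Finset (Finset 𝒱)) (V : Finset 𝒱)
    (C : Finset 𝒞) (J : Finset ℕ) (σ : 𝒱 → ℕ × Fin s) (κ : 𝒞 → ℕ × Finset (Fin s)) : Prop where
  bijOn_vertex : Set.BijOn σ V (J ×ˢ (Finset.univ : Finset (Fin s)) : Finset (ℕ × Fin s))
  bijOn_colour : Set.BijOn κ C (J ×ˢ F : Finset (ℕ × Finset (Fin s)))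
  edge_mem : ∀ c ∈ C, (V.filter fun x => (σ x).1 = (κ c).1 ∧ (σ x).2 ∈ (κ c).2) ∈ H c

/-- There is a random transversal `F`-factor in which any partial assignment of vertices and colours
to slots is about as likely as under a uniformly random assignment. -/
def HasSpreadFactor (F : Finset (Finset (Fin s))) (H : 𝒞 → Finset (Finset 𝒱)) (V : Finset 𝒱)
    (C : Finset 𝒞) (J : Finset ℕ) (K : ℝ) : Prop :=
  ∃ (Ω : Type) (_ : Fintype Ω) (w : Ω → ℝ) (σ : Ω → 𝒱 → ℕ × Fin s)
    (κ : Ω → 𝒞 → ℕ × Finset (Fin s)),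
    (∀ ω, 0 ≤ w ω) ∧ ∑ ω, w ω = 1 ∧ (∀ ω, IsSlotFactor F H V C J (σ ω) (κ ω)) ∧
    ∀ P ⊆ V, ∀ Q ⊆ C, ∀ (g : 𝒱 → ℕ × Fin s) (h : 𝒞 → ℕ × Finset (Fin s)),
      (∑ ω with (∀ x ∈ P, σ ω x = g x) ∧ ∀ c ∈ Q, κ ω c = h c, w ω) *
        (V.card.descFactorial P.card * C.card.descFactorial Q.card) ≤ K ^ (P.card + Q.card)

lemma HasSpreadFactor.mono {F : Finset (Finset (Fin s))} {H : 𝒞 → Finset (Finset 𝒱)} {V : Finset 𝒱}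
    {C : Finset 𝒞} {J : Finset ℕ} {K K' : ℝ} (h : HasSpreadFactor F H V C J K) (hK : 0 ≤ K)
    (hKK' : K ≤ K') : HasSpreadFactor F H V C J K' := by
  obtain ⟨Ω, i, w, σ, κ, h1, h2, h3, h4⟩ := h
  exact ⟨Ω, i, w, σ, κ, h1, h2, h3, fun P hP Q hQ g h =>
    (h4 P hP Q hQ g h).trans (pow_le_pow_left₀ hK hKK' _)⟩

variable [DecidableEq 𝒱] [DecidableEq 𝒞]

lemma bijOn_piecewise {α β : Type*} [DecidableEq α] [DecidableEq β] {A A₁ : Finset α}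
    {B B₁ B₂ : Finset β} (hA : A₁ ⊆ A) (hB : B₁ ∪ B₂ = B) (hd : Disjoint B₁ B₂) {f₁ f₂ : α → β}
    (h₁ : Set.BijOn f₁ A₁ B₁) (h₂ : Set.BijOn f₂ (A \ A₁ : Finset α) B₂) :
    Set.BijOn (fun x => if x ∈ A₁ then f₁ x else f₂ x) A B := by
  have e1 : Set.BijOn (fun x => if x ∈ A₁ then f₁ x else f₂ x) A₁ B₁ :=
    h₁.congr fun x hx => (if_pos hx).symm
  have e2 : Set.BijOn (fun x => if x ∈ A₁ then f₁ x else f₂ x) (A \ A₁ : Finset α) B₂ :=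
    h₂.congr fun x hx => (if_neg (Finset.mem_sdiff.1 hx).2).symm
  have e3 : (A : Set α) = (A₁ : Set α) ∪ ((A \ A₁ : Finset α) : Set α) := by
    rw [← Finset.coe_union, Finset.union_sdiff_of_subset hA]
  have e4 : (B : Set β) = (B₁ : Set β) ∪ (B₂ : Set β) := by rw [← hB, Finset.coe_union]
  rw [e3, e4]
  refine e1.union e2 ((Set.injOn_union ?_).2 ⟨e1.injOn, e2.injOn, fun a ha b hb hab => ?_⟩)
  · rw [Finset.disjoint_coe]
    exact Finset.disjoint_sdiff
  · have h3 := e1.mapsTo ha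
    have h4 := e2.mapsTo hb
    rw [← hab] at h4
    exact Finset.disjoint_left.1 hd h3 h4

lemma IsSlotFactor.glue {F : Finset (Finset (Fin s))} {H : 𝒞 → Finset (Finset 𝒱)}
    {V V₁ : Finset 𝒱} {C C₁ : Finset 𝒞} {J J₁ : Finset ℕ} (hV : V₁ ⊆ V) (hC : C₁ ⊆ C)
    (hJ : J₁ ⊆ J) {σ₁ σ₂ : 𝒱 → ℕ × Fin s} {κ₁ κ₂ : 𝒞 → ℕ × Finset (Fin s)}
    (h₁ : IsSlotFactor F H V₁ C₁ J₁ σ₁ κ₁)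
    (h₂ : IsSlotFactor F H (V \ V₁) (C \ C₁) (J \ J₁) σ₂ κ₂) :
    IsSlotFactor F H V C J (fun x => if x ∈ V₁ then σ₁ x else σ₂ x)
      (fun c => if c ∈ C₁ then κ₁ c else κ₂ c) := by
  refine ⟨bijOn_piecewise hV ?_ ?_ h₁.bijOn_vertex h₂.bijOn_vertex,
    bijOn_piecewise hC ?_ ?_ h₁.bijOn_colour h₂.bijOn_colour, fun c hc => ?_⟩
  · rw [← Finset.union_product, Finset.union_sdiff_of_subset hJ]
  · exact Finset.disjoint_product.2 (Or.inl Finset.disjoint_sdiff)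
  · rw [← Finset.union_product, Finset.union_sdiff_of_subset hJ]
  · exact Finset.disjoint_product.2 (Or.inl Finset.disjoint_sdiff)
  · have m1 : ∀ x ∈ V₁, (σ₁ x).1 ∈ J₁ := fun x hx =>
      (Finset.mem_product.1 (h₁.bijOn_vertex.mapsTo hx)).1
    have m2 : ∀ x ∈ V \ V₁, (σ₂ x).1 ∉ J₁ := fun x hx =>
      (Finset.mem_sdiff.1 (Finset.mem_product.1 (h₂.bijOn_vertex.mapsTo hx)).1).2
    by_cases hc1 : c ∈ C₁
    · have m3 : (κ₁ c).1 ∈ J₁ := (Finset.mem_product.1 (h₁.bijOn_colour.mapsTo hc1)).1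
      convert h₁.edge_mem c hc1 using 1
      ext x
      simp only [Finset.mem_filter, if_pos hc1]
      by_cases hx : x ∈ V₁
      · simp [hx, hV hx]
      · simp only [hx, if_false, false_and, iff_false, not_and]
        intro hxV hσ
        exact absurd (hσ ▸ m3) (m2 x (Finset.mem_sdiff.2 ⟨hxV, hx⟩))
    · have hc2 : c ∈ C \ C₁ := Finset.mem_sdiff.2 ⟨hc, hc1⟩
      have m3 : (κ₂ c).1 ∉ J₁ :=
        (Finset.mem_sdiff.1 (Finset.mem_product.1 (h₂.bijOn_colour.mapsTo hc2)).1).2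
      convert h₂.edge_mem c hc2 using 1
      ext x
      simp only [Finset.mem_filter, if_neg hc1]
      by_cases hx : x ∈ V₁
      · simp only [hx, if_true, Finset.mem_sdiff, not_true, and_false, false_and, iff_false,
          not_and]
        intro _ hσ
        exact absurd (hσ ▸ m1 x hx) m3
      · simp [hx]

lemma choose_mul_descFactorial_le {N₁ N₂ a₁ a₂ : ℕ} (h₁ : a₁ ≤ N₁) :
    (N₁ + N₂ - (a₁ + a₂)).choose (N₁ - a₁) * (N₁ + N₂).descFactorial (a₁ + a₂) ≤
      (N₁ + N₂).choose N₁ * (N₁.descFactorial a₁ * N₂.descFactorial a₂) := by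
  rcases lt_or_ge N₂ a₂ with h | h₂
  · rcases lt_or_ge (N₁ + N₂) (a₁ + a₂) with h' | h'
    · rw [Nat.descFactorial_of_lt h', mul_zero]
      exact Nat.zero_le _
    · rw [Nat.choose_eq_zero_of_lt (by omega), zero_mul]
      exact Nat.zero_le _
  refine le_of_eq ?_
  have e1 := Nat.factorial_mul_descFactorial (show a₁ + a₂ ≤ N₁ + N₂ by omega)
  have e2 := Nat.factorial_mul_descFactorial h₁
  have e3 := Nat.factorial_mul_descFactorial h₂
  have e4 := Nat.choose_mul_factorial_mul_factorial (show N₁ ≤ N₁ + N₂ by omega)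
  have e5 := Nat.choose_mul_factorial_mul_factorial
    (show N₁ - a₁ ≤ N₁ + N₂ - (a₁ + a₂) by omega)
  rw [show N₁ + N₂ - N₁ = N₂ by omega] at e4
  rw [show N₁ + N₂ - (a₁ + a₂) - (N₁ - a₁) = N₂ - a₂ by omega] at e5
  have hpos : 0 < (N₁ - a₁).factorial * (N₂ - a₂).factorial := by positivity
  refine Nat.eq_of_mul_eq_mul_right hpos ?_
  calc _ = ((N₁ + N₂ - (a₁ + a₂)).choose (N₁ - a₁) * (N₁ - a₁).factorial * (N₂ - a₂).factorial) *
        (N₁ + N₂).descFactorial (a₁ + a₂) := by ring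
    _ = (N₁ + N₂).choose N₁ * N₁.factorial * N₂.factorial := by rw [e5, e1, e4]
    _ = _ := by rw [← e2, ← e3]; ring

lemma card_consistent_subsets_mul_le {α : Type*} [DecidableEq α] {A P P₁ : Finset α} (hP : P ⊆ A)
    (hP₁ : P₁ ⊆ P) {N₁ N₂ : ℕ} (hA : A.card = N₁ + N₂) :
    ((A.powersetCard N₁).filter fun B => ∀ x ∈ P, x ∈ B ↔ x ∈ P₁).card *
      A.card.descFactorial P.card ≤
      A.card.choose N₁ * (N₁.descFactorial P₁.card * N₂.descFactorial (P \ P₁).card) := by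
  have hcard : P.card = P₁.card + (P \ P₁).card := by
    have := Finset.card_sdiff_add_card_eq_card hP₁
    omega
  rcases lt_or_ge N₁ P₁.card with h | h
  · have : ((A.powersetCard N₁).filter fun B => ∀ x ∈ P, x ∈ B ↔ x ∈ P₁) = ∅ := by
      rw [Finset.filter_eq_empty_iff]
      intro B hB hcon
      have h1 : P₁ ⊆ B := fun x hx => (hcon x (hP₁ hx)).2 hx
      have h2 := Finset.card_le_card h1
      rw [(Finset.mem_powersetCard.1 hB).2] at h2
      omega
    simp [this]
  · have h1 : ((A.powersetCard N₁).filter fun B => ∀ x ∈ P, x ∈ B ↔ x ∈ P₁).card ≤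
        (A.card - P.card).choose (N₁ - P₁.card) := by
      rw [← Finset.card_sdiff_of_subset hP, ← Finset.card_powersetCard]
      refine Finset.card_le_card_of_injOn (fun B => B \ P₁) ?_ ?_
      · intro B hB
        rw [Finset.mem_coe, Finset.mem_filter, Finset.mem_powersetCard] at hB
        obtain ⟨⟨hBA, hBc⟩, hcon⟩ := hB
        rw [Finset.mem_coe, Finset.mem_powersetCard]
        refine ⟨fun x hx => ?_, ?_⟩
        · rw [Finset.mem_sdiff] at hx ⊢
          exact ⟨hBA hx.1, fun hxP => hx.2 ((hcon x hxP).1 hx.1)⟩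
        · rw [Finset.card_sdiff_of_subset fun x hx => (hcon x (hP₁ hx)).2 hx, hBc]
      · intro B hB B' hB' hBB'
        rw [Finset.mem_coe, Finset.mem_filter] at hB hB'
        have e1 : P₁ ⊆ B := fun x hx => (hB.2 x (hP₁ hx)).2 hx
        have e2 : P₁ ⊆ B' := fun x hx => (hB'.2 x (hP₁ hx)).2 hx
        rw [← Finset.sdiff_union_of_subset e1, ← Finset.sdiff_union_of_subset e2]
        exact congrArg (· ∪ P₁) hBB'
    refine (Nat.mul_le_mul_right _ h1).trans ?_
    rw [hA, hcard]
    exact choose_mul_descFactorial_le h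

set_option maxHeartbeats 2000000 in
/-- Spread random factors on the two sides of a random split combine to a spread random factor. -/
lemma HasSpreadFactor.of_split {F : Finset (Finset (Fin s))} {H : 𝒞 → Finset (Finset 𝒱)}
    {V : Finset 𝒱} {C : Finset 𝒞} {J J₁ : Finset ℕ} (hJ : J₁ ⊆ J) {N₁ N₂ T₁ T₂ : ℕ}
    (hV : V.card = N₁ + N₂) (hC : C.card = T₁ + T₂) {G : Finset (Finset 𝒱)}
    (hG : G ⊆ V.powersetCard N₁) {K K' η : ℝ} (hK : 0 ≤ K) (hη0 : 0 ≤ η) (hη : η < 1)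
    (hGcard : (1 - η) * V.card.choose N₁ ≤ G.card)
    (hKK' : K ≤ K' * (1 - η))
    (h₁ : ∀ V₁ ∈ G, ∀ C₁ ∈ C.powersetCard T₁, HasSpreadFactor F H V₁ C₁ J₁ K)
    (h₂ : ∀ V₁ ∈ G, ∀ C₁ ∈ C.powersetCard T₁, HasSpreadFactor F H (V \ V₁) (C \ C₁) (J \ J₁) K) :
    HasSpreadFactor F H V C J K' := by
  classical
  set PC := C.powersetCard T₁ with hPC
  have h₁' : ∀ g : G × PC, HasSpreadFactor F H g.1.1 g.2.1 J₁ K :=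
    fun g => h₁ _ g.1.2 _ g.2.2
  have h₂' : ∀ g : G × PC, HasSpreadFactor F H (V \ g.1.1) (C \ g.2.1) (J \ J₁) K :=
    fun g => h₂ _ g.1.2 _ g.2.2
  choose Ω₁ i₁ w₁ σ₁ κ₁ w₁nn w₁sum fac₁ spr₁ using h₁'
  choose Ω₂ i₂ w₂ σ₂ κ₂ w₂nn w₂sum fac₂ spr₂ using h₂'
  have hη' : 0 < 1 - η := by linarith
  have hchV : (0 : ℝ) < V.card.choose N₁ := by
    exact_mod_cast Nat.choose_pos (by omega)
  have hGpos : (0 : ℝ) < G.card := (mul_pos hη' hchV).trans_le hGcard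
  have hPCcard : PC.card = C.card.choose T₁ := Finset.card_powersetCard _ _
  have hPCpos : (0 : ℝ) < PC.card := by
    rw [hPCcard]
    exact_mod_cast Nat.choose_pos (by omega)
  set z : ℝ := 1 / (G.card * PC.card) with hz
  have hz0 : 0 < z := by positivity
  clear_value z
  -- transport along an equivalence so that the index type lives in `Type`
  obtain ⟨eqG⟩ : Nonempty (G × PC ≃ Fin (Fintype.card (G × PC))) := ⟨Fintype.equivFin _⟩
  set e := eqG.symm with he
  clear_value e
  have hsum : ∑ ω : (Σ i : Fin (Fintype.card (G × PC)), Ω₁ (e i) × Ω₂ (e i)),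
      z * (w₁ _ ω.2.1 * w₂ _ ω.2.2) = 1 := by
    rw [Fintype.sum_sigma]
    have h3 : ∀ i, ∑ ω : Ω₁ (e i) × Ω₂ (e i), z * (w₁ _ ω.1 * w₂ _ ω.2) = z := by
      intro i
      rw [← Finset.mul_sum, Fintype.sum_prod_type]
      simp_rw [← Finset.mul_sum]
      rw [w₂sum, ← Finset.sum_mul, w₁sum]
      simp
    rw [Finset.sum_congr rfl fun i _ => h3 i]
    simp only [Finset.sum_const, Finset.card_univ, Fintype.card_fin, Fintype.card_prod,
      Fintype.card_coe, nsmul_eq_mul, hz]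
    push_cast
    field_simp
  refine ⟨Σ i : Fin (Fintype.card (G × PC)), Ω₁ (e i) × Ω₂ (e i), inferInstance,
    fun ω => z * (w₁ _ ω.2.1 * w₂ _ ω.2.2),
    fun ω x => if x ∈ (e ω.1).1.1 then σ₁ _ ω.2.1 x else σ₂ _ ω.2.2 x,
    fun ω c => if c ∈ (e ω.1).2.1 then κ₁ _ ω.2.1 c else κ₂ _ ω.2.2 c,
    fun ω => mul_nonneg hz0.le (mul_nonneg (w₁nn _ _) (w₂nn _ _)), hsum, ?_, ?_⟩
  · exact fun ω => (fac₁ _ ω.2.1).glue (Finset.mem_powersetCard.1 (hG (e ω.1).1.2)).1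
      (Finset.mem_powersetCard.1 (e ω.1).2.2).1 hJ (fac₂ _ ω.2.2)
  · intro P hP Q hQ g h
    set P₁ := P.filter fun x => (g x).1 ∈ J₁ with hP₁
    set Q₁ := Q.filter fun c => (h c).1 ∈ J₁ with hQ₁
    set a := P.card with ha
    set b := Q.card with hb
    set XV : ℝ := N₁.descFactorial P₁.card * N₂.descFactorial (P \ P₁).card with hXV
    set XC : ℝ := T₁.descFactorial Q₁.card * T₂.descFactorial (Q \ Q₁).card with hXC
    clear_value XV XC
    have hcV := card_consistent_subsets_mul_le hP (Finset.filter_subset _ _ : P₁ ⊆ P) hV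
    have hcC := card_consistent_subsets_mul_le hQ (Finset.filter_subset _ _ : Q₁ ⊆ Q) hC
    have haP : P₁.card + (P \ P₁).card = a := by
      rw [add_comm]
      exact Finset.card_sdiff_add_card_eq_card (Finset.filter_subset _ _)
    have hbQ : Q₁.card + (Q \ Q₁).card = b := by
      rw [add_comm]
      exact Finset.card_sdiff_add_card_eq_card (Finset.filter_subset _ _)
    set conV : Finset 𝒱 → Prop := fun V₁ => ∀ x ∈ P, x ∈ V₁ ↔ x ∈ P₁ with hconV
    set conC : Finset 𝒞 → Prop := fun C₁ => ∀ c ∈ Q, c ∈ C₁ ↔ c ∈ Q₁ with hconC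
    have hinner : ∀ j : G × PC, ∑ ω : Ω₁ j × Ω₂ j,
        (if (∀ x ∈ P, (if x ∈ j.1.1 then σ₁ _ ω.1 x else σ₂ _ ω.2 x) = g x) ∧
          ∀ c ∈ Q, (if c ∈ j.2.1 then κ₁ _ ω.1 c else κ₂ _ ω.2 c) = h c
          then z * (w₁ _ ω.1 * w₂ _ ω.2) else 0) ≤
        (z * (K ^ (a + b) / (XV * XC))) *
          ((if conV j.1.1 then 1 else 0) * (if conC j.2.1 then 1 else 0)) := by
      intro j
      obtain ⟨hj1, hj1c⟩ := Finset.mem_powersetCard.1 (hG j.1.2)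
      obtain ⟨hj2, hj2c⟩ := Finset.mem_powersetCard.1 j.2.2
      have hagree : ∀ ω : Ω₁ j × Ω₂ j,
          ((∀ x ∈ P, (if x ∈ j.1.1 then σ₁ _ ω.1 x else σ₂ _ ω.2 x) = g x) ∧
          ∀ c ∈ Q, (if c ∈ j.2.1 then κ₁ _ ω.1 c else κ₂ _ ω.2 c) = h c) →
          conV j.1.1 ∧ conC j.2.1 ∧
          ((∀ x ∈ P₁, σ₁ _ ω.1 x = g x) ∧ ∀ c ∈ Q₁, κ₁ _ ω.1 c = h c) ∧
          ((∀ x ∈ P \ P₁, σ₂ _ ω.2 x = g x) ∧ ∀ c ∈ Q \ Q₁, κ₂ _ ω.2 c = h c) := by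
        rintro ω ⟨hv, hc⟩
        have cV : conV j.1.1 := by
          intro x hx
          have h5 := hv x hx
          simp only [hP₁, Finset.mem_filter, hx, true_and]
          by_cases hxj : x ∈ j.1.1
          · rw [if_pos hxj] at h5
            have := (Finset.mem_product.1 ((fac₁ j ω.1).bijOn_vertex.mapsTo hxj)).1
            rw [h5] at this
            exact ⟨fun _ => this, fun _ => hxj⟩
          · rw [if_neg hxj] at h5
            have h6 : x ∈ V \ j.1.1 := Finset.mem_sdiff.2 ⟨hP hx, hxj⟩
            have := (Finset.mem_product.1 ((fac₂ j ω.2).bijOn_vertex.mapsTo h6)).1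
            rw [h5] at this
            exact ⟨fun h => absurd h hxj, fun h => absurd h (Finset.mem_sdiff.1 this).2⟩
        have cC : conC j.2.1 := by
          intro x hx
          have h5 := hc x hx
          simp only [hQ₁, Finset.mem_filter, hx, true_and]
          by_cases hxj : x ∈ j.2.1
          · rw [if_pos hxj] at h5
            have := (Finset.mem_product.1 ((fac₁ j ω.1).bijOn_colour.mapsTo hxj)).1
            rw [h5] at this
            exact ⟨fun _ => this, fun _ => hxj⟩
          · rw [if_neg hxj] at h5
            have h6 : x ∈ C \ j.2.1 := Finset.mem_sdiff.2 ⟨hQ hx, hxj⟩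
            have := (Finset.mem_product.1 ((fac₂ j ω.2).bijOn_colour.mapsTo h6)).1
            rw [h5] at this
            exact ⟨fun h => absurd h hxj, fun h => absurd h (Finset.mem_sdiff.1 this).2⟩
        refine ⟨cV, cC, ⟨fun x hx => ?_, fun x hx => ?_⟩, ⟨fun x hx => ?_, fun x hx => ?_⟩⟩
        · have hxP := (Finset.mem_filter.1 hx).1
          rw [← hv x hxP, if_pos ((cV x hxP).2 hx)]
        · have hxP := (Finset.mem_filter.1 hx).1
          rw [← hc x hxP, if_pos ((cC x hxP).2 hx)]
        · obtain ⟨hxP, hx1⟩ := Finset.mem_sdiff.1 hx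
          rw [← hv x hxP, if_neg fun h => hx1 ((cV x hxP).1 h)]
        · obtain ⟨hxP, hx1⟩ := Finset.mem_sdiff.1 hx
          rw [← hc x hxP, if_neg fun h => hx1 ((cC x hxP).1 h)]
      by_cases hcon : conV j.1.1 ∧ conC j.2.1
      · obtain ⟨hconV', hconC'⟩ := hcon
        rw [if_pos hconV', if_pos hconC', one_mul, mul_one]
        have sP₁ : P₁ ⊆ j.1.1 := fun x hx => (hconV' x (Finset.mem_filter.1 hx).1).2 hx
        have sQ₁ : Q₁ ⊆ j.2.1 := fun x hx => (hconC' x (Finset.mem_filter.1 hx).1).2 hx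
        have sP₂ : P \ P₁ ⊆ V \ j.1.1 := fun x hx => by
          obtain ⟨hxP, hx1⟩ := Finset.mem_sdiff.1 hx
          exact Finset.mem_sdiff.2 ⟨hP hxP, fun h => hx1 ((hconV' x hxP).1 h)⟩
        have sQ₂ : Q \ Q₁ ⊆ C \ j.2.1 := fun x hx => by
          obtain ⟨hxP, hx1⟩ := Finset.mem_sdiff.1 hx
          exact Finset.mem_sdiff.2 ⟨hQ hxP, fun h => hx1 ((hconC' x hxP).1 h)⟩
        have s₁ := spr₁ j P₁ sP₁ Q₁ sQ₁ g h
        have s₂ := spr₂ j (P \ P₁) sP₂ (Q \ Q₁) sQ₂ g h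
        have c2 : (V \ j.1.1).card = N₂ := by rw [Finset.card_sdiff_of_subset hj1, hV, hj1c]; omega
        have c2' : (C \ j.2.1).card = T₂ := by
          rw [Finset.card_sdiff_of_subset hj2, hC, hj2c]; omega
        rw [hj1c, hj2c] at s₁
        rw [c2, c2'] at s₂
        have d1 : 0 < N₁.descFactorial P₁.card := by
          rw [Nat.pos_iff_ne_zero, ne_eq, Nat.descFactorial_eq_zero_iff_lt, not_lt, ← hj1c]
          exact Finset.card_le_card sP₁
        have d2 : 0 < N₂.descFactorial (P \ P₁).card := by
          rw [Nat.pos_iff_ne_zero, ne_eq, Nat.descFactorial_eq_zero_iff_lt, not_lt, ← c2]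
          exact Finset.card_le_card sP₂
        have d3 : 0 < T₁.descFactorial Q₁.card := by
          rw [Nat.pos_iff_ne_zero, ne_eq, Nat.descFactorial_eq_zero_iff_lt, not_lt, ← hj2c]
          exact Finset.card_le_card sQ₁
        have d4 : 0 < T₂.descFactorial (Q \ Q₁).card := by
          rw [Nat.pos_iff_ne_zero, ne_eq, Nat.descFactorial_eq_zero_iff_lt, not_lt, ← c2']
          exact Finset.card_le_card sQ₂
        have hX : 0 < XV * XC := by rw [hXV, hXC]; positivity
        set p₁ := ∑ ω with (∀ x ∈ P₁, σ₁ j ω x = g x) ∧ ∀ c ∈ Q₁, κ₁ j ω c = h c, w₁ j ω with hp₁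
        set p₂ := ∑ ω with (∀ x ∈ P \ P₁, σ₂ j ω x = g x) ∧ ∀ c ∈ Q \ Q₁, κ₂ j ω c = h c, w₂ j ω
          with hp₂
        have hp₂0 : 0 ≤ p₂ := Finset.sum_nonneg fun ω _ => w₂nn j ω
        have hpp : p₁ * p₂ ≤ K ^ (a + b) / (XV * XC) := by
          rw [le_div_iff₀ hX]
          calc p₁ * p₂ * (XV * XC) = (p₁ * (N₁.descFactorial P₁.card * T₁.descFactorial Q₁.card)) *
                (p₂ * (N₂.descFactorial (P \ P₁).card * T₂.descFactorial (Q \ Q₁).card)) := by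
                rw [hXV, hXC]; ring
            _ ≤ K ^ (P₁.card + Q₁.card) * K ^ ((P \ P₁).card + (Q \ Q₁).card) :=
                mul_le_mul s₁ s₂ (by positivity) (by positivity)
            _ = _ := by rw [← pow_add]; congr 1; omega
        refine le_trans ?_ (mul_le_mul_of_nonneg_left hpp hz0.le)
        rw [hp₁, hp₂, Finset.sum_filter, Finset.sum_filter, Finset.sum_mul_sum, Finset.mul_sum,
          Fintype.sum_prod_type]
        refine Finset.sum_le_sum fun ω₁ _ => ?_
        rw [Finset.mul_sum]
        refine Finset.sum_le_sum fun ω₂ _ => ?_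
        by_cases hag : (∀ x ∈ P, (if x ∈ j.1.1 then σ₁ _ ω₁ x else σ₂ _ ω₂ x) = g x) ∧
          ∀ c ∈ Q, (if c ∈ j.2.1 then κ₁ _ ω₁ c else κ₂ _ ω₂ c) = h c
        · obtain ⟨-, -, g1, g2⟩ := hagree (ω₁, ω₂) hag
          rw [if_pos hag, if_pos g1, if_pos g2]
        · rw [if_neg hag]
          have := w₁nn j ω₁
          have := w₂nn j ω₂
          positivity
      · have hz' : ((if conV j.1.1 then 1 else 0) * (if conC j.2.1 then 1 else 0) : ℝ) = 0 := by
          by_cases hv : conV j.1.1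
          · rw [if_neg fun hc => hcon ⟨hv, hc⟩, mul_zero]
          · rw [if_neg hv, zero_mul]
        rw [hz', mul_zero]
        refine (Finset.sum_eq_zero fun ω _ => if_neg fun hag => ?_).le
        obtain ⟨g1, g2, -⟩ := hagree ω hag
        exact hcon ⟨g1, g2⟩
    rcases Nat.eq_zero_or_pos (a + b) with hab | hab
    · have ha0 : a = 0 := by omega
      have hb0 : b = 0 := by omega
      rw [ha0, hb0]
      simp only [Nat.descFactorial_zero, Nat.cast_one, mul_one, add_zero, pow_zero]
      rw [← hsum]
      exact Finset.sum_le_sum_of_subset_of_nonneg (Finset.filter_subset _ _) fun ω _ _ =>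
        mul_nonneg hz0.le (mul_nonneg (w₁nn _ _) (w₂nn _ _))
    set cV : ℝ := (((V.powersetCard N₁).filter conV).card : ℝ) with hcVdef
    set cC : ℝ := ((PC.filter conC).card : ℝ) with hcCdef
    clear_value cV cC
    have hcV' : cV * V.card.descFactorial a ≤ V.card.choose N₁ * XV := by
      rw [hcVdef, hXV]
      exact_mod_cast hcV
    have hcC' : cC * C.card.descFactorial b ≤ C.card.choose T₁ * XC := by
      rw [hcCdef, hXC]
      exact_mod_cast hcC
    have hcV0 : 0 ≤ cV := by rw [hcVdef]; positivity
    have hcC0 : 0 ≤ cC := by rw [hcCdef]; positivity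
    have hXV0 : 0 ≤ XV := by rw [hXV]; positivity
    have hXC0 : 0 ≤ XC := by rw [hXC]; positivity
    have hsV : ∑ V₁ : G, (if conV V₁.1 then (1 : ℝ) else 0) ≤ cV := by
      rw [Finset.sum_coe_sort G fun V₁ => if conV V₁ then (1 : ℝ) else 0, Finset.sum_boole, hcVdef]
      exact_mod_cast Finset.card_le_card (Finset.filter_subset_filter _ hG)
    have hsC : ∑ C₁ : PC, (if conC C₁.1 then (1 : ℝ) else 0) = cC := by
      rw [Finset.sum_coe_sort PC fun C₁ => if conC C₁ then (1 : ℝ) else 0, Finset.sum_boole, hcCdef]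
    have hK'0 : 0 ≤ K' := by
      by_contra hneg
      have := mul_neg_of_neg_of_pos (not_le.1 hneg) hη'
      linarith
    have hprob : ∑ ω : (Σ i : Fin (Fintype.card (G × PC)), Ω₁ (e i) × Ω₂ (e i)) with
        (∀ x ∈ P, (if x ∈ (e ω.1).1.1 then σ₁ _ ω.2.1 x else σ₂ _ ω.2.2 x) = g x) ∧
        ∀ c ∈ Q, (if c ∈ (e ω.1).2.1 then κ₁ _ ω.2.1 c else κ₂ _ ω.2.2 c) = h c,
        z * (w₁ _ ω.2.1 * w₂ _ ω.2.2) ≤ (z * (K ^ (a + b) / (XV * XC))) * (cV * cC) := by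
      rw [Finset.sum_filter, Fintype.sum_sigma]
      refine (Finset.sum_le_sum fun i _ => hinner (e i)).trans ?_
      rw [Equiv.sum_comp e fun j : G × PC => (z * (K ^ (a + b) / (XV * XC))) *
          ((if conV j.1.1 then 1 else 0) * (if conC j.2.1 then 1 else 0)), ← Finset.mul_sum,
        Fintype.sum_prod_type]
      refine mul_le_mul_of_nonneg_left ?_ (by positivity)
      refine (Finset.sum_mul_sum _ _ (fun V₁ : G => if conV V₁.1 then (1 : ℝ) else 0)
        (fun C₁ : PC => if conC C₁.1 then (1 : ℝ) else 0)).symm.le.trans ?_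
      rw [hsC]
      exact mul_le_mul_of_nonneg_right hsV (by positivity)
    have hzz : z * (V.card.choose N₁ * C.card.choose T₁) * (1 - η) ≤ 1 := by
      rw [hz, ← hPCcard, div_mul_eq_mul_div, div_mul_eq_mul_div, div_le_one (by positivity)]
      nlinarith [mul_le_mul_of_nonneg_right hGcard hPCpos.le]
    have hXX : XV * XC / (XV * XC) ≤ 1 := div_self_le_one _
    calc _ ≤ (z * (K ^ (a + b) / (XV * XC))) * (cV * cC) *
          (V.card.descFactorial a * C.card.descFactorial b) :=
          mul_le_mul_of_nonneg_right hprob (by positivity)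
      _ = (z * (K ^ (a + b) / (XV * XC))) *
          ((cV * V.card.descFactorial a) * (cC * C.card.descFactorial b)) := by ring
      _ ≤ (z * (K ^ (a + b) / (XV * XC))) *
          ((V.card.choose N₁ * XV) * (C.card.choose T₁ * XC)) :=
          mul_le_mul_of_nonneg_left (mul_le_mul hcV' hcC' (by positivity) (by positivity))
            (by positivity)
      _ = (z * (V.card.choose N₁ * C.card.choose T₁)) * K ^ (a + b) * (XV * XC / (XV * XC)) := by
          ring
      _ ≤ (z * (V.card.choose N₁ * C.card.choose T₁)) * K ^ (a + b) :=
          mul_le_of_le_one_right (by positivity) hXX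
      _ ≤ (z * (V.card.choose N₁ * C.card.choose T₁)) * (K' ^ (a + b) * (1 - η)) := by
          refine mul_le_mul_of_nonneg_left ?_ (by positivity)
          refine (pow_le_pow_left₀ hK hKK' _).trans ?_
          rw [mul_pow]
          refine mul_le_mul_of_nonneg_left ?_ (by positivity)
          exact pow_le_of_le_one hη'.le (by linarith) (by omega)
      _ = (z * (V.card.choose N₁ * C.card.choose T₁) * (1 - η)) * K' ^ (a + b) := by ring
      _ ≤ K' ^ (a + b) := mul_le_of_le_one_left (by positivity) hzz

end SpreadFactor

section Split

variable {𝒱 𝒞 : Type*} [DecidableEq 𝒱]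

/-- Every `d`-subset of `V` has relative degree at least `β` in each `H c` (`c ∈ C`) induced
on `V`, where `H c` is regarded as a `k`-graph. -/
def HasMinDegree (k d : ℕ) (H : 𝒞 → Finset (Finset 𝒱)) (V : Finset 𝒱) (C : Finset 𝒞) (β : ℝ) :
    Prop :=
  ∀ c ∈ C, ∀ D ⊆ V, D.card = d → β * ((V.card - d).choose (k - d) : ℝ) ≤
    (((H c).filter fun e => D ⊆ e ∧ e ⊆ V).card : ℝ)

lemma card_link_filter_subset {E : Finset (Finset 𝒱)} {D Z : Finset 𝒱} (hDZ : D ⊆ Z) :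
    ((((E.filter fun e => D ⊆ e).image (· \ D)).filter fun g => g ⊆ Z \ D).card) =
      (E.filter fun e => D ⊆ e ∧ e ⊆ Z).card := by
  have h : (((E.filter fun e => D ⊆ e).image (· \ D)).filter fun g => g ⊆ Z \ D) =
      (E.filter fun e => D ⊆ e ∧ e ⊆ Z).image (· \ D) := by
    ext g
    simp only [Finset.mem_filter, Finset.mem_image]
    constructor
    · rintro ⟨⟨e, ⟨he, hDe⟩, rfl⟩, hg⟩
      refine ⟨e, ⟨he, hDe, ?_⟩, rfl⟩
      rw [← Finset.sdiff_union_of_subset hDe]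
      exact Finset.union_subset (hg.trans Finset.sdiff_subset) hDZ
    · rintro ⟨e, ⟨he, hDe, heZ⟩, rfl⟩
      exact ⟨⟨e, ⟨he, hDe⟩, rfl⟩, Finset.sdiff_subset_sdiff heZ le_rfl⟩
  rw [h, Finset.card_image_of_injOn]
  intro e he e' he' hee
  rw [Finset.mem_coe, Finset.mem_filter] at he he'
  rw [← Finset.sdiff_union_of_subset he.2.1, ← Finset.sdiff_union_of_subset he'.2.1]
  exact congrArg (· ∪ D) hee

lemma card_sparse_link_le {k d : ℕ} (hdk : d < k) {E : Finset (Finset 𝒱)}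
    (hE : ∀ e ∈ E, e.card = k) {V D : Finset 𝒱} (hDV : D ⊆ V) (hD : D.card = d) {N : ℕ}
    (hkN : k ≤ N) (hNV : N ≤ V.card) {β lam : ℝ} (hl0 : 0 ≤ lam) (hl1 : lam ≤ 1)
    (hdeg : β * ((V.card - d).choose (k - d) : ℝ) ≤
      ((E.filter fun e => D ⊆ e ∧ e ⊆ V).card : ℝ)) :
    (((V.powersetCard N).filter fun Z => D ⊆ Z ∧ ((E.filter fun e => D ⊆ e ∧ e ⊆ Z).card : ℝ) <
      (β - lam) * ((N - d).choose (k - d) : ℝ)).card : ℝ) ≤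
      Real.exp (-(lam ^ 2 * ((N - d : ℕ) : ℝ) / (4 * k ^ 2))) * V.card.choose N := by
  have hU : (V \ D).card = V.card - d := by rw [Finset.card_sdiff_of_subset hDV, hD]
  have key := card_sparse_subsets_le (E := (E.filter fun e => D ⊆ e).image (· \ D)) (r := k - d)
    (by
      intro g hg
      obtain ⟨e, he, rfl⟩ := Finset.mem_image.1 hg
      obtain ⟨he, hDe⟩ := Finset.mem_filter.1 he
      rw [Finset.card_sdiff_of_subset hDe, hE e he, hD])
    (by omega) (n₁ := N - d) (by omega) (U := V \ D) (by omega) (ρ := β) hl0 hl1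
    (by rw [card_link_filter_subset hDV, hU]; exact hdeg)
  have hinj : ((V.powersetCard N).filter fun Z => D ⊆ Z ∧
      ((E.filter fun e => D ⊆ e ∧ e ⊆ Z).card : ℝ) <
        (β - lam) * ((N - d).choose (k - d) : ℝ)).card ≤
      (((V \ D).powersetCard (N - d)).filter fun Z =>
        ((((E.filter fun e => D ⊆ e).image (· \ D)).filter fun g => g ⊆ Z).card : ℝ) <
          (β - lam) * ((N - d).choose (k - d) : ℝ)).card := by
    refine Finset.card_le_card_of_injOn (· \ D) ?_ ?_
    · intro Z hZ
      rw [Finset.mem_coe, Finset.mem_filter, Finset.mem_powersetCard] at hZ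
      obtain ⟨⟨hZV, hZc⟩, hDZ, hZ⟩ := hZ
      rw [Finset.mem_coe, Finset.mem_filter, Finset.mem_powersetCard, card_link_filter_subset hDZ,
        Finset.card_sdiff_of_subset hDZ, hZc, hD]
      exact ⟨⟨Finset.sdiff_subset_sdiff hZV le_rfl, rfl⟩, hZ⟩
    · intro Z hZ Z' hZ' hZZ
      rw [Finset.mem_coe, Finset.mem_filter] at hZ hZ'
      rw [← Finset.sdiff_union_of_subset hZ.2.1, ← Finset.sdiff_union_of_subset hZ'.2.1]
      exact congrArg (· ∪ D) hZZ
  have hch : ((V \ D).card.choose (N - d) : ℝ) ≤ V.card.choose N := by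
    rw [hU]
    have h1 := Nat.choose_symm (show N ≤ V.card by omega)
    have h2 := Nat.choose_symm (show N - d ≤ V.card - d by omega)
    rw [← h1, ← h2, show V.card - d - (N - d) = V.card - N by omega]
    exact_mod_cast Nat.choose_le_choose _ (by omega)
  have hr : (0 : ℝ) < ((k - d : ℕ) : ℝ) := by exact_mod_cast (by omega : 0 < k - d)
  have hrk : ((k - d : ℕ) : ℝ) ≤ k := by exact_mod_cast Nat.sub_le _ _
  calc _ ≤ _ := by exact_mod_cast hinj
    _ ≤ _ := key
    _ ≤ _ := by
      refine mul_le_mul ?_ hch (by positivity) (by positivity)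
      rw [Real.exp_le_exp, neg_le_neg_iff]
      gcongr

lemma card_not_hasMinDegree_le {k d : ℕ} (hdk : d < k) {H : 𝒞 → Finset (Finset 𝒱)} {V : Finset 𝒱}
    {C : Finset 𝒞} (hH : ∀ c ∈ C, ∀ e ∈ H c, e.card = k) {N : ℕ} (hkN : k ≤ N) (hNV : N ≤ V.card)
    {β lam : ℝ} (hl0 : 0 ≤ lam) (hl1 : lam ≤ 1) (hdeg : HasMinDegree k d H V C β) :
    (Set.ncard {Z | Z ∈ V.powersetCard N ∧ ¬ HasMinDegree k d H Z C (β - lam)} : ℝ) ≤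
      C.card * V.card ^ d * Real.exp (-(lam ^ 2 * ((N - d : ℕ) : ℝ) / (4 * k ^ 2))) *
        V.card.choose N := by
  classical
  set bad : 𝒞 × Finset 𝒱 → Finset (Finset 𝒱) := fun q => (V.powersetCard N).filter fun Z =>
    q.2 ⊆ Z ∧ (((H q.1).filter fun e => q.2 ⊆ e ∧ e ⊆ Z).card : ℝ) <
      (β - lam) * ((N - d).choose (k - d) : ℝ) with hbad
  have hsub : {Z | Z ∈ V.powersetCard N ∧ ¬ HasMinDegree k d H Z C (β - lam)} ⊆
      (((C ×ˢ V.powersetCard d).biUnion bad : Finset (Finset 𝒱)) : Set (Finset 𝒱)) := by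
    rintro Z ⟨hZ, hnot⟩
    unfold HasMinDegree at hnot
    push Not at hnot
    obtain ⟨c, hc, D, hDZ, hD, hlt⟩ := hnot
    have hZ' := Finset.mem_powersetCard.1 hZ
    rw [Finset.mem_coe, Finset.mem_biUnion]
    refine ⟨(c, D), Finset.mem_product.2 ⟨hc, Finset.mem_powersetCard.2 ⟨hDZ.trans hZ'.1, hD⟩⟩,
      Finset.mem_filter.2 ⟨hZ, hDZ, ?_⟩⟩
    rw [hZ'.2] at hlt
    exact hlt
  have h1 := Set.ncard_le_ncard hsub (Finset.finite_toSet _)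
  rw [Set.ncard_coe_finset] at h1
  calc _ ≤ (((C ×ˢ V.powersetCard d).biUnion bad).card : ℝ) := by exact_mod_cast h1
    _ ≤ ∑ q ∈ C ×ˢ V.powersetCard d, ((bad q).card : ℝ) := by
      exact_mod_cast Finset.card_biUnion_le
    _ ≤ ∑ q ∈ C ×ˢ V.powersetCard d,
        Real.exp (-(lam ^ 2 * ((N - d : ℕ) : ℝ) / (4 * k ^ 2))) * V.card.choose N := by
      refine Finset.sum_le_sum fun q hq => ?_
      obtain ⟨hq1, hq2⟩ := Finset.mem_product.1 hq
      obtain ⟨hq2, hq3⟩ := Finset.mem_powersetCard.1 hq2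
      exact card_sparse_link_le hdk (hH _ hq1) hq2 hq3 hkN hNV hl0 hl1 (hdeg _ hq1 _ hq2 hq3)
    _ = (C.card * V.card.choose d) *
        (Real.exp (-(lam ^ 2 * ((N - d : ℕ) : ℝ) / (4 * k ^ 2))) * V.card.choose N) := by
      rw [Finset.sum_const, Finset.card_product, Finset.card_powersetCard, nsmul_eq_mul]
      push_cast
      ring
    _ ≤ (C.card * V.card ^ d) *
        (Real.exp (-(lam ^ 2 * ((N - d : ℕ) : ℝ) / (4 * k ^ 2))) * V.card.choose N) := by
      gcongr
      exact_mod_cast Nat.choose_le_pow _ _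
    _ = _ := by ring

lemma exists_good_splits {k d : ℕ} (hdk : d < k) {H : 𝒞 → Finset (Finset 𝒱)} {V : Finset 𝒱}
    {C : Finset 𝒞} (hH : ∀ c ∈ C, ∀ e ∈ H c, e.card = k) {N₁ N₂ : ℕ} (hkN₁ : k ≤ N₁)
    (hkN₂ : k ≤ N₂) (hV : V.card = N₁ + N₂) {β lam η : ℝ} (hl0 : 0 ≤ lam) (hl1 : lam ≤ 1)
    (hdeg : HasMinDegree k d H V C β)
    (hη₁ : C.card * V.card ^ d * Real.exp (-(lam ^ 2 * ((N₁ - d : ℕ) : ℝ) / (4 * k ^ 2))) ≤ η / 2)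
    (hη₂ : C.card * V.card ^ d * Real.exp (-(lam ^ 2 * ((N₂ - d : ℕ) : ℝ) / (4 * k ^ 2))) ≤ η / 2) :
    ∃ G ⊆ V.powersetCard N₁, (1 - η) * V.card.choose N₁ ≤ G.card ∧
      ∀ V₁ ∈ G, HasMinDegree k d H V₁ C (β - lam) ∧ HasMinDegree k d H (V \ V₁) C (β - lam) := by
  classical
  set B₁ := (V.powersetCard N₁).filter fun Z => ¬ HasMinDegree k d H Z C (β - lam) with hB₁
  set B₂ := (V.powersetCard N₁).filter fun Z => ¬ HasMinDegree k d H (V \ Z) C (β - lam) with hB₂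
  have c₁ : (B₁.card : ℝ) ≤ η / 2 * V.card.choose N₁ := by
    have := card_not_hasMinDegree_le hdk hH hkN₁ (by omega) hl0 hl1 hdeg
    have e : {Z | Z ∈ V.powersetCard N₁ ∧ ¬ HasMinDegree k d H Z C (β - lam)} =
      (B₁ : Set (Finset 𝒱)) := by
      ext Z
      simp [hB₁]
    rw [e, Set.ncard_coe_finset] at this
    exact this.trans (by gcongr)
  have c₂ : (B₂.card : ℝ) ≤ η / 2 * V.card.choose N₁ := by
    have := card_not_hasMinDegree_le hdk hH hkN₂ (by omega) hl0 hl1 hdeg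
    have e : {Z | Z ∈ V.powersetCard N₂ ∧ ¬ HasMinDegree k d H Z C (β - lam)} =
      (((V.powersetCard N₂).filter fun Z => ¬ HasMinDegree k d H Z C (β - lam) :
        Finset (Finset 𝒱)) : Set (Finset 𝒱)) := by
      ext Z
      simp
    rw [e, Set.ncard_coe_finset] at this
    have hle : B₂.card ≤
        ((V.powersetCard N₂).filter fun Z => ¬ HasMinDegree k d H Z C (β - lam)).card := by
      refine Finset.card_le_card_of_injOn (V \ ·) ?_ ?_
      · intro Z hZ
        rw [Finset.mem_coe, Finset.mem_filter, Finset.mem_powersetCard] at hZ ⊢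
        refine ⟨⟨Finset.sdiff_subset, ?_⟩, hZ.2⟩
        rw [Finset.card_sdiff_of_subset hZ.1.1, hZ.1.2, hV]
        omega
      · intro Z hZ Z' hZ' hZZ
        rw [Finset.mem_coe, Finset.mem_filter, Finset.mem_powersetCard] at hZ hZ'
        rw [← Finset.sdiff_sdiff_eq_self hZ.1.1, ← Finset.sdiff_sdiff_eq_self hZ'.1.1]
        exact congrArg (V \ ·) hZZ
    have hsym : V.card.choose N₂ = V.card.choose N₁ := by
      rw [← Nat.choose_symm (show N₁ ≤ V.card by omega), hV]
      congr 1
      omega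
    rw [hsym] at this
    exact (Nat.cast_le.2 hle).trans (this.trans (by gcongr))
  refine ⟨V.powersetCard N₁ \ (B₁ ∪ B₂), Finset.sdiff_subset, ?_, ?_⟩
  · have h1 := Finset.le_card_sdiff (B₁ ∪ B₂) (V.powersetCard N₁)
    have h2 := Finset.card_union_le B₁ B₂
    rw [Finset.card_powersetCard] at h1
    have h3 : V.card.choose N₁ ≤ (V.powersetCard N₁ \ (B₁ ∪ B₂)).card + (B₁.card + B₂.card) := by
      omega
    have h4 : (V.card.choose N₁ : ℝ) ≤
        (V.powersetCard N₁ \ (B₁ ∪ B₂)).card + (B₁.card + B₂.card) := by exact_mod_cast h3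
    linarith
  · intro Z hZ
    simp only [hB₁, hB₂, Finset.mem_sdiff, Finset.mem_union, Finset.mem_filter, not_or, not_and,
      not_not] at hZ
    exact ⟨hZ.2.1 hZ.1, hZ.2.2 hZ.1⟩

end Split

section Iteration

lemma HasMinDegree.mono {𝒱 𝒞 : Type*} [DecidableEq 𝒱] {k d : ℕ} {H : 𝒞 → Finset (Finset 𝒱)}
    {V : Finset 𝒱} {C C' : Finset 𝒞} {β β' : ℝ} (h : HasMinDegree k d H V C β) (hC : C' ⊆ C)
    (hβ : β' ≤ β) : HasMinDegree k d H V C' β' :=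
  fun c hc D hD hd => (mul_le_mul_of_nonneg_right hβ (Nat.cast_nonneg _)).trans (h c (hC hc) D hD hd)

lemma IsSlotFactor.hasSpreadFactor {𝒱 𝒞 : Type*} [DecidableEq 𝒱] [DecidableEq 𝒞] {s : ℕ}
    {F : Finset (Finset (Fin s))} {H : 𝒞 → Finset (Finset 𝒱)} {V : Finset 𝒱} {C : Finset 𝒞}
    {J : Finset ℕ} {σ : 𝒱 → ℕ × Fin s} {κ : 𝒞 → ℕ × Finset (Fin s)}
    (h : IsSlotFactor F H V C J σ κ) {K : ℝ} (hV : V.card ≤ K) (hC : C.card ≤ K) :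
    HasSpreadFactor F H V C J K := by
  refine ⟨Unit, inferInstance, fun _ => 1, fun _ => σ, fun _ => κ, fun _ => zero_le_one, by simp,
    fun _ => h, fun P _ Q _ g h => ?_⟩
  have h1 : ∑ ω : Unit with (∀ x ∈ P, σ x = g x) ∧ ∀ c ∈ Q, κ c = h c, (1 : ℝ) ≤ 1 := by
    refine (Finset.sum_le_sum_of_subset_of_nonneg (Finset.filter_subset _ _)
      fun _ _ _ => zero_le_one).trans ?_
    simp
  have h2 : ((V.card.descFactorial P.card : ℕ) : ℝ) ≤ K ^ P.card :=
    (by exact_mod_cast Nat.descFactorial_le_pow _ _ : _ ≤ (V.card : ℝ) ^ P.card).trans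
      (pow_le_pow_left₀ (Nat.cast_nonneg _) hV _)
  have h3 : ((C.card.descFactorial Q.card : ℕ) : ℝ) ≤ K ^ Q.card :=
    (by exact_mod_cast Nat.descFactorial_le_pow _ _ : _ ≤ (C.card : ℝ) ^ Q.card).trans
      (pow_le_pow_left₀ (Nat.cast_nonneg _) hC _)
  have hK : 0 ≤ K := (Nat.cast_nonneg _).trans hV
  rw [pow_add]
  calc _ ≤ 1 * ((V.card.descFactorial P.card : ℝ) * C.card.descFactorial Q.card) := by gcongr
    _ ≤ _ := by
      rw [one_mul]
      gcongr

lemma eventually_mul_pow_mul_exp_neg_sqrt_le (A : ℝ) (n : ℕ) {c : ℝ} (hc : 0 < c) :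
    ∃ M₀ : ℕ, ∀ m : ℕ, M₀ ≤ m → A * (m : ℝ) ^ n * Real.exp (-(c * √m)) ≤ 1 := by
  have h1 : Filter.Tendsto (fun m : ℕ => c * √(m : ℝ)) Filter.atTop Filter.atTop :=
    (Real.tendsto_sqrt_atTop.comp tendsto_natCast_atTop_atTop).const_mul_atTop hc
  have h2 := ((Real.tendsto_pow_mul_exp_neg_atTop_nhds_zero (2 * n)).comp h1).const_mul
    (A / c ^ (2 * n))
  rw [mul_zero] at h2
  obtain ⟨M₀, hM⟩ := Filter.eventually_atTop.1 (h2.eventually_le_const zero_lt_one)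
  refine ⟨M₀, fun m hm => ?_⟩
  have h3 := hM m hm
  simp only [Function.comp_apply] at h3
  refine le_trans (le_of_eq ?_) h3
  rw [mul_pow, pow_mul (√(m : ℝ)), Real.sq_sqrt (Nat.cast_nonneg m)]
  field_simp

/-- The failure probability of a random halving of a system on `s * m` vertices. -/
lemma exists_halving_error (k s t d : ℕ) (hk : 0 < k) (hs : 1 ≤ s) {α : ℝ} (hα : 0 < α) :
    ∃ M₀ : ℕ, ∀ m j m' : ℕ, M₀ ≤ m → 2 ^ (j + 1) ≤ m → m ≤ 2 * m' + 1 →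
      ((t * m : ℕ) : ℝ) * ((s * m : ℕ) : ℝ) ^ d * Real.exp (-((α / 10 * (9 / 10) ^ j) ^ 2 *
        ((s * m' - d : ℕ) : ℝ) / (4 * k ^ 2))) ≤ (1 / 2) ^ (j + 2) / 2 := by
  set c : ℝ := α ^ 2 / (1600 * k ^ 2) with hc
  have hc0 : 0 < c := by positivity
  obtain ⟨M₀, hM₀⟩ := eventually_mul_pow_mul_exp_neg_sqrt_le (4 * t * s ^ d) (d + 2) hc0
  refine ⟨M₀ + 4 * d + 2, fun m j m' hm hj hm' => ?_⟩
  have hmpos : (0 : ℝ) < m := by exact_mod_cast (by omega : 0 < m)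
  have h2j : (2 : ℝ) ^ (j + 1) ≤ m := by exact_mod_cast hj
  have hsize : (m : ℝ) ≤ 4 * ((s * m' - d : ℕ) : ℝ) := by
    have h1 : m' ≤ s * m' := Nat.le_mul_of_pos_left _ hs
    exact_mod_cast (by omega : m ≤ 4 * (s * m' - d))
  have hpow : 1 / √(m : ℝ) ≤ (81 / 100 : ℝ) ^ j := by
    rw [div_le_iff₀ (Real.sqrt_pos.2 hmpos)]
    refine (Real.one_le_sqrt.2 ?_ : 1 ≤ √(((81 / 100 : ℝ) ^ j) ^ 2 * m)).trans ?_
    · calc (1 : ℝ) ≤ (((81 / 100 : ℝ) ^ 2) * 2) ^ j := one_le_pow₀ (by norm_num)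
        _ = ((81 / 100 : ℝ) ^ j) ^ 2 * 2 ^ j := by rw [mul_pow, ← pow_mul, ← pow_mul, mul_comm 2 j]
        _ ≤ _ := by
          gcongr
          exact (pow_le_pow_right₀ one_le_two (Nat.le_succ j)).trans h2j
    · rw [Real.sqrt_mul (by positivity), Real.sqrt_sq (by positivity)]
  have hexp : c * √m ≤ (α / 10 * (9 / 10) ^ j) ^ 2 * ((s * m' - d : ℕ) : ℝ) / (4 * k ^ 2) := by
    have e1 : (α / 10 * (9 / 10) ^ j) ^ 2 = α ^ 2 / 100 * (81 / 100 : ℝ) ^ j := by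
      rw [mul_pow, ← pow_mul, mul_comm j 2, pow_mul]
      norm_num
      ring
    have e2 : √(m : ℝ) = 1 / √(m : ℝ) * m := by
      rw [div_mul_eq_mul_div, one_mul, Real.div_sqrt]
    rw [e1, hc, e2]
    calc α ^ 2 / (1600 * k ^ 2) * (1 / √(m : ℝ) * m) ≤
        α ^ 2 / (1600 * k ^ 2) * ((81 / 100 : ℝ) ^ j * (4 * ((s * m' - d : ℕ) : ℝ))) := by gcongr
      _ = _ := by field_simp; norm_num
  have hfin := hM₀ m (by omega)
  have h3 : ((t * m : ℕ) : ℝ) * ((s * m : ℕ) : ℝ) ^ d * Real.exp (-(c * √m)) ≤ 1 / (4 * m) := by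
    rw [le_div_iff₀ (by positivity)]
    refine le_trans (le_of_eq ?_) hfin
    push_cast
    ring
  calc _ ≤ ((t * m : ℕ) : ℝ) * ((s * m : ℕ) : ℝ) ^ d * Real.exp (-(c * √m)) := by gcongr
    _ ≤ 1 / (4 * m) := h3
    _ ≤ 1 / (4 * 2 ^ (j + 1)) := by gcongr
    _ = (1 / 2) ^ (j + 2) / 2 := by
      rw [one_div_pow]
      field_simp
      ring

/-- If a density guarantees a transversal factor in all large systems, a slightly larger density
guarantees a spread random transversal factor. -/
theorem exists_hasSpreadFactor {k s t d : ℕ} (hdk : d < k) (hs : 1 ≤ s)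
    {F : Finset (Finset (Fin s))} {β₀ α : ℝ} (hα : 0 < α) {n₁ : ℕ}
    (hbase : ∀ (𝒱 𝒞 : Type) [DecidableEq 𝒱] (H : 𝒞 → Finset (Finset 𝒱)) (V : Finset 𝒱)
      (C : Finset 𝒞) (J : Finset ℕ) (m : ℕ), n₁ ≤ m → V.card = s * m → C.card = t * m →
      J.card = m → (∀ c ∈ C, ∀ e ∈ H c, e.card = k) → HasMinDegree k d H V C β₀ →
      ∃ σ κ, IsSlotFactor F H V C J σ κ) :
    ∃ (K : ℝ) (M : ℕ), 0 < K ∧ ∀ (𝒱 𝒞 : Type) [DecidableEq 𝒱] [DecidableEq 𝒞]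
      (H : 𝒞 → Finset (Finset 𝒱)) (V : Finset 𝒱)
      (C : Finset 𝒞) (J : Finset ℕ) (m : ℕ), M ≤ m → V.card = s * m → C.card = t * m →
      J.card = m → (∀ c ∈ C, ∀ e ∈ H c, e.card = k) → HasMinDegree k d H V C (β₀ + α) →
      HasSpreadFactor F H V C J K := by
  set a := min α 1 with ha
  have ha0 : 0 < a := lt_min hα one_pos
  have ha1 : a ≤ 1 := min_le_right _ _
  obtain ⟨M₀, hM₀⟩ := exists_halving_error k s t d (by omega) hs ha0
  set M := n₁ + M₀ + k + 1 with hM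
  set K : ℝ := s * (2 * M) + t * (2 * M) with hK
  have hK0 : 0 < K := by
    have : (0 : ℝ) < s := by exact_mod_cast hs
    have : (0 : ℝ) < M := by exact_mod_cast (by omega : 0 < M)
    positivity
  have main : ∀ (j : ℕ) (𝒱 𝒞 : Type) [DecidableEq 𝒱] [DecidableEq 𝒞]
      (H : 𝒞 → Finset (Finset 𝒱)) (V : Finset 𝒱) (C : Finset 𝒞) (J : Finset ℕ) (m : ℕ),
      2 ^ j * M ≤ m → m ≤ 2 ^ (j + 1) * M → V.card = s * m → C.card = t * m →
      J.card = m → (∀ c ∈ C, ∀ e ∈ H c, e.card = k) →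
      HasMinDegree k d H V C (β₀ + a * (1 - (9 / 10) ^ j)) →
      HasSpreadFactor F H V C J (K * (2 - (1 / 2) ^ j)) := by
    intro j
    induction j with
    | zero =>
      intro 𝒱 𝒞 _ _ H V C J m hm1 hm2 hV hC hJ hH hdeg
      obtain ⟨σ, κ, h⟩ := hbase 𝒱 𝒞 H V C J m (by omega) hV hC hJ hH
        (hdeg.mono le_rfl (by simp))
      have hmr : (m : ℝ) ≤ 2 * M := by
        rw [zero_add, pow_one] at hm2
        exact_mod_cast hm2
      refine h.hasSpreadFactor ?_ ?_
      · rw [hV, pow_zero, hK]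
        push_cast
        have : (s : ℝ) * m ≤ s * (2 * M) := by gcongr
        have : (0 : ℝ) ≤ t * (2 * M) := by positivity
        linarith
      · rw [hC, pow_zero, hK]
        push_cast
        have : (t : ℝ) * m ≤ t * (2 * M) := by gcongr
        have : (0 : ℝ) ≤ s * (2 * M) := by positivity
        linarith
    | succ j ih =>
      intro 𝒱 𝒞 _ _ H V C J m hm1 hm2 hV hC hJ hH hdeg
      rw [pow_succ] at hm1
      rw [pow_succ] at hm2
      set B := 2 ^ j * M with hB
      have hMB : M ≤ B := Nat.le_mul_of_pos_left _ (by positivity)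
      have e1 : 2 ^ j * 2 * M = 2 * B := by rw [hB]; ring
      have e2 : 2 ^ (j + 1) * 2 * M = 4 * B := by rw [hB, pow_succ]; ring
      have e3 : 2 ^ (j + 1) * M = 2 * B := by rw [hB, pow_succ]; ring
      rw [e1] at hm1
      rw [e2] at hm2
      rw [e3] at ih
      set m₁ := m / 2 with hm₁
      set m₂ := m - m / 2 with hm₂
      have hmm : m = m₁ + m₂ := by omega
      have hmM : 2 ^ (j + 1) ≤ m := by
        have h5 : 2 ^ (j + 1) ≤ 2 ^ (j + 1) * M := Nat.le_mul_of_pos_right _ (by omega)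
        omega
      set lam : ℝ := a / 10 * (9 / 10) ^ j with hlam
      have hlam1 : lam ≤ 1 := by
        have : (9 / 10 : ℝ) ^ j ≤ 1 := pow_le_one₀ (by norm_num) (by norm_num)
        have : (0 : ℝ) ≤ (9 / 10 : ℝ) ^ j := by positivity
        rw [hlam]
        nlinarith
      have hs1 : m₁ ≤ s * m₁ := Nat.le_mul_of_pos_left _ hs
      have hs2 : m₂ ≤ s * m₂ := Nat.le_mul_of_pos_left _ hs
      obtain ⟨G, hGsub, hGcard, hGgood⟩ := exists_good_splits (N₁ := s * m₁) (N₂ := s * m₂)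
        (lam := lam) (η := (1 / 2) ^ (j + 2)) hdk hH (by omega) (by omega)
        (by rw [hV, hmm, mul_add]) (by positivity) hlam1 hdeg
        (by rw [hC, hV]; exact hM₀ m j m₁ (by omega) hmM (by omega))
        (by rw [hC, hV]; exact hM₀ m j m₂ (by omega) hmM (by omega))
      have hβ : β₀ + a * (1 - (9 / 10) ^ (j + 1)) - lam = β₀ + a * (1 - (9 / 10) ^ j) := by
        rw [hlam, pow_succ]
        ring
      rw [hβ] at hGgood
      obtain ⟨J₁, hJ₁, hJ₁c⟩ := Finset.exists_subset_card_eq (show m₁ ≤ J.card by omega)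
      have hx : (1 / 2 : ℝ) ^ (j + 1) ≤ 1 := pow_le_one₀ (by norm_num) (by norm_num)
      have hx0 : (0 : ℝ) < (1 / 2 : ℝ) ^ (j + 1) := by positivity
      have hx2 : (1 / 2 : ℝ) ^ (j + 2) = (1 / 2) ^ (j + 1) / 2 := by rw [pow_succ]; ring
      have hx3 : (1 / 2 : ℝ) ^ j = (1 / 2) ^ (j + 1) * 2 := by rw [pow_succ]; ring
      refine HasSpreadFactor.of_split (K := K * (2 - (1 / 2) ^ j)) (η := (1 / 2) ^ (j + 2)) hJ₁
        (N₁ := s * m₁) (N₂ := s * m₂) (T₁ := t * m₁) (T₂ := t * m₂)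
        (by rw [hV, hmm, mul_add]) (by rw [hC, hmm, mul_add]) hGsub ?_ (by positivity) ?_ hGcard ?_
        ?_ ?_
      · rw [hx3]
        exact mul_nonneg hK0.le (by linarith)
      · rw [hx2]
        linarith
      · rw [mul_assoc]
        refine mul_le_mul_of_nonneg_left ?_ hK0.le
        rw [hx2, hx3]
        nlinarith
      · intro V₁ hV₁ C₁ hC₁
        obtain ⟨hC₁, hC₁c⟩ := Finset.mem_powersetCard.1 hC₁
        exact ih 𝒱 𝒞 H V₁ C₁ J₁ m₁ (by omega) (by omega)
          (Finset.mem_powersetCard.1 (hGsub hV₁)).2 hC₁c hJ₁c (fun c hc => hH c (hC₁ hc))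
          ((hGgood V₁ hV₁).1.mono hC₁ le_rfl)
      · intro V₁ hV₁ C₁ hC₁
        obtain ⟨hC₁, hC₁c⟩ := Finset.mem_powersetCard.1 hC₁
        obtain ⟨hV₁s, hV₁c⟩ := Finset.mem_powersetCard.1 (hGsub hV₁)
        refine ih 𝒱 𝒞 H (V \ V₁) (C \ C₁) (J \ J₁) m₂ (by omega) (by omega) ?_ ?_ ?_
          (fun c hc => hH c (Finset.mem_sdiff.1 hc).1)
          ((hGgood V₁ hV₁).2.mono Finset.sdiff_subset le_rfl)
        · rw [Finset.card_sdiff_of_subset hV₁s, hV, hV₁c, hmm, mul_add]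
          omega
        · rw [Finset.card_sdiff_of_subset hC₁, hC, hC₁c, hmm, mul_add]
          omega
        · rw [Finset.card_sdiff_of_subset hJ₁, hJ, hJ₁c]
  refine ⟨K * 2, M, by positivity, fun 𝒱 𝒞 _ _ H V C J m hm hV hC hJ hH hdeg => ?_⟩
  have hMpos : 0 < M := by omega
  have hq : m / M ≠ 0 := (Nat.div_pos hm hMpos).ne'
  have h1 : 2 ^ Nat.log 2 (m / M) * M ≤ m :=
    (Nat.mul_le_mul_right _ (Nat.pow_log_le_self 2 hq)).trans (Nat.div_mul_le_self _ _)
  have h2 : m ≤ 2 ^ (Nat.log 2 (m / M) + 1) * M :=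
    ((Nat.div_lt_iff_lt_mul hMpos).1 (Nat.lt_pow_succ_log_self one_lt_two (m / M))).le
  set j := Nat.log 2 (m / M)
  have h9 : (0 : ℝ) ≤ (9 / 10 : ℝ) ^ j := by positivity
  have h21 : (1 / 2 : ℝ) ^ j ≤ 1 := pow_le_one₀ (by norm_num) (by norm_num)
  have h20 : (0 : ℝ) ≤ (1 / 2 : ℝ) ^ j := by positivity
  refine (main j 𝒱 𝒞 H V C J m h1 h2 hV hC hJ hH (hdeg.mono le_rfl ?_)).mono ?_ ?_
  · have := min_le_left α 1
    nlinarith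
  · exact mul_nonneg hK0.le (by linarith)
  · exact mul_le_mul_of_nonneg_left (by linarith) hK0.le

end Iteration

section Threshold

lemma card_filter_superset_le {N k d : ℕ} {E : Finset (Finset (Fin N))}
    (hE : ∀ e ∈ E, e.card = k) {D : Finset (Fin N)} (hD : D.card = d) :
    (E.filter fun e => D ⊆ e).card ≤ (N - d).choose (k - d) := by
  have h : (N - d).choose (k - d) = ((Finset.univ \ D).powersetCard (k - d)).card := by
    rw [Finset.card_powersetCard, Finset.card_sdiff_of_subset (Finset.subset_univ D), hD,
      Finset.card_univ, Fintype.card_fin]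
  rw [h]
  refine Finset.card_le_card_of_injOn (· \ D) ?_ ?_
  · intro e he
    rw [Finset.mem_coe, Finset.mem_filter] at he
    rw [Finset.mem_coe, Finset.mem_powersetCard, Finset.card_sdiff_of_subset he.2, hE e he.1, hD]
    exact ⟨Finset.sdiff_subset_sdiff (Finset.subset_univ e) le_rfl, rfl⟩
  · intro e he e' he' hee
    rw [Finset.mem_coe, Finset.mem_filter] at he he'
    rw [← Finset.sdiff_union_of_subset he.2, ← Finset.sdiff_union_of_subset he'.2]
    exact congrArg (· ∪ D) hee

lemma exists_isTransversalFFactor_of_threshold_lt {k s t d : ℕ} (hdk : d ≤ k) (hk : 0 < k)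
    (hs : 1 ≤ s) (ht : 0 < t) {F : Finset (Finset (Fin s))} {β : ℝ}
    (hβ : transversalDiracThreshold k s t d F < β) :
    ∃ n₀ : ℕ, ∀ n : ℕ, n₀ ≤ n → ∀ Hs : Fin (t * n) → Finset (Finset (Fin (s * n))),
      (∀ i, ∀ e ∈ Hs i, e.card = k) →
      (∀ i (D : Finset (Fin (s * n))), D.card = d → β * ((s * n - d).choose (k - d) : ℝ) ≤
        (((Hs i).filter fun e => D ⊆ e).card : ℝ)) →
      IsTransversalFFactor F Hs := by
  obtain ⟨δ, ⟨-, hδ⟩, hδβ⟩ := exists_lt_of_csInf_lt (by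
    refine ⟨1, one_pos, fun α hα => ⟨k, fun n hn Hs h1 h2 => ?_⟩⟩
    exfalso
    have hkn : k ≤ s * n := hn.trans (Nat.le_mul_of_pos_left _ hs)
    obtain ⟨D, -, hD⟩ := Finset.exists_subset_card_eq
      (show d ≤ (Finset.univ : Finset (Fin (s * n))).card by
        rw [Finset.card_univ, Fintype.card_fin]; omega)
    have hi : 0 < t * n := Nat.mul_pos ht (by omega)
    have h3 := h2 ⟨0, hi⟩ D hD
    have h4 : ((((Hs ⟨0, hi⟩).filter fun e => D ⊆ e).card : ℕ) : ℝ) ≤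
        (s * n - d).choose (k - d) := by exact_mod_cast card_filter_superset_le (h1 _) hD
    have h5 : (0 : ℝ) < (s * n - d).choose (k - d) := by
      exact_mod_cast Nat.choose_pos (by omega)
    nlinarith) hβ
  obtain ⟨n₀, h⟩ := hδ (β - δ) (sub_pos.2 hδβ)
  refine ⟨n₀, fun n hn Hs h1 h2 => h n hn Hs h1 fun i D hD => ?_⟩
  rw [add_sub_cancel]
  exact h2 i D hD

lemma exists_bijOn_product {α β γ : Type*} {A : Finset α} {J : Finset ℕ} {B : Finset β}
    [Nonempty β] {m : ℕ} (eJ : J ≃ Fin m) (e : A ≃ Fin m × γ) {i : γ → β}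
    (hi : Function.Injective i) (hB : ∀ b, b ∈ B ↔ ∃ g, i g = b) :
    ∃ f : α → ℕ × β, Set.BijOn f A (J ×ˢ B : Finset (ℕ × β)) ∧
      ∀ x : A, f x = (((eJ.symm (e x).1 : J) : ℕ), i (e x).2) := by
  classical
  set f : α → ℕ × β := fun x => if hx : x ∈ A then
    (((eJ.symm (e ⟨x, hx⟩).1 : J) : ℕ), i (e ⟨x, hx⟩).2) else (0, Classical.arbitrary β) with hf
  have hfx : ∀ x : A, f x = (((eJ.symm (e x).1 : J) : ℕ), i (e x).2) := fun x => by
    simp only [hf, x.2, dif_pos]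
  refine ⟨f, ⟨fun x hx => ?_, fun x hx y hy hxy => ?_, fun q hq => ?_⟩, hfx⟩
  · rw [hfx ⟨x, hx⟩, Finset.mem_coe, Finset.mem_product]
    exact ⟨Finset.coe_mem _, (hB _).2 ⟨_, rfl⟩⟩
  · rw [hfx ⟨x, hx⟩, hfx ⟨y, hy⟩, Prod.mk.injEq] at hxy
    have h1 := eJ.symm.injective (Subtype.ext hxy.1)
    exact congrArg Subtype.val (e.injective (Prod.ext h1 (hi hxy.2)))
  · rw [Finset.mem_coe, Finset.mem_product] at hq
    obtain ⟨g, hg⟩ := (hB _).1 hq.2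
    refine ⟨e.symm (eJ ⟨q.1, hq.1⟩, g), Finset.coe_mem _, ?_⟩
    rw [hfx]
    simp [hg]

lemma exists_isSlotFactor_of_threshold_lt {k s t d : ℕ} (hdk : d ≤ k) (hk : 0 < k)
    (hs : 1 ≤ s) (ht : 0 < t) {F : Finset (Finset (Fin s))} {β : ℝ}
    (hβ : transversalDiracThreshold k s t d F < β) :
    ∃ n₀ : ℕ, ∀ (𝒱 𝒞 : Type) [DecidableEq 𝒱] (H : 𝒞 → Finset (Finset 𝒱)) (V : Finset 𝒱)
      (C : Finset 𝒞) (J : Finset ℕ) (m : ℕ), n₀ ≤ m → V.card = s * m → C.card = t * m →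
      J.card = m → (∀ c ∈ C, ∀ e ∈ H c, e.card = k) → HasMinDegree k d H V C β →
      ∃ σ κ, IsSlotFactor F H V C J σ κ := by
  obtain ⟨n₀, hn₀⟩ := exists_isTransversalFFactor_of_threshold_lt hdk hk hs ht hβ
  refine ⟨n₀, fun 𝒱 𝒞 _ H V C J m hm hV hC hJ hH hdeg => ?_⟩
  have eV := V.equivFinOfCardEq hV
  have eC := C.equivFinOfCardEq hC
  have eJ := J.equivFinOfCardEq hJ
  let v : Fin (s * m) ↪ 𝒱 := eV.symm.toEmbedding.trans (Function.Embedding.subtype _)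
  have hv : Finset.univ.map v = V := by
    ext x
    rw [Finset.mem_map]
    refine ⟨fun ⟨a, _, ha⟩ => ha ▸ (eV.symm a).2, fun hx => ⟨eV ⟨x, hx⟩, Finset.mem_univ _, ?_⟩⟩
    simp [v]
  set Hs : Fin (t * m) → Finset (Finset (Fin (s * m))) :=
    fun i => Finset.univ.filter fun e => e.map v ∈ H (eC.symm i) with hHs
  have hfac : IsTransversalFFactor F Hs := by
    refine hn₀ m hm Hs ?_ ?_
    · intro i e he
      rw [← Finset.card_map v]
      exact hH _ (eC.symm i).2 _ (Finset.mem_filter.1 he).2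
    · intro i D hD
      have h1 := hdeg _ (eC.symm i).2 (D.map v) (hv ▸ Finset.map_subset_map.2 (Finset.subset_univ D))
        (by rw [Finset.card_map, hD])
      rw [hV] at h1
      refine h1.trans (Nat.cast_le.2 ?_)
      rw [← Finset.card_map (Finset.mapEmbedding v).toEmbedding]
      refine Finset.card_le_card fun e he => ?_
      obtain ⟨he, hDe, heV⟩ := Finset.mem_filter.1 he
      rw [← hv, Finset.subset_map_iff] at heV
      obtain ⟨u, -, rfl⟩ := heV
      rw [Finset.mem_map]
      exact ⟨u, Finset.mem_filter.2 ⟨Finset.mem_filter.2 ⟨Finset.mem_univ _, he⟩,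
        Finset.map_subset_map.1 hDe⟩, rfl⟩
  obtain ⟨φ, hφ1, hφ2, c, hc, hedge⟩ := hfac
  have hφ : Function.Bijective fun q : Fin m × Fin s => φ q.1 q.2 := by
    rw [Fintype.bijective_iff_injective_and_card]
    refine ⟨fun q q' hq => ?_, by simp [mul_comm]⟩
    by_cases h : q.1 = q'.1
    · refine Prod.ext h (hφ1 q.1 ?_)
      simpa [h] using hq
    · exact absurd hq (hφ2 _ _ h _ _)
  set Φ := Equiv.ofBijective _ hφ with hΦ
  set c' := Equiv.ofBijective _ hc with hc'
  have : Nonempty (Fin s) := ⟨⟨0, hs⟩⟩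
  obtain ⟨σ, hσ1, hσ2⟩ := exists_bijOn_product (B := Finset.univ) eJ (eV.trans Φ.symm)
    Function.injective_id (by simp)
  obtain ⟨κ, hκ1, hκ2⟩ := exists_bijOn_product (B := F) eJ (eC.trans c'.symm)
    (Subtype.val_injective (p := fun e => e ∈ F)) (by simp)
  refine ⟨σ, κ, hσ1, hκ1, fun x hx => ?_⟩
  obtain ⟨q, hq⟩ : ∃ q, c' q = eC ⟨x, hx⟩ := c'.surjective _
  have hκx : κ x = (((eJ.symm q.1 : J) : ℕ), (q.2 : Finset (Fin s))) := by
    rw [hκ2 ⟨x, hx⟩]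
    simp [← hq]
  have hmem := hedge q.1 q.2
  rw [Finset.mem_filter] at hmem
  have hcq : eC.symm (c (q.1, q.2)) = ⟨x, hx⟩ := by
    rw [Equiv.symm_apply_eq, ← hq]
    rfl
  rw [hcq] at hmem
  convert hmem.2 using 1
  ext y
  rw [Finset.mem_filter, Finset.mem_map]
  constructor
  · rintro ⟨hy, hy1, hy2⟩
    obtain ⟨r, hr⟩ : ∃ r, Φ r = eV ⟨y, hy⟩ := Φ.surjective _
    have hσy : σ y = (((eJ.symm r.1 : J) : ℕ), r.2) := by
      rw [hσ2 ⟨y, hy⟩]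
      simp [← hr]
    rw [hσy, hκx] at hy1 hy2
    have hrq : r.1 = q.1 := eJ.symm.injective (Subtype.ext hy1)
    refine ⟨Φ r, Finset.mem_image.2 ⟨r.2, hy2, ?_⟩, ?_⟩
    · rw [← hrq]
      rfl
    · rw [hr]
      simp [v]
  · rintro ⟨z, hz, rfl⟩
    obtain ⟨b, hb, rfl⟩ := Finset.mem_image.1 hz
    have hy : v (φ q.1 b) ∈ V := (eV.symm _).2
    have hσy : σ (v (φ q.1 b)) = (((eJ.symm q.1 : J) : ℕ), b) := by
      rw [hσ2 ⟨_, hy⟩]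
      have h1 : eV ⟨v (φ q.1 b), hy⟩ = Φ (q.1, b) := by
        rw [← Equiv.eq_symm_apply]
        rfl
      simp [h1]
    rw [hσy, hκx]
    exact ⟨hy, rfl, hb⟩

end Threshold

section EdgeSpread

lemma natCast_pow_le_three_pow_mul_descFactorial {N a : ℕ} (h : a ≤ N) :
    (N : ℝ) ^ a ≤ 3 ^ a * N.descFactorial a := by
  induction a generalizing N with
  | zero => simp
  | succ b ih =>
    obtain ⟨M, rfl⟩ : ∃ M, N = M + 1 := ⟨N - 1, by omega⟩
    have hb : b ≤ M := by omega
    have h1 : ((M : ℝ) + 1) ^ b ≤ 3 * (M : ℝ) ^ b := by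
      rcases Nat.eq_zero_or_pos M with rfl | hM
      · obtain rfl : b = 0 := by omega
        norm_num
      · have hM' : (0 : ℝ) < M := by exact_mod_cast hM
        have hbM : (b : ℝ) ≤ M := by exact_mod_cast hb
        calc ((M : ℝ) + 1) ^ b = (1 / M + 1) ^ b * (M : ℝ) ^ b := by
              rw [← mul_pow]; congr 1; field_simp; ring
          _ ≤ Real.exp (1 / M) ^ b * (M : ℝ) ^ b := by
              gcongr
              exact Real.add_one_le_exp _
          _ = Real.exp (b / M) * (M : ℝ) ^ b := by
              rw [← Real.exp_nat_mul, mul_one_div]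
          _ ≤ 3 * (M : ℝ) ^ b := by
              gcongr
              calc Real.exp (b / M) ≤ Real.exp 1 := by
                    rw [Real.exp_le_exp]
                    exact (div_le_one hM').2 hbM
                _ ≤ 3 := by linarith [Real.exp_one_lt_d9]
    rw [Nat.succ_descFactorial_succ]
    push_cast
    calc ((M : ℝ) + 1) ^ (b + 1) = (M + 1) * ((M : ℝ) + 1) ^ b := by ring
      _ ≤ (M + 1) * (3 * (3 ^ b * M.descFactorial b)) := by
          refine mul_le_mul_of_nonneg_left (h1.trans ?_) (by positivity)
          exact mul_le_mul_of_nonneg_left (ih hb) (by norm_num)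
      _ = _ := by ring

lemma div_le_maxOneDensity {V : Type*} [Fintype V] [DecidableEq V] {F E : Finset (Finset V)}
    {W : Finset V} (hE : E ⊆ F) (hEW : ∀ e ∈ E, e ⊆ W) (hW : 2 ≤ W.card) :
    (E.card : ℝ) / ((W.card : ℝ) - 1) ≤ maxOneDensity F := by
  refine le_csSup ⟨F.card, ?_⟩ ⟨W, E, hE, hEW, hW, rfl⟩
  rintro x ⟨W, E, hE, -, hW, rfl⟩
  have h1 : (2 : ℝ) ≤ W.card := by exact_mod_cast hW
  have h2 : (E.card : ℝ) ≤ F.card := by exact_mod_cast Finset.card_le_card hE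
  rw [div_le_iff₀ (by linarith)]
  nlinarith [(Nat.cast_nonneg F.card : (0 : ℝ) ≤ F.card)]

variable {𝒱 𝒞 : Type*} {s : ℕ}

/-- The edge that the colour `c` contributes to a transversal factor. -/
def slotEdge (V : Finset 𝒱) (σ : 𝒱 → ℕ × Fin s) (κ : 𝒞 → ℕ × Finset (Fin s)) (c : 𝒞) : Finset 𝒱 :=
  V.filter fun x => (σ x).1 = (κ c).1 ∧ (σ x).2 ∈ (κ c).2

/-- Two colours of `Q` are linked if their edges intersect. -/
def EdgeLinked (E : 𝒞 → Finset 𝒱) (Q : Finset 𝒞) (c c' : 𝒞) : Prop :=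
  c ∈ Q ∧ c' ∈ Q ∧ ¬ Disjoint (E c) (E c')

lemma fst_eq_of_edgeLinked {V : Finset 𝒱} {σ : 𝒱 → ℕ × Fin s} {κ : 𝒞 → ℕ × Finset (Fin s)}
    {E : 𝒞 → Finset 𝒱} {Q : Finset 𝒞} (hE : ∀ c ∈ Q, slotEdge V σ κ c = E c) {c c' : 𝒞}
    (h : EdgeLinked E Q c c') : (κ c).1 = (κ c').1 := by
  obtain ⟨hc, hc', h⟩ := h
  obtain ⟨x, hx, hx'⟩ := Finset.not_disjoint_iff.1 h
  rw [← hE c hc] at hx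
  rw [← hE c' hc'] at hx'
  rw [← (Finset.mem_filter.1 hx).2.1, ← (Finset.mem_filter.1 hx').2.1]

lemma fst_eq_of_quot_mk_eq {V : Finset 𝒱} {σ : 𝒱 → ℕ × Fin s} {κ : 𝒞 → ℕ × Finset (Fin s)}
    {E : 𝒞 → Finset 𝒱} {Q : Finset 𝒞} (hE : ∀ c ∈ Q, slotEdge V σ κ c = E c) {c c' : 𝒞}
    (h : Quot.mk (EdgeLinked E Q) c = Quot.mk (EdgeLinked E Q) c') : (κ c).1 = (κ c').1 :=
  congrArg (Quot.lift (fun c => (κ c).1) fun _ _ h => fst_eq_of_edgeLinked hE h) h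

variable [DecidableEq 𝒱]

open Classical in
/-- A partial transversal factor with `r` connected components, `a` vertices and `b` edges satisfies
`b ≤ m₁(F) * (a - r)`. -/
lemma IsSlotFactor.card_le_maxOneDensity_mul {F : Finset (Finset (Fin s))}
    {H : 𝒞 → Finset (Finset 𝒱)} {V : Finset 𝒱} {C : Finset 𝒞} {J : Finset ℕ} {σ : 𝒱 → ℕ × Fin s}
    {κ : 𝒞 → ℕ × Finset (Fin s)} (h : IsSlotFactor F H V C J σ κ) {Q : Finset 𝒞} (hQ : Q ⊆ C)
    (hcard : ∀ c ∈ Q, 2 ≤ (slotEdge V σ κ c).card) :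
    (Q.card : ℝ) ≤ maxOneDensity F * (((Q.biUnion (slotEdge V σ κ)).card : ℝ) -
      (Q.image (Quot.mk (EdgeLinked (slotEdge V σ κ) Q))).card) := by
  set E := slotEdge V σ κ with hE
  set R := Q.image (Quot.mk (EdgeLinked E Q)) with hR
  set Qc := fun ρ => Q.filter fun c => Quot.mk (EdgeLinked E Q) c = ρ with hQc
  have hQsum : (Q.card : ℝ) = ∑ ρ ∈ R, ((Qc ρ).card : ℝ) := by
    exact_mod_cast Finset.card_eq_sum_card_image (Quot.mk (EdgeLinked E Q)) Q
  have hPsum : (∑ ρ ∈ R, (((Qc ρ).biUnion E).card : ℝ)) ≤ (Q.biUnion E).card := by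
    rw [← Nat.cast_sum, ← Finset.card_biUnion]
    · refine Nat.cast_le.2 (Finset.card_le_card ?_)
      rw [Finset.biUnion_subset]
      exact fun ρ _ => Finset.biUnion_subset_biUnion_of_subset_left _ (Finset.filter_subset _ _)
    · intro ρ _ ρ' _ hne
      refine Finset.disjoint_left.2 fun x hx hx' => ?_
      obtain ⟨c, hc, hxc⟩ := Finset.mem_biUnion.1 hx
      obtain ⟨c', hc', hxc'⟩ := Finset.mem_biUnion.1 hx'
      have hcQ := Finset.mem_filter.1 hc
      have hcQ' := Finset.mem_filter.1 hc'
      refine hne ?_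
      rw [← hcQ.2, ← hcQ'.2]
      exact Quot.sound ⟨hcQ.1, hcQ'.1, Finset.not_disjoint_iff.2 ⟨x, hxc, hxc'⟩⟩
  have hcomp : ∀ ρ ∈ R, ((Qc ρ).card : ℝ) ≤
      maxOneDensity F * ((((Qc ρ).biUnion E).card : ℝ) - 1) := by
    intro ρ hρ
    obtain ⟨c₀, hc₀, hcρ⟩ := Finset.mem_image.1 hρ
    have hc₀ρ : c₀ ∈ Qc ρ := Finset.mem_filter.2 ⟨hc₀, hcρ⟩
    have hslot : ∀ c ∈ Qc ρ, (κ c).1 = (κ c₀).1 := fun c hc =>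
      fst_eq_of_quot_mk_eq (E := E) (Q := Q) (fun _ _ => rfl)
        ((Finset.mem_filter.1 hc).2.trans hcρ.symm)
    have hslotV : ∀ x ∈ (Qc ρ).biUnion E, x ∈ V ∧ (σ x).1 = (κ c₀).1 := by
      intro x hx
      obtain ⟨c, hc, hxc⟩ := Finset.mem_biUnion.1 hx
      obtain ⟨hxV, hx1, -⟩ := Finset.mem_filter.1 hxc
      exact ⟨hxV, hx1.trans (hslot c hc)⟩
    have hcW : (((Qc ρ).biUnion E).image fun x => (σ x).2).card = ((Qc ρ).biUnion E).card := by
      refine Finset.card_image_of_injOn fun x hx y hy hxy => ?_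
      obtain ⟨hxV, hx1⟩ := hslotV x hx
      obtain ⟨hyV, hy1⟩ := hslotV y hy
      exact h.bijOn_vertex.injOn hxV hyV (Prod.ext (hx1.trans hy1.symm) hxy)
    have hcQ : ((Qc ρ).image fun c => (κ c).2).card = (Qc ρ).card := by
      refine Finset.card_image_of_injOn fun c hc c' hc' hcc => ?_
      rw [Finset.mem_coe] at hc hc'
      exact h.bijOn_colour.injOn (hQ (Finset.mem_filter.1 hc).1) (hQ (Finset.mem_filter.1 hc').1)
        (Prod.ext ((hslot c hc).trans (hslot c' hc').symm) hcc)
    have h2 : 2 ≤ ((Qc ρ).biUnion E).card :=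
      (hcard c₀ hc₀).trans (Finset.card_le_card (Finset.subset_biUnion_of_mem E hc₀ρ))
    have hd := div_le_maxOneDensity (F := F) (E := (Qc ρ).image fun c => (κ c).2)
      (W := ((Qc ρ).biUnion E).image fun x => (σ x).2) ?_ ?_ (by rw [hcW]; exact h2)
    · rw [hcW, hcQ] at hd
      have h2' : (2 : ℝ) ≤ ((Qc ρ).biUnion E).card := by exact_mod_cast h2
      rwa [div_le_iff₀ (by linarith)] at hd
    · intro e he
      obtain ⟨c, hc, rfl⟩ := Finset.mem_image.1 he
      exact (Finset.mem_product.1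
        (h.bijOn_colour.mapsTo (hQ (Finset.mem_filter.1 hc).1))).2
    · intro e he i hi
      obtain ⟨c, hc, rfl⟩ := Finset.mem_image.1 he
      have hJ := (Finset.mem_product.1
        (h.bijOn_colour.mapsTo (hQ (Finset.mem_filter.1 hc).1))).1
      obtain ⟨x, hxV, hx⟩ := h.bijOn_vertex.surjOn
        (show ((κ c).1, i) ∈ ((J ×ˢ Finset.univ : Finset (ℕ × Fin s)) : Set (ℕ × Fin s)) from
          Finset.mem_coe.2 (Finset.mem_product.2 ⟨hJ, Finset.mem_univ i⟩))
      refine Finset.mem_image.2 ⟨x, Finset.mem_biUnion.2 ⟨c, hc, Finset.mem_filter.2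
        ⟨hxV, ?_, ?_⟩⟩, ?_⟩
      · rw [hx]
      · rw [hx]
        exact hi
      · rw [hx]
  calc (Q.card : ℝ) = ∑ ρ ∈ R, ((Qc ρ).card : ℝ) := hQsum
    _ ≤ ∑ ρ ∈ R, maxOneDensity F * ((((Qc ρ).biUnion E).card : ℝ) - 1) :=
        Finset.sum_le_sum hcomp
    _ = maxOneDensity F * ((∑ ρ ∈ R, (((Qc ρ).biUnion E).card : ℝ)) - R.card) := by
        rw [← Finset.mul_sum, Finset.sum_sub_distrib, Finset.sum_const, nsmul_eq_mul, mul_one]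
    _ ≤ _ := by
        refine mul_le_mul_of_nonneg_left (by linarith) ?_
        refine Real.sSup_nonneg ?_
        rintro x ⟨W, E', -, -, hW, rfl⟩
        have : (2 : ℝ) ≤ W.card := by exact_mod_cast hW
        exact div_nonneg (Nat.cast_nonneg _) (by linarith)

end EdgeSpread

section Spread

variable {𝒱 𝒞 : Type*} [DecidableEq 𝒱] [DecidableEq 𝒞] {s : ℕ}

open Classical in
/-- The probability that a spread random factor contains given edges, in terms of the number of
components of these edges. -/
lemma HasSpreadFactor.sum_slotEdge_eq_mul_le {F : Finset (Finset (Fin s))}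
    {H : 𝒞 → Finset (Finset 𝒱)} {V : Finset 𝒱} {C : Finset 𝒞} {J : Finset ℕ} {K : ℝ}
    {Ω : Type} [Fintype Ω] {w : Ω → ℝ} {σ : Ω → 𝒱 → ℕ × Fin s} {κ : Ω → 𝒞 → ℕ × Finset (Fin s)}
    (hw : ∀ ω, 0 ≤ w ω) (hfac : ∀ ω, IsSlotFactor F H V C J (σ ω) (κ ω))
    (hspr : ∀ P ⊆ V, ∀ Q ⊆ C, ∀ (g : 𝒱 → ℕ × Fin s) (h : 𝒞 → ℕ × Finset (Fin s)),
      (∑ ω with (∀ x ∈ P, σ ω x = g x) ∧ ∀ c ∈ Q, κ ω c = h c, w ω) *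
        (V.card.descFactorial P.card * C.card.descFactorial Q.card) ≤ K ^ (P.card + Q.card))
    (ω₀ : Ω) {Q : Finset 𝒞} (hQ : Q ⊆ C) {E : 𝒞 → Finset 𝒱}
    (hE : ∀ c ∈ Q, slotEdge V (σ ω₀) (κ ω₀) c = E c) :
    (∑ ω with ∀ c ∈ Q, slotEdge V (σ ω) (κ ω) c = E c, w ω) *
      (V.card.descFactorial (Q.biUnion E).card * C.card.descFactorial Q.card) ≤
      (J.card ^ (Q.image (Quot.mk (EdgeLinked E Q))).card * s ^ (Q.biUnion E).card *
        F.card ^ Q.card : ℕ) * K ^ ((Q.biUnion E).card + Q.card) := by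
  set P := Q.biUnion E with hP
  set R := Q.image (Quot.mk (EdgeLinked E Q)) with hR
  have hPV : P ⊆ V := by
    rw [hP, Finset.biUnion_subset]
    intro c hc
    rw [← hE c hc]
    exact Finset.filter_subset _ _
  have hpc : ∀ x : P, ∃ c ∈ Q, x.1 ∈ E c := fun x => Finset.mem_biUnion.1 x.2
  choose pc hpcQ hpcE using hpc
  have hrc : ∀ ρ : R, ∃ c ∈ Q, Quot.mk (EdgeLinked E Q) c = ρ.1 := fun ρ => Finset.mem_image.1 ρ.2
  choose rc hrcQ hrcR using hrc
  have memR : ∀ c ∈ Q, Quot.mk (EdgeLinked E Q) c ∈ R := fun c hc => Finset.mem_image_of_mem _ hc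
  let g : (R → J) × (P → Fin s) × (Q → F) → 𝒱 → ℕ × Fin s := fun D x => if hx : x ∈ P then
    (D.1 ⟨_, memR _ (hpcQ ⟨x, hx⟩)⟩, D.2.1 ⟨x, hx⟩) else σ ω₀ x
  let h : (R → J) × (P → Fin s) × (Q → F) → 𝒞 → ℕ × Finset (Fin s) := fun D c =>
    if hc : c ∈ Q then (D.1 ⟨_, memR c hc⟩, D.2.2 ⟨c, hc⟩) else κ ω₀ c
  have hagree : ∀ ω, (∀ c ∈ Q, slotEdge V (σ ω) (κ ω) c = E c) →
      ∃ D, (∀ x ∈ P, σ ω x = g D x) ∧ ∀ c ∈ Q, κ ω c = h D c := by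
    intro ω hω
    have hκ : ∀ c ∈ Q, κ ω c ∈ J ×ˢ F := fun c hc => (hfac ω).bijOn_colour.mapsTo (hQ hc)
    refine ⟨⟨fun ρ => ⟨(κ ω (rc ρ)).1, (Finset.mem_product.1 (hκ _ (hrcQ ρ))).1⟩,
      fun x => (σ ω x).2, fun c => ⟨(κ ω c).2, (Finset.mem_product.1 (hκ _ c.2)).2⟩⟩, ?_, ?_⟩
    · intro x hx
      simp only [g, hx, dif_pos]
      refine Prod.ext ?_ rfl
      have h1 := hpcE ⟨x, hx⟩
      rw [← hω _ (hpcQ ⟨x, hx⟩)] at h1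
      exact (Finset.mem_filter.1 h1).2.1.trans
        (fst_eq_of_quot_mk_eq hω (hrcR ⟨_, memR _ (hpcQ ⟨x, hx⟩)⟩).symm)
    · intro c hc
      simp only [h, hc, dif_pos]
      refine Prod.ext ?_ rfl
      exact fst_eq_of_quot_mk_eq hω (hrcR ⟨_, memR c hc⟩).symm
  have hsum : (∑ ω with ∀ c ∈ Q, slotEdge V (σ ω) (κ ω) c = E c, w ω) ≤
      ∑ D, ∑ ω with (∀ x ∈ P, σ ω x = g D x) ∧ ∀ c ∈ Q, κ ω c = h D c, w ω := by
    simp_rw [Finset.sum_filter]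
    rw [Finset.sum_comm]
    refine Finset.sum_le_sum fun ω _ => ?_
    have hnn : ∀ D, 0 ≤ if (∀ x ∈ P, σ ω x = g D x) ∧ ∀ c ∈ Q, κ ω c = h D c then w ω else 0 :=
      fun D => by
        split_ifs
        · exact hw ω
        · exact le_rfl
    by_cases hω : ∀ c ∈ Q, slotEdge V (σ ω) (κ ω) c = E c
    · obtain ⟨D, hD⟩ := hagree ω hω
      rw [if_pos hω]
      refine le_trans (le_of_eq (if_pos hD).symm)
        (Finset.single_le_sum (fun D _ => hnn D) (Finset.mem_univ D))
    · rw [if_neg hω]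
      exact Finset.sum_nonneg fun D _ => hnn D
  calc _ ≤ (∑ D, ∑ ω with (∀ x ∈ P, σ ω x = g D x) ∧ ∀ c ∈ Q, κ ω c = h D c, w ω) *
        (V.card.descFactorial P.card * C.card.descFactorial Q.card) := by gcongr
    _ ≤ ∑ _D : (R → J) × (P → Fin s) × (Q → F), K ^ (P.card + Q.card) := by
        rw [Finset.sum_mul]
        exact Finset.sum_le_sum fun D _ => hspr P hPV Q hQ (g D) (h D)
    _ = _ := by
        rw [Finset.sum_const, Finset.card_univ, Fintype.card_prod, Fintype.card_prod,
          Fintype.card_fun, Fintype.card_fun, Fintype.card_fun, Fintype.card_coe, Fintype.card_coe,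
          Fintype.card_coe, Fintype.card_coe, Fintype.card_coe, Fintype.card_fin, nsmul_eq_mul,
          mul_assoc]

/-- A spread random factor, viewed as a random set of coloured edges, is spread. -/
lemma HasSpreadFactor.exists_edge_spread {k t n : ℕ} (hk : 2 ≤ k) (hs : 1 ≤ s) (ht : 1 ≤ t)
    (hn : 1 ≤ n) {F : Finset (Finset (Fin s))} (hF : F.card = t) {H : 𝒞 → Finset (Finset 𝒱)}
    {V : Finset 𝒱} {C : Finset 𝒞} {J : Finset ℕ} (hV : V.card = s * n) (hC : C.card = t * n)
    (hJ : J.card = n) (hH : ∀ c ∈ C, ∀ e ∈ H c, e.card = k) (hm : 0 < maxOneDensity F) {K : ℝ}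
    (hK : 1 ≤ K) (h : HasSpreadFactor F H V C J K) :
    ∃ (Ω : Type) (_ : Fintype Ω) (w : Ω → ℝ) (A : Ω → Finset (𝒞 × Finset 𝒱)),
      (∀ ω, 0 ≤ w ω) ∧ ∑ ω, w ω = 1 ∧
      (∀ ω, ∃ σ κ, IsSlotFactor F H V C J σ κ ∧ A ω = C.image fun c => (c, slotEdge V σ κ c)) ∧
      ∀ S, ∑ ω with S ⊆ A ω, w ω ≤
        ((3 * K) ^ (k + 1) * (n : ℝ) ^ (-(1 / maxOneDensity F) - 1)) ^ S.card := by
  obtain ⟨Ω, _, w, σ, κ, hw, hsum, hfac, hspr⟩ := h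
  refine ⟨Ω, inferInstance, w, fun ω => C.image fun c => (c, slotEdge V (σ ω) (κ ω) c), hw, hsum,
    fun ω => ⟨σ ω, κ ω, hfac ω, rfl⟩, fun S => ?_⟩
  have hn0 : (0 : ℝ) < n := by exact_mod_cast hn
  by_cases hex : ∃ ω₀, S ⊆ C.image fun c => (c, slotEdge V (σ ω₀) (κ ω₀) c)
  swap
  · push Not at hex
    rw [Finset.filter_false_of_mem fun ω _ => hex ω, Finset.sum_empty]
    positivity
  obtain ⟨ω₀, hS⟩ := hex
  set E := slotEdge V (σ ω₀) (κ ω₀) with hE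
  set Q := S.image Prod.fst with hQ
  have hSE : ∀ q ∈ S, q.1 ∈ C ∧ q.2 = E q.1 := by
    intro q hq
    obtain ⟨c, hc, rfl⟩ := Finset.mem_image.1 (hS hq)
    exact ⟨hc, rfl⟩
  have hQC : Q ⊆ C := by
    intro c hc
    obtain ⟨q, hq, rfl⟩ := Finset.mem_image.1 hc
    exact (hSE q hq).1
  have hQS : Q.card = S.card := Finset.card_image_of_injOn fun q hq q' hq' hqq => by
    refine Prod.ext hqq ?_
    rw [(hSE q hq).2, (hSE q' hq').2]
    exact congrArg E hqq
  have hEk : ∀ c ∈ Q, (E c).card = k := fun c hc =>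
    hH c (hQC hc) _ ((hfac ω₀).edge_mem c (hQC hc))
  have hmono : ∑ ω with S ⊆ C.image fun c => (c, slotEdge V (σ ω) (κ ω) c), w ω ≤
      ∑ ω with ∀ c ∈ Q, slotEdge V (σ ω) (κ ω) c = E c, w ω := by
    refine Finset.sum_le_sum_of_subset_of_nonneg ?_ fun ω _ _ => hw ω
    refine Finset.monotone_filter_right _ fun ω _ hω c hc => ?_
    obtain ⟨q, hq, rfl⟩ := Finset.mem_image.1 hc
    obtain ⟨c, -, hc⟩ := Finset.mem_image.1 (hω hq)
    rw [← (hSE q hq).2, ← hc]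
  refine hmono.trans ?_
  classical
  have key := HasSpreadFactor.sum_slotEdge_eq_mul_le hw hfac hspr ω₀ hQC
    (E := E) fun _ _ => rfl
  have hdens := (hfac ω₀).card_le_maxOneDensity_mul hQC fun c hc => (hEk c hc).symm ▸ hk
  rw [← hE] at hdens
  have hPV : Q.biUnion E ⊆ V := Finset.biUnion_subset.2 fun c _ => Finset.filter_subset _ _
  have ha : (Q.biUnion E).card ≤ Q.card * k :=
    Finset.card_biUnion_le_card_mul _ _ _ fun c hc => (hEk c hc).le
  have hd1 := natCast_pow_le_three_pow_mul_descFactorial (Finset.card_le_card hPV)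
  have hd2 := natCast_pow_le_three_pow_mul_descFactorial (Finset.card_le_card hQC)
  rw [hV] at key hd1
  rw [hC] at key hd2
  rw [hJ, hF] at key
  set p := ∑ ω with ∀ c ∈ Q, slotEdge V (σ ω) (κ ω) c = E c, w ω with hp
  have hp0 : 0 ≤ p := Finset.sum_nonneg fun ω _ => hw ω
  rw [← hQS]
  set a := (Q.biUnion E).card
  set b := Q.card
  set r := (Q.image (Quot.mk (EdgeLinked E Q))).card
  clear_value p a b r
  have hs0 : (0 : ℝ) < s := by exact_mod_cast hs
  have ht0 : (0 : ℝ) < t := by exact_mod_cast ht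
  push_cast at key hd1 hd2
  have hmul : p * ((s : ℝ) ^ a * t ^ b * n ^ (a + b)) ≤
      ((3 * K) ^ (a + b) * n ^ r) * (s ^ a * t ^ b) := by
    calc p * ((s : ℝ) ^ a * t ^ b * n ^ (a + b)) = p * (((s : ℝ) * n) ^ a * (t * n) ^ b) := by ring
      _ ≤ p * ((3 ^ a * (s * n).descFactorial a) * (3 ^ b * (t * n).descFactorial b)) := by gcongr
      _ = 3 ^ (a + b) * (p * ((s * n).descFactorial a * (t * n).descFactorial b)) := by ring
      _ ≤ 3 ^ (a + b) * ((n : ℝ) ^ r * s ^ a * t ^ b * K ^ (a + b)) := by gcongr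
      _ = _ := by rw [mul_pow]; ring
  have hmul' : p * (n : ℝ) ^ (a + b) ≤ (3 * K) ^ (a + b) * n ^ r := by
    refine le_of_mul_le_mul_right ?_ (by positivity : 0 < (s : ℝ) ^ a * t ^ b)
    refine le_trans (le_of_eq ?_) hmul
    ring
  have hn1 : (1 : ℝ) ≤ n := by exact_mod_cast hn
  have hexp : (r : ℝ) - (a + b) ≤ (-(1 / maxOneDensity F) - 1) * b := by
    have : (b : ℝ) / maxOneDensity F ≤ a - r := by
      rw [div_le_iff₀ hm, mul_comm]
      exact hdens
    have e : (-(1 / maxOneDensity F) - 1) * (b : ℝ) = -(b / maxOneDensity F) - b := by ring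
    linarith
  have hpn : p ≤ (3 * K) ^ (a + b) * (n : ℝ) ^ ((r : ℝ) - (a + b)) := by
    rw [Real.rpow_sub hn0, Real.rpow_natCast, ← Nat.cast_add, Real.rpow_natCast, ← mul_div_assoc,
      le_div_iff₀ (by positivity)]
    exact hmul'
  calc p ≤ (3 * K) ^ (a + b) * (n : ℝ) ^ ((r : ℝ) - (a + b)) := hpn
    _ ≤ (3 * K) ^ ((k + 1) * b) * (n : ℝ) ^ ((-(1 / maxOneDensity F) - 1) * b) := by
        refine mul_le_mul (pow_le_pow_right₀ (by linarith) ?_)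
          (Real.rpow_le_rpow_of_exponent_le hn1 hexp) (by positivity) (by positivity)
        rw [add_mul, one_mul, mul_comm k b]
        omega
    _ = _ := by
        rw [mul_pow ((3 * K) ^ (k + 1)), ← pow_mul (3 * K), Real.rpow_mul_natCast hn0.le]

end Spread

section Robustness

lemma card_filter_snd_mem {M : ℕ} {V : Type*} [Fintype V] [DecidableEq V]
    (σ : Fin M → Finset (Finset V)) :
    (Finset.univ.filter fun x : Fin M × Finset V => x.2 ∈ σ x.1).card = ∑ i, (σ i).card := by
  rw [Finset.card_filter, Fintype.sum_prod_type]
  refine Finset.sum_congr rfl fun i _ => ?_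
  rw [← Finset.card_filter]
  simp

open Classical in
/-- A random sparsification of a system is a random subset of the set of its coloured edges. -/
lemma sysSparsProb_eq_binExp {M : ℕ} {V : Type*} [Fintype V] [DecidableEq V]
    (Hs : Fin M → Finset (Finset V)) (p : ℝ) (E : (Fin M → Finset (Finset V)) → Prop) :
    sysSparsProb Hs p E =
      binExp p (Finset.univ.filter fun x : Fin M × Finset V => x.2 ∈ Hs x.1) fun W =>
        if E fun i => Finset.univ.filter fun e => (i, e) ∈ W then 1 else 0 := by
  refine Finset.sum_bij' (fun σ _ => Finset.univ.filter fun x => x.2 ∈ σ x.1)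
    (fun W _ i => Finset.univ.filter fun e => (i, e) ∈ W) (fun σ hσ => ?_) (fun W hW => ?_)
    (fun σ _ => ?_) (fun W _ => ?_) fun σ hσ => ?_
  · rw [Finset.mem_powerset]
    refine Finset.monotone_filter_right _ fun x _ hx => ?_
    exact Finset.mem_powerset.1 (Fintype.mem_piFinset.1 hσ x.1) hx
  · refine Fintype.mem_piFinset.2 fun i => Finset.mem_powerset.2 fun e he => ?_
    simpa using Finset.mem_powerset.1 hW (Finset.mem_filter.1 he).2
  · ext i e
    simp
  · ext x
    simp
  · have hle : ∀ i, (σ i).card ≤ (Hs i).card := fun i =>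
      Finset.card_le_card (Finset.mem_powerset.1 (Fintype.mem_piFinset.1 hσ i))
    have hσ' : (fun i => Finset.univ.filter fun e => (i, e) ∈
        Finset.univ.filter fun x : Fin M × Finset V => x.2 ∈ σ x.1) = σ := by
      ext i e
      simp
    beta_reduce
    rw [hσ', card_filter_snd_mem, card_filter_snd_mem, ← Finset.sum_tsub_distrib _ fun i _ => hle i,
      mul_ite, mul_one, mul_zero, Finset.prod_mul_distrib, Finset.prod_pow_eq_pow_sum,
      Finset.prod_pow_eq_pow_sum]

lemma IsSlotFactor.isTransversalFFactor {s t n : ℕ} {F : Finset (Finset (Fin s))}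
    {H Hs : Fin (t * n) → Finset (Finset (Fin (s * n)))}
    {σ : Fin (s * n) → ℕ × Fin s} {κ : Fin (t * n) → ℕ × Finset (Fin s)}
    (h : IsSlotFactor F H Finset.univ Finset.univ (Finset.range n) σ κ)
    (hHs : ∀ c, slotEdge Finset.univ σ κ c ∈ Hs c) : IsTransversalFFactor F Hs := by
  have hσ : ∀ (j : Fin n) (a : Fin s), ∃ x, σ x = ((j : ℕ), a) := fun j a => by
    obtain ⟨x, -, hx⟩ := h.bijOn_vertex.surjOn (show ((j : ℕ), a) ∈ _ by simp)
    exact ⟨x, hx⟩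
  have hκ : ∀ (y : Fin n × {e // e ∈ F}), ∃ c, κ c = ((y.1 : ℕ), y.2.1) := fun y => by
    obtain ⟨x, -, hx⟩ := h.bijOn_colour.surjOn
      (show ((y.1 : ℕ), y.2.1) ∈ _ by simp)
    exact ⟨x, hx⟩
  have hσi : Function.Injective σ := fun x y hxy =>
    h.bijOn_vertex.injOn (by simp) (by simp) hxy
  have hκi : Function.Injective κ := fun x y hxy =>
    h.bijOn_colour.injOn (by simp) (by simp) hxy
  choose φ hφ using hσ
  choose c hc using hκ
  refine ⟨φ, fun j a b hab => ?_, fun j j' hj a b hab => ?_, c, ⟨fun y y' hy => ?_, fun i => ?_⟩,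
    fun j e => ?_⟩
  · have := congrArg σ hab
    rw [hφ, hφ] at this
    exact congrArg Prod.snd this
  · have := congrArg σ hab
    rw [hφ, hφ] at this
    exact hj (Fin.ext (congrArg Prod.fst this))
  · have := congrArg κ hy
    rw [hc, hc, Prod.ext_iff] at this
    exact Prod.ext (Fin.ext this.1) (Subtype.ext this.2)
  · have hi := h.bijOn_colour.mapsTo (show i ∈ _ by simp)
    simp only [Finset.coe_product, Set.mem_prod, Finset.mem_coe, Finset.mem_range] at hi
    refine ⟨(⟨_, hi.1⟩, ⟨_, hi.2⟩), hκi ?_⟩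
    rw [hc]
  · convert hHs (c (j, e)) using 1
    ext x
    simp only [slotEdge, Finset.mem_image, Finset.mem_filter, Finset.mem_univ, true_and, hc]
    constructor
    · rintro ⟨a, ha, rfl⟩
      rw [hφ]
      exact ⟨rfl, ha⟩
    · rintro ⟨h1, h2⟩
      exact ⟨_, h2, hσi (by rw [hφ, ← h1])⟩

lemma maxOneDensity_pos {V : Type*} [Fintype V] [DecidableEq V] {F : Finset (Finset V)}
    {e : Finset V} (he : e ∈ F) (hcard : 2 ≤ e.card) : 0 < maxOneDensity F := by
  refine lt_of_lt_of_le ?_ (div_le_maxOneDensity (E := {e}) (W := e) (by simpa) (by simp) hcard)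
  have : (2 : ℝ) ≤ e.card := by exact_mod_cast hcard
  rw [Finset.card_singleton, Nat.cast_one]
  exact div_pos one_pos (by linarith)

lemma exists_robustness_constant {α : ℝ} (hα : 0 < α) {k s t d : ℕ} (hd : 1 ≤ d) (hdk : d < k)
    (hs : 1 ≤ s) (ht : 0 < t) {F : Finset (Finset (Fin s))} (hFk : ∀ e ∈ F, e.card = k)
    (hF : F.card = t) :
    ∃ C : ℝ, 0 < C ∧ ∀ ε : ℝ, 0 < ε → ∃ n₀ : ℕ, ∀ n : ℕ, n₀ ≤ n →
      ∀ Hs : Fin (t * n) → Finset (Finset (Fin (s * n))),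
        (∀ i, ∀ e ∈ Hs i, e.card = k) →
        (∀ i (D : Finset (Fin (s * n))), D.card = d →
          (transversalDiracThreshold k s t d F + α) * ((s * n - d).choose (k - d) : ℝ) ≤
            (((Hs i).filter fun e => D ⊆ e).card : ℝ)) →
      ∀ p : ℝ, p ≤ 1 → C * (n : ℝ) ^ (-(1 / maxOneDensity F) - 1) * Real.log n ≤ p →
        1 - ε ≤ sysSparsProb Hs p (fun σ => IsTransversalFFactor F σ) := by
  classical
  obtain ⟨n₁, hbase⟩ := exists_isSlotFactor_of_threshold_lt hdk.le (by omega) hs ht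
    (show transversalDiracThreshold k s t d F < transversalDiracThreshold k s t d F + α / 2 by
      linarith)
  obtain ⟨K, M, hK, hspread⟩ := exists_hasSpreadFactor hdk hs (half_pos hα) hbase
  set K' := max K 1 with hK'
  have hK'1 : 1 ≤ K' := le_max_right _ _
  have hm : 0 < maxOneDensity F := by
    obtain ⟨e, he⟩ := Finset.card_pos.1 (hF.symm ▸ ht)
    exact maxOneDensity_pos he (by rw [hFk e he]; omega)
  refine ⟨512 * (3 * K') ^ (k + 1), by positivity, fun ε hε => ?_⟩
  obtain ⟨n₀, hn₀, hthr⟩ := spread_threshold ht hε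
  refine ⟨max n₀ M, fun n hn Hs hHs hdeg p hp1 hp => ?_⟩
  have hn0 : n₀ ≤ n := (le_max_left _ _).trans hn
  have hnpos : (0 : ℝ) < n := by exact_mod_cast (by omega : 0 < n)
  have hspr := (hspread _ _ Hs Finset.univ Finset.univ (Finset.range n) n
    ((le_max_right _ _).trans hn) (by simp) (by simp) (by simp) (fun c _ => hHs c) ?_).mono hK.le
    (le_max_left K 1)
  swap
  · intro c _ D _ hD
    rw [Finset.card_univ, Fintype.card_fin, add_assoc, add_halves]
    simpa using hdeg c D hD
  obtain ⟨Ω, _, w, A, hw, hsum, hA, hAS⟩ := hspr.exists_edge_spread (k := k) (t := t) (n := n)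
    (by omega) hs ht (by omega) hF (by simp) (by simp) (by simp) (fun c _ => hHs c) hm hK'1
  rw [sysSparsProb_eq_binExp]
  have hlog : 0 ≤ Real.log n := Real.log_natCast_nonneg n
  have hp0 : 0 ≤ p := le_trans (by positivity) hp
  refine (hthr n hn0 (I := Finset.univ) (S := A) (μ := w) ?_ hw hsum ?_ hAS ?_
    (by rw [← mul_assoc]; exact hp) hp1).trans (binExp_mono hp0 hp1 fun W _ => ?_)
  · intro ω _ x hx
    obtain ⟨σ, κ, hfac, hAω⟩ := hA ω
    rw [hAω] at hx
    obtain ⟨c, -, rfl⟩ := Finset.mem_image.1 hx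
    exact Finset.mem_filter.2 ⟨Finset.mem_univ _, hfac.edge_mem c (Finset.mem_univ c)⟩
  · positivity
  · intro ω _
    obtain ⟨σ, κ, -, hAω⟩ := hA ω
    rw [hAω]
    exact Finset.card_image_le.trans (by simp)
  · unfold containsMember
    split_ifs with h1 h2 h2
    · exact le_rfl
    · refine absurd ?_ h2
      obtain ⟨ω, -, hω⟩ := h1
      obtain ⟨σ, κ, hfac, hAω⟩ := hA ω
      refine hfac.isTransversalFFactor fun c => Finset.mem_filter.2 ⟨Finset.mem_univ _, hω ?_⟩
      rw [hAω]
      exact Finset.mem_image_of_mem _ (Finset.mem_univ c)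
    · exact zero_le_one
    · exact le_rfl

end Robustness

theorem transversal_factor_robustness_general
    (α : ℝ) (hα : 0 < α) (k s t : ℕ) (hk : 0 < k) (hs : 2 ≤ s) (ht : 0 < t) :
    ∃ C : ℝ, 0 < C ∧
      ∀ d : ℕ, 1 ≤ d → d ≤ k - 1 →
      ∀ F : Finset (Finset (Fin s)),
        (∀ e ∈ F, e.card = k) → F.card = t →
      ∀ ε : ℝ, 0 < ε →
      ∃ n₀ : ℕ, ∀ n : ℕ, n₀ ≤ n →
      ∀ Hs : Fin (t * n) → Finset (Finset (Fin (s * n))),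
        (∀ i, ∀ e ∈ Hs i, e.card = k) →
        (∀ i (D : Finset (Fin (s * n))), D.card = d →
          (transversalDiracThreshold k s t d F + α) * ((s * n - d).choose (k - d) : ℝ) ≤
            (((Hs i).filter fun e => D ⊆ e).card : ℝ)) →
      ∀ p : ℝ, 0 ≤ p → p ≤ 1 →
        C * (n : ℝ) ^ (-(1 / maxOneDensity F) - 1) * Real.log n ≤ p →
        1 - ε ≤ sysSparsProb Hs p (fun σ => IsTransversalFFactor F σ) := by
  classical
  have key := fun (d : ℕ) (F : Finset (Finset (Fin s)))
    (h : (1 ≤ d ∧ d < k) ∧ (∀ e ∈ F, e.card = k) ∧ F.card = t) =>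
    exists_robustness_constant hα h.1.1 h.1.2 (by omega) ht h.2.1 h.2.2
  choose C hC0 hC using key
  let C' : ℕ × Finset (Finset (Fin s)) → ℝ := fun x =>
    if h : (1 ≤ x.1 ∧ x.1 < k) ∧ (∀ e ∈ x.2, e.card = k) ∧ x.2.card = t then C x.1 x.2 h else 0
  have hC' : ∀ x, 0 ≤ C' x := fun x => by
    unfold C'
    split_ifs with h
    · exact (hC0 _ _ h).le
    · exact le_rfl
  refine ⟨∑ x ∈ Finset.range k ×ˢ Finset.univ, C' x + 1,
    add_pos_of_nonneg_of_pos (Finset.sum_nonneg fun x _ => hC' x) one_pos,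
    fun d hd hdk F hFk hF ε hε => ?_⟩
  have h : (1 ≤ d ∧ d < k) ∧ (∀ e ∈ F, e.card = k) ∧ F.card = t := ⟨⟨hd, by omega⟩, hFk, hF⟩
  obtain ⟨n₀, hn₀⟩ := hC d F h ε hε
  refine ⟨n₀, fun n hn Hs hHs hdeg p _ hp1 hp => hn₀ n hn Hs hHs hdeg p hp1 (le_trans ?_ hp)⟩
  have hlog : 0 ≤ Real.log n := Real.log_natCast_nonneg n
  have hle : C d F h ≤ ∑ x ∈ Finset.range k ×ˢ Finset.univ, C' x + 1 := by
    have h1 := Finset.single_le_sum (fun x _ => hC' x) (Finset.mem_product.2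
      ⟨Finset.mem_range.2 h.1.2, Finset.mem_univ F⟩ : (d, F) ∈ Finset.range k ×ˢ Finset.univ)
    have h2 : C' (d, F) = C d F h := dif_pos h
    linarith
  gcongr
end

section
/- For every ε > 0 there exists C = C(ε) > 0 such that the following holds for every sufficiently large n. Let G = (V_1, V_2) be a balanced bipartite graph with |V_1| = |V_2| = n. If δ(G) ≥ (1/2 + ε)n, then there is a (C/n)-vertex-spread probability distribution on embeddings of perfect matchings into G (i.e., on embeddings into G of the graph consisting of n pairwise disjoint edges). -/
open Classical in
/-- A probability distribution `μ` on functions `V → W` is `q`-vertex-spread if for any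
two sequences of distinct vertices `x : Fin s → V` and `y : Fin s → W`, the probability
that `f (x i) = y i` for all `i` is at most `q ^ s`. -/
def IsVertexSpread {V W : Type*} [Fintype V] [Fintype W] [DecidableEq V] [DecidableEq W]
    (q : ℝ) (μ : (V → W) → ℝ) : Prop :=
  ∀ (s : ℕ) (x : Fin s → V) (y : Fin s → W),
    Function.Injective x → Function.Injective y →
    ∑ f ∈ Finset.univ.filter (fun f : V → W => ∀ i, f (x i) = y i), μ f ≤ q ^ s

/-- Adjacency of the bipartite graph on `Fin n ⊕ Fin n` whose cross edges are
given by the relation `Adj` between the two sides. -/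
def bipAdj {n : ℕ} (Adj : Fin n → Fin n → Prop) : (Fin n ⊕ Fin n) → (Fin n ⊕ Fin n) → Prop
  | .inl a, .inr b => Adj a b
  | .inr b, .inl a => Adj a b
  | _, _ => False

/-- `f` is an embedding into the bipartite graph given by `Adj` of the graph consisting of
`n` pairwise disjoint edges (a perfect matching). -/
def IsPMEmbedding {n : ℕ} (Adj : Fin n → Fin n → Prop)
    (f : (Fin n ⊕ Fin n) → (Fin n ⊕ Fin n)) : Prop :=
  Function.Injective f ∧ ∀ i : Fin n, bipAdj Adj (f (Sum.inl i)) (f (Sum.inr i))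

open Finset Equiv

section PerfectMatchings

variable {α : Type*} [Fintype α]

open Classical in
/-- The permutations `σ` all of whose pairs `(a, σ a)` are edges: the perfect matchings of the
bipartite graph with edge relation `Adj`. -/
noncomputable def perfectMatchings (Adj : α → α → Prop) : Finset (Perm α) :=
  univ.filter fun σ => ∀ a, Adj a (σ a)

open Classical in
/-- The perfect matchings that agree with `τ` on `S`. -/
noncomputable def matchingsAgreeingOn (Adj : α → α → Prop) (S : Finset α) (τ : Perm α) :
    Finset (Perm α) :=
  (perfectMatchings Adj).filter fun σ => ∀ a ∈ S, σ a = τ a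

open Classical in
/-- The vertices `a` for which the pair `(a, σ a)` is not an edge. -/
noncomputable def nonEdges (Adj : α → α → Prop) (σ : Perm α) : Finset α :=
  univ.filter fun a => ¬ Adj a (σ a)

lemma mem_perfectMatchings {Adj : α → α → Prop} {σ : Perm α} :
    σ ∈ perfectMatchings Adj ↔ ∀ a, Adj a (σ a) := by
  simp [perfectMatchings]

lemma mem_matchingsAgreeingOn {Adj : α → α → Prop} {S : Finset α} {τ σ : Perm α} :
    σ ∈ matchingsAgreeingOn Adj S τ ↔ (∀ a, Adj a (σ a)) ∧ ∀ a ∈ S, σ a = τ a := by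
  simp [matchingsAgreeingOn, mem_perfectMatchings]

lemma mem_nonEdges {Adj : α → α → Prop} {σ : Perm α} {a : α} :
    a ∈ nonEdges Adj σ ↔ ¬ Adj a (σ a) := by
  simp [nonEdges]

open Classical in
/-- The degree condition `n + m ≤ deg a + deg b` for all `a`, `b` on the two sides. -/
def HasDegreeSum (Adj : α → α → Prop) (m : ℕ) : Prop :=
  ∀ a b, Fintype.card α + m ≤ #{b' | Adj a b'} + #{a' | Adj a' b}

open Classical in
lemma HasDegreeSum.le_card_switches {Adj : α → α → Prop} {m : ℕ} (h : HasDegreeSum Adj m)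
    (σ : Perm α) (a b : α) : m ≤ #{a' | Adj a (σ a') ∧ Adj a' b} := by
  have h1 : #{a' | Adj a (σ a')} = #{b' | Adj a b'} := by
    refine card_bij (fun x _ => σ x) (by simp) (by simp) fun b' hb' => ⟨σ.symm b', ?_, by simp⟩
    simpa using hb'
  have h2 := card_union_add_card_inter
    (univ.filter fun a' => Adj a (σ a')) (univ.filter fun a' => Adj a' b)
  have h3 := card_le_univ ((univ.filter fun a' => Adj a (σ a')) ∪ univ.filter fun a' => Adj a' b)
  rw [← filter_and] at h2
  have := h a b
  omega

open Classical in
lemma card_matchingsAgreeingOn_insert_mul_le {Adj : α → α → Prop} {m : ℕ}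
    (h : HasDegreeSum Adj m) (τ : Perm α) {S : Finset α} {a : α} (ha : a ∉ S) :
    #(matchingsAgreeingOn Adj (insert a S) τ) * (m - #S) ≤ #(matchingsAgreeingOn Adj S τ) := by
  set T : Perm α → Finset α :=
    fun σ => (univ.filter fun a' => Adj a (σ a') ∧ Adj a' (τ a)) \ S with hT
  have hcard : #(matchingsAgreeingOn Adj (insert a S) τ) * (m - #S) ≤
      #((matchingsAgreeingOn Adj (insert a S) τ).sigma T) := by
    rw [card_sigma, ← smul_eq_mul]
    refine card_nsmul_le_sum _ _ _ fun σ _ => ?_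
    have h1 := h.le_card_switches σ a (τ a)
    have h2 := le_card_sdiff S (univ.filter fun a' => Adj a (σ a') ∧ Adj a' (τ a))
    simp only [hT]
    omega
  refine hcard.trans (card_le_card_of_injOn (fun p => p.1 * swap a p.2) ?_ ?_)
  · rintro ⟨σ, a'⟩ hp
    simp only [hT, coe_sigma, Set.mem_sigma_iff, mem_coe, mem_matchingsAgreeingOn,
      mem_filter, mem_univ, true_and, mem_insert, mem_sdiff, forall_eq_or_imp] at hp ⊢
    obtain ⟨⟨hσ, hσa, hσS⟩, ⟨h1, h2⟩, hS⟩ := hp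
    refine ⟨fun c => ?_, fun c hc => ?_⟩
    · rw [Perm.mul_apply]
      by_cases hca : c = a
      · simpa [hca] using h1
      by_cases hca' : c = a'
      · simpa [hca', hσa] using h2
      rw [swap_apply_of_ne_of_ne hca hca']
      exact hσ c
    · rw [Perm.mul_apply, swap_apply_of_ne_of_ne (by rintro rfl; exact ha hc)
        (by rintro rfl; exact hS hc)]
      exact hσS c hc
  · rintro ⟨σ, a'⟩ hp ⟨ρ, c⟩ hq heq
    simp only [hT, coe_sigma, Set.mem_sigma_iff, mem_coe, mem_matchingsAgreeingOn,
      mem_filter, mem_univ, true_and, mem_insert, mem_sdiff, forall_eq_or_imp] at hp hq heq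
    have e1 : (σ * swap a a') a' = τ a := by simp [hp.1.2.1]
    have e2 : (ρ * swap a c) c = τ a := by simp [hq.1.2.1]
    have e3 : a' = c := (σ * swap a a').injective (by rw [e1, heq, e2])
    subst e3
    have e4 : σ = ρ := mul_right_cancel heq
    rw [e4]

lemma card_matchingsAgreeingOn_mul_descFactorial_le {Adj : α → α → Prop} {m : ℕ}
    (h : HasDegreeSum Adj m) (τ : Perm α) (S : Finset α) :
    #(matchingsAgreeingOn Adj S τ) * m.descFactorial #S ≤ #(perfectMatchings Adj) := by
  classical
  induction S using Finset.induction_on with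
  | empty => simpa using card_le_card fun σ hσ =>
      mem_perfectMatchings.2 (mem_matchingsAgreeingOn.1 hσ).1
  | insert a S ha ih =>
    rw [card_insert_of_notMem ha, Nat.descFactorial_succ, ← mul_assoc]
    exact (Nat.mul_le_mul_right _ (card_matchingsAgreeingOn_insert_mul_le h τ ha)).trans ih

lemma card_matchingsAgreeingOn_mul_descFactorial_card_le (Adj : α → α → Prop)
    (τ : Perm α) (S : Finset α) :
    #(matchingsAgreeingOn Adj S τ) * (Fintype.card α).descFactorial #S ≤
      (Fintype.card α).factorial := by
  classical
  have h : HasDegreeSum (fun _ _ : α => True) (Fintype.card α) := fun a b => by simp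
  calc _ ≤ #(matchingsAgreeingOn (fun _ _ => True) S τ) * (Fintype.card α).descFactorial #S :=
        Nat.mul_le_mul_right _ <| card_le_card fun σ hσ =>
          mem_matchingsAgreeingOn.2 ⟨fun _ => trivial, (mem_matchingsAgreeingOn.1 hσ).2⟩
    _ ≤ #(perfectMatchings fun _ _ : α => True) :=
        card_matchingsAgreeingOn_mul_descFactorial_le h τ S
    _ ≤ (Fintype.card α).factorial := (card_le_univ _).trans_eq Fintype.card_perm

open Classical in
lemma card_nonEdges_mul_swap_lt {Adj : α → α → Prop} {σ : Perm α} {a a' : α}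
    (ha : ¬ Adj a (σ a)) (h1 : Adj a (σ a')) (h2 : Adj a' (σ a)) :
    #(nonEdges Adj (σ * swap a a')) < #(nonEdges Adj σ) := by
  refine card_lt_card ⟨fun c hc => ?_, fun hsub => ?_⟩
  · rw [mem_nonEdges] at hc ⊢
    rw [Perm.mul_apply] at hc
    by_cases hca : c = a
    · rwa [hca]
    by_cases hca' : c = a'
    · rw [hca', swap_apply_right] at hc
      exact absurd h2 hc
    rwa [swap_apply_of_ne_of_ne hca hca'] at hc
  · have := hsub (mem_nonEdges.2 ha)
    simp [mem_nonEdges, h1] at this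

open Classical in
lemma card_nonEdges_eq_mul_le {Adj : α → α → Prop} {m : ℕ} (h : HasDegreeSum Adj m) (j : ℕ) :
    #{σ : Perm α | #(nonEdges Adj σ) = j + 1} * ((j + 1) * m) ≤
      #{σ : Perm α | #(nonEdges Adj σ) ≤ j} * Fintype.card α ^ 2 := by
  set T : Perm α → Finset ((_ : α) × α) := fun σ =>
    (nonEdges Adj σ).sigma fun a => univ.filter fun a' => Adj a (σ a') ∧ Adj a' (σ a) with hT
  set D := (univ.filter fun σ : Perm α => #(nonEdges Adj σ) = j + 1).sigma T with hD
  have hcard : #{σ : Perm α | #(nonEdges Adj σ) = j + 1} * ((j + 1) * m) ≤ #D := by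
    rw [hD, card_sigma, ← smul_eq_mul]
    refine card_nsmul_le_sum _ _ _ fun σ hσ => ?_
    rw [hT, card_sigma, ← (mem_filter.1 hσ).2, ← smul_eq_mul]
    exact card_nsmul_le_sum _ _ _ fun a _ => h.le_card_switches σ a (σ a)
  have himg : #D ≤ #((univ.filter fun σ : Perm α => #(nonEdges Adj σ) ≤ j) ×ˢ
      (univ : Finset (α × α))) := by
    refine card_le_card_of_injOn (fun p => (p.1 * swap p.2.1 p.2.2, p.2.1, p.2.2)) ?_ ?_
    · rintro ⟨σ, a, a'⟩ hp
      simp only [hD, hT, coe_sigma, Set.mem_sigma_iff, mem_coe, mem_filter, mem_univ,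
        true_and, mem_product, and_true] at hp ⊢
      obtain ⟨hσ, ha, h1, h2⟩ := hp
      have := card_nonEdges_mul_swap_lt (mem_nonEdges.1 ha) h1 h2
      omega
    · rintro ⟨σ, a, a'⟩ - ⟨ρ, c, c'⟩ - heq
      simp only [Prod.mk.injEq] at heq
      obtain ⟨h1, rfl, rfl⟩ := heq
      rw [mul_right_cancel h1]
  refine (hcard.trans himg).trans_eq ?_
  rw [card_product, card_univ, Fintype.card_prod, sq]

open Classical in
lemma card_nonEdges_le_mul_factorial_le {Adj : α → α → Prop} {m : ℕ} (h : HasDegreeSum Adj m)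
    {K : ℝ} (hK : 0 ≤ K) (hKm : (Fintype.card α : ℝ) ^ 2 ≤ K * m) (hm : 0 < m) (j : ℕ)
    (hj : j ≤ Fintype.card α) :
    (#{σ : Perm α | #(nonEdges Adj σ) ≤ j} : ℝ) * j.factorial ≤
      (Fintype.card α + K) ^ j * #(perfectMatchings Adj) := by
  induction j with
  | zero =>
    simp only [Nat.factorial_zero, Nat.cast_one, mul_one, pow_zero, one_mul, Nat.cast_le]
    refine card_le_card fun σ => ?_
    simp [mem_perfectMatchings, eq_empty_iff_forall_notMem, mem_nonEdges]
  | succ j ih =>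
    set A : ℝ := ((#{σ : Perm α | #(nonEdges Adj σ) ≤ j} : ℕ) : ℝ) with hA
    set E : ℝ := ((#{σ : Perm α | #(nonEdges Adj σ) = j + 1} : ℕ) : ℝ) with hE
    have hsplit : (#{σ : Perm α | #(nonEdges Adj σ) ≤ j + 1} : ℝ) = A + E := by
      rw [hA, hE, ← Nat.cast_add, ← card_union_of_disjoint, ← filter_or]
      · simp only [Nat.le_succ_iff]
      · exact disjoint_filter.2 fun σ _ h1 h2 => by omega
    have hA0 : 0 ≤ A := Nat.cast_nonneg _
    have hm' : (0 : ℝ) < m := by exact_mod_cast hm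
    have hE' : E * (j + 1) ≤ K * A := by
      have h1 : E * ((j + 1) * m) ≤ A * (Fintype.card α : ℝ) ^ 2 := by
        rw [hA, hE]
        exact_mod_cast card_nonEdges_eq_mul_le h j
      refine le_of_mul_le_mul_right ?_ hm'
      nlinarith [mul_le_mul_of_nonneg_left hKm hA0]
    have hj' : (j : ℝ) + 1 ≤ Fintype.card α := by exact_mod_cast hj
    have ih' := ih (by omega)
    rw [hsplit, Nat.factorial_succ, pow_succ']
    push_cast
    calc (A + E) * ((j + 1) * j.factorial) = (A * (j + 1) + E * (j + 1)) * j.factorial := by ring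
      _ ≤ (A * Fintype.card α + K * A) * j.factorial := by gcongr
      _ = (Fintype.card α + K) * (A * j.factorial) := by ring
      _ ≤ (Fintype.card α + K) *
          ((Fintype.card α + K) ^ j * #(perfectMatchings Adj)) := by gcongr
      _ = _ := by ring

lemma factorial_sq_le_card_perfectMatchings {Adj : α → α → Prop} {m : ℕ} (h : HasDegreeSum Adj m)
    {K : ℝ} (hK : 0 ≤ K) (hKm : (Fintype.card α : ℝ) ^ 2 ≤ K * m) (hm : 0 < m) :
    ((Fintype.card α).factorial : ℝ) ^ 2 ≤
      (Fintype.card α + K) ^ Fintype.card α * #(perfectMatchings Adj) := by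
  classical
  have := card_nonEdges_le_mul_factorial_le h hK hKm hm _ le_rfl
  rw [filter_true_of_mem fun σ _ => card_le_univ _, card_univ, Fintype.card_perm] at this
  rwa [sq]

end PerfectMatchings

lemma pow_le_exp_pow_mul_descFactorial (m s : ℕ) (hs : s ≤ m) :
    (m : ℝ) ^ s ≤ Real.exp 1 ^ s * m.descFactorial s := by
  induction m generalizing s with
  | zero => simp [Nat.le_zero.1 hs]
  | succ m ih =>
    cases s with
    | zero => simp
    | succ s =>
      have hsm : s ≤ m := by omega
      have key : ((m : ℝ) + 1) ^ s ≤ Real.exp 1 * (m : ℝ) ^ s := by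
        rcases Nat.eq_zero_or_pos m with rfl | hm
        · simp [Nat.le_zero.1 hsm]
        have hm' : (0 : ℝ) < m := by exact_mod_cast hm
        have h1 : (m : ℝ) + 1 ≤ Real.exp (1 / m) * m := by
          have := mul_le_mul_of_nonneg_right (Real.add_one_le_exp (1 / (m : ℝ))) hm'.le
          refine le_trans (le_of_eq ?_) this
          field_simp
          ring
        calc ((m : ℝ) + 1) ^ s ≤ (Real.exp (1 / m) * m) ^ s := by gcongr
          _ = Real.exp (s * (1 / m)) * (m : ℝ) ^ s := by rw [mul_pow, Real.exp_nat_mul]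
          _ ≤ Real.exp 1 * (m : ℝ) ^ s := by
            gcongr
            rw [mul_one_div, div_le_one hm']
            exact_mod_cast hsm
      rw [Nat.succ_descFactorial_succ]
      push_cast
      have h0 : (0 : ℝ) ≤ m + 1 := by positivity
      calc ((m : ℝ) + 1) ^ (s + 1) = (m + 1) * (m + 1) ^ s := pow_succ' _ _
        _ ≤ (m + 1) * (Real.exp 1 * (m : ℝ) ^ s) := by gcongr
        _ ≤ (m + 1) * (Real.exp 1 * (Real.exp 1 ^ s * m.descFactorial s)) := by
          gcongr
          exact ih s hsm
        _ = _ := by ring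

lemma card_matchingsAgreeingOn_le {n : ℕ} (hn : 0 < n) (Adj : Fin n → Fin n → Prop)
    (S : Finset (Fin n)) (τ : Perm (Fin n)) :
    (#(matchingsAgreeingOn Adj S τ) : ℝ) ≤ (Real.exp 1 / n) ^ #S * n.factorial := by
  have hn' : (0 : ℝ) < n := by exact_mod_cast hn
  have h0 := card_matchingsAgreeingOn_mul_descFactorial_card_le Adj τ S
  rw [Fintype.card_fin] at h0
  have h1 : (#(matchingsAgreeingOn Adj S τ) : ℝ) * n.descFactorial #S ≤ n.factorial := by
    exact_mod_cast h0
  have h2 := pow_le_exp_pow_mul_descFactorial n #S (by simpa using card_le_univ S)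
  rw [div_pow, div_mul_eq_mul_div, le_div_iff₀ (by positivity)]
  calc _ ≤ (#(matchingsAgreeingOn Adj S τ) : ℝ) *
        (Real.exp 1 ^ #S * n.descFactorial #S) := by gcongr
    _ = Real.exp 1 ^ #S * (#(matchingsAgreeingOn Adj S τ) * n.descFactorial #S) := by ring
    _ ≤ _ := by gcongr

/-- The uniform distribution on perfect matchings of a dense bipartite graph is spread. -/
lemma exists_card_matchingsAgreeingOn_le (ε : ℝ) (hε : 0 < ε) :
    ∃ C : ℝ, Real.exp 1 ≤ C ∧ ∀ (n m : ℕ) (Adj : Fin n → Fin n → Prop), 0 < n →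
      ε * n ≤ m → HasDegreeSum Adj m → 0 < #(perfectMatchings Adj) ∧
      ∀ (S : Finset (Fin n)) (τ : Perm (Fin n)),
        (#(matchingsAgreeingOn Adj S τ) : ℝ) ≤ (C / n) ^ #S * #(perfectMatchings Adj) := by
  set B : ℝ := Real.exp 1 * (1 + 1 / ε) with hB
  set k : ℕ := ⌈1 / ε⌉₊ with hk
  have he : 1 ≤ Real.exp 1 := Real.one_le_exp zero_le_one
  have hB1 : 1 ≤ B := one_le_mul_of_one_le_of_one_le he (by simp [hε.le])
  refine ⟨Real.exp 1 / ε + Real.exp 1 * B ^ k, ?_, fun n m Adj hn hmn h => ?_⟩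
  · have : Real.exp 1 ≤ Real.exp 1 * B ^ k :=
      le_mul_of_one_le_right (by positivity) (one_le_pow₀ hB1)
    have : 0 ≤ Real.exp 1 / ε := by positivity
    linarith
  have hn' : (0 : ℝ) < n := by exact_mod_cast hn
  have hm' : (0 : ℝ) < m := lt_of_lt_of_le (by positivity) hmn
  have hm : 0 < m := by exact_mod_cast hm'
  have hfac : (0 : ℝ) < n.factorial := by exact_mod_cast n.factorial_pos
  have hsq := factorial_sq_le_card_perfectMatchings h (K := n / ε) (by positivity)
    (by
      rw [Fintype.card_fin, div_mul_eq_mul_div, le_div_iff₀ hε]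
      nlinarith) hm
  rw [Fintype.card_fin] at hsq
  have hlow : (n.factorial : ℝ) ≤ B ^ n * #(perfectMatchings Adj) := by
    have h1 := pow_le_exp_pow_mul_descFactorial n n le_rfl
    rw [Nat.descFactorial_self] at h1
    refine le_of_mul_le_mul_right ?_ hfac
    calc (n.factorial : ℝ) * n.factorial = (n.factorial : ℝ) ^ 2 := by ring
      _ ≤ (n + n / ε) ^ n * #(perfectMatchings Adj) := hsq
      _ = (1 + 1 / ε) ^ n * (n : ℝ) ^ n * #(perfectMatchings Adj) := by
        rw [← mul_pow]
        congr 2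
        ring
      _ ≤ (1 + 1 / ε) ^ n * (Real.exp 1 ^ n * n.factorial) * #(perfectMatchings Adj) := by
        gcongr
      _ = _ := by
        rw [hB, mul_pow]
        ring
  refine ⟨?_, fun S τ => ?_⟩
  · by_contra hzero
    rw [Nat.eq_zero_of_not_pos hzero] at hlow
    simp only [Nat.cast_zero, mul_zero] at hlow
    linarith
  set F : ℝ := ((#(matchingsAgreeingOn Adj S τ) : ℕ) : ℝ) with hF
  set N : ℝ := ((#(perfectMatchings Adj) : ℕ) : ℝ) with hN
  have hF0 : 0 ≤ F := Nat.cast_nonneg _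
  have hN0 : 0 ≤ N := Nat.cast_nonneg _
  by_cases hS : #S ≤ m
  · have h1 : F * m.descFactorial #S ≤ N := by
      rw [hF, hN]
      exact_mod_cast card_matchingsAgreeingOn_mul_descFactorial_le h τ S
    have h2 := pow_le_exp_pow_mul_descFactorial m #S hS
    have h3 : F ≤ (Real.exp 1 / m) ^ #S * N := by
      rw [div_pow, div_mul_eq_mul_div, le_div_iff₀ (by positivity)]
      calc F * (m : ℝ) ^ #S ≤ F * (Real.exp 1 ^ #S * m.descFactorial #S) := by gcongr
        _ = Real.exp 1 ^ #S * (F * m.descFactorial #S) := by ring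
        _ ≤ _ := by gcongr
    have h4 : Real.exp 1 / m ≤ (Real.exp 1 / ε + Real.exp 1 * B ^ k) / n :=
      calc Real.exp 1 / m ≤ Real.exp 1 / (ε * n) := by gcongr
        _ = Real.exp 1 / ε / n := by rw [div_div]
        _ ≤ _ := by
          gcongr
          have : 0 ≤ Real.exp 1 * B ^ k := by positivity
          linarith
    exact h3.trans (mul_le_mul_of_nonneg_right (pow_le_pow_left₀ (by positivity) h4 _) hN0)
  · have h3 : F ≤ (Real.exp 1 / n) ^ #S * n.factorial :=
      card_matchingsAgreeingOn_le hn Adj S τ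
    have hnk : n ≤ k * #S := by
      have hmS : (m : ℝ) ≤ #S := by exact_mod_cast (not_le.1 hS).le
      have hk1 : 1 / ε ≤ k := Nat.le_ceil _
      have : (n : ℝ) ≤ k * #S := calc
        (n : ℝ) = 1 / ε * (ε * n) := by field_simp
        _ ≤ k * #S := by
          gcongr
          exact hmn.trans hmS
      exact_mod_cast this
    calc F ≤ (Real.exp 1 / n) ^ #S * n.factorial := h3
      _ ≤ (Real.exp 1 / n) ^ #S * (B ^ n * N) := by gcongr
      _ ≤ (Real.exp 1 / n) ^ #S * (B ^ (k * #S) * N) := by gcongr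
      _ = (Real.exp 1 * B ^ k / n) ^ #S * N := by
        rw [pow_mul, ← mul_assoc, ← mul_pow]
        congr 2
        ring
      _ ≤ _ := by
        gcongr
        have : 0 ≤ Real.exp 1 / ε := by positivity
        linarith

/-- The map on `Fin n ⊕ Fin n` sending the `i`-th edge to the edge of `σ` at `π i`. -/
def matchingEmbedding {n : ℕ} (p : Perm (Fin n) × Perm (Fin n)) :
    Fin n ⊕ Fin n → Fin n ⊕ Fin n :=
  Sum.map p.2 fun i => p.1 (p.2 i)

lemma isPMEmbedding_matchingEmbedding {n : ℕ} {Adj : Fin n → Fin n → Prop}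
    {p : Perm (Fin n) × Perm (Fin n)} (hp : p.1 ∈ perfectMatchings Adj) :
    IsPMEmbedding Adj (matchingEmbedding p) :=
  ⟨p.2.injective.sumMap (p.1.injective.comp p.2.injective), fun i => by
    simpa [matchingEmbedding, bipAdj] using mem_perfectMatchings.1 hp (p.2 i)⟩

open Classical in
lemma card_matchingEmbedding_agreeing_le {n : ℕ} (hn : 0 < n) {Adj : Fin n → Fin n → Prop} {C : ℝ}
    (hC : Real.exp 1 ≤ C)
    (h : ∀ (S : Finset (Fin n)) (τ : Perm (Fin n)),
      (#(matchingsAgreeingOn Adj S τ) : ℝ) ≤ (C / n) ^ #S * #(perfectMatchings Adj))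
    (X : Finset (Fin n ⊕ Fin n)) (p₀ : Perm (Fin n) × Perm (Fin n)) :
    (#((perfectMatchings Adj ×ˢ univ).filter fun p : Perm (Fin n) × Perm (Fin n) =>
        ∀ v ∈ X, matchingEmbedding p v = matchingEmbedding p₀ v) : ℝ) ≤
      (C / n) ^ #X * (#(perfectMatchings Adj) * n.factorial) := by
  obtain ⟨σ₀, π₀⟩ := p₀
  set I := X.toLeft with hI
  set J := X.toRight with hJ
  have hC0 : 0 < C := lt_of_lt_of_le (Real.exp_pos 1) hC
  set S := (I ∩ J).map π₀.toEmbedding with hS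
  set T : Perm (Fin n) → Finset (Perm (Fin n)) := fun σ =>
    univ.filter fun π => (∀ j ∈ I, π j = π₀ j) ∧ ∀ j ∈ J, σ (π j) = σ₀ (π₀ j) with hT
  have hTcard : ∀ σ, (#(T σ) : ℝ) ≤ (C / n) ^ #(I ∪ J) * n.factorial := by
    intro σ
    rcases (T σ).eq_empty_or_nonempty with h0 | ⟨π₁, hπ₁⟩
    · rw [h0, card_empty, Nat.cast_zero]
      positivity
    · have h1 : T σ ⊆ matchingsAgreeingOn (fun _ _ => True) (I ∪ J) π₁ := by
        intro π hπ
        simp only [hT, mem_filter, mem_univ, true_and] at hπ hπ₁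
        refine mem_matchingsAgreeingOn.2 ⟨fun _ => trivial, fun a ha => ?_⟩
        rcases mem_union.1 ha with ha | ha
        · rw [hπ.1 a ha, hπ₁.1 a ha]
        · exact σ.injective ((hπ.2 a ha).trans (hπ₁.2 a ha).symm)
      calc (#(T σ) : ℝ) ≤ _ := by exact_mod_cast card_le_card h1
        _ ≤ (Real.exp 1 / n) ^ #(I ∪ J) * n.factorial := card_matchingsAgreeingOn_le hn _ _ π₁
        _ ≤ _ := by gcongr
  have hsub : ((perfectMatchings Adj ×ˢ univ).filter fun p : Perm (Fin n) × Perm (Fin n) =>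
      ∀ v ∈ X, matchingEmbedding p v = matchingEmbedding (σ₀, π₀) v).card ≤
      #((matchingsAgreeingOn Adj S σ₀).sigma T) := by
    refine card_le_card_of_injOn (fun p => ⟨p.1, p.2⟩) ?_ ?_
    · rintro ⟨σ, π⟩ hp
      simp only [mem_coe, mem_filter, mem_product, mem_univ, and_true] at hp
      obtain ⟨hσ, hX⟩ := hp
      have hl : ∀ j ∈ I, π j = π₀ j := fun j hj => by
        simpa [matchingEmbedding] using hX (.inl j) (mem_toLeft.1 hj)
      have hr : ∀ j ∈ J, σ (π j) = σ₀ (π₀ j) := fun j hj => by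
        simpa [matchingEmbedding] using hX (.inr j) (mem_toRight.1 hj)
      simp only [coe_sigma, Set.mem_sigma_iff, mem_coe, mem_matchingsAgreeingOn, mem_filter, hT,
        mem_univ, true_and]
      refine ⟨⟨mem_perfectMatchings.1 hσ, fun a ha => ?_⟩, hl, hr⟩
      obtain ⟨j, hj, rfl⟩ := mem_map.1 ha
      rw [mem_inter] at hj
      have := hr j hj.2
      rwa [hl j hj.1] at this
    · rintro ⟨σ, π⟩ - ⟨ρ, π'⟩ - heq
      simpa using heq
  have hXcard : #(I ∩ J) + #(I ∪ J) = #X := by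
    rw [card_inter_add_card_union, hI, hJ, card_toLeft_add_card_toRight]
  calc _ ≤ (#((matchingsAgreeingOn Adj S σ₀).sigma T) : ℝ) := by exact_mod_cast hsub
    _ = ∑ σ ∈ matchingsAgreeingOn Adj S σ₀, (#(T σ) : ℝ) := by
      rw [card_sigma, Nat.cast_sum]
    _ ≤ #(matchingsAgreeingOn Adj S σ₀) * ((C / n) ^ #(I ∪ J) * n.factorial) := by
      rw [← nsmul_eq_mul]
      exact sum_le_card_nsmul _ _ _ fun σ _ => hTcard σ
    _ ≤ ((C / n) ^ #(I ∩ J) * #(perfectMatchings Adj)) *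
        ((C / n) ^ #(I ∪ J) * n.factorial) := by
      gcongr
      simpa [hS] using h S σ₀
    _ = _ := by
      rw [← hXcard, pow_add]
      ring

open Classical in
theorem vertex_spread_PM_bipartite_minDegree (ε : ℝ) (hε : 0 < ε) :
    ∃ C : ℝ, 0 < C ∧ ∃ n₀ : ℕ, ∀ n : ℕ, n₀ ≤ n →
    ∀ Adj : Fin n → Fin n → Prop,
      (∀ a : Fin n, (1 / 2 + ε) * n ≤ ((Finset.univ.filter fun b => Adj a b).card : ℝ)) →
      (∀ b : Fin n, (1 / 2 + ε) * n ≤ ((Finset.univ.filter fun a => Adj a b).card : ℝ)) →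
      ∃ μ : ((Fin n ⊕ Fin n) → (Fin n ⊕ Fin n)) → ℝ,
        (∀ f, 0 ≤ μ f) ∧ (∑ f, μ f = 1) ∧
        (∀ f, μ f ≠ 0 → IsPMEmbedding Adj f) ∧
        IsVertexSpread (C / n) μ := by
  obtain ⟨C, hC, hspread⟩ := exists_card_matchingsAgreeingOn_le (2 * ε) (by positivity)
  have hC0 : 0 < C := lt_of_lt_of_le (Real.exp_pos 1) hC
  refine ⟨C, hC0, 1, fun n hn Adj hleft hright => ?_⟩
  have hdeg : HasDegreeSum Adj ⌈2 * ε * n⌉₊ := by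
    intro a b
    have h1 : ⌈2 * ε * n⌉₊ ≤ (#{b' | Adj a b'} + #{a' | Adj a' b} : ℤ) - n := by
      rw [Int.natCast_ceil_eq_ceil (by positivity), Int.ceil_le]
      push_cast
      linarith [hleft a, hright b]
    rw [Fintype.card_fin]
    omega
  obtain ⟨hpos, hle⟩ := hspread n _ Adj hn (Nat.le_ceil _) hdeg
  set Ω := perfectMatchings Adj ×ˢ (univ : Finset (Perm (Fin n))) with hΩ
  have hΩcard : (#Ω : ℝ) = #(perfectMatchings Adj) * n.factorial := by
    rw [hΩ, card_product, card_univ, Fintype.card_perm, Fintype.card_fin, Nat.cast_mul]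
  have hΩpos : (0 : ℝ) < #Ω := by
    rw [hΩcard]
    exact mul_pos (by exact_mod_cast hpos) (by exact_mod_cast n.factorial_pos)
  have hsum : ∀ A : Finset (Fin n ⊕ Fin n → Fin n ⊕ Fin n),
      ∑ f ∈ A, (#(Ω.filter fun p => matchingEmbedding p = f) : ℝ) / #Ω =
        #(Ω.filter fun p => matchingEmbedding p ∈ A) / #Ω := by
    intro A
    rw [← sum_div, ← Nat.cast_sum, card_eq_sum_card_fiberwise (f := matchingEmbedding) (t := A)
      (s := Ω.filter fun p => matchingEmbedding p ∈ A)
      (by intro p hp; simpa using (mem_filter.1 hp).2)]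
    congr 2
    refine sum_congr rfl fun f hf => ?_
    rw [filter_filter]
    congr 1
    refine filter_congr fun p _ => ⟨fun h => ⟨h ▸ hf, h⟩, fun h => h.2⟩
  refine ⟨fun f => #(Ω.filter fun p => matchingEmbedding p = f) / #Ω, fun f => by positivity,
    ?_, fun f hf => ?_, fun s x y hx _ => ?_⟩
  · rw [hsum]
    simp [hΩpos.ne']
  · have : (Ω.filter fun p => matchingEmbedding p = f).Nonempty := by
      rw [nonempty_iff_ne_empty]
      rintro h0
      simp [h0] at hf
    obtain ⟨p, hp⟩ := this
    obtain ⟨hpΩ, rfl⟩ := mem_filter.1 hp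
    exact isPMEmbedding_matchingEmbedding (mem_product.1 hpΩ).1
  · rw [hsum, div_le_iff₀ hΩpos]
    set D := Ω.filter fun p => matchingEmbedding p ∈
      univ.filter fun f : Fin n ⊕ Fin n → Fin n ⊕ Fin n => ∀ i, f (x i) = y i with hD
    rcases D.eq_empty_or_nonempty with h0 | ⟨p₀, hp₀⟩
    · rw [h0, card_empty, Nat.cast_zero]
      positivity
    have hsub : D ⊆ Ω.filter fun p => ∀ v ∈ univ.image x,
        matchingEmbedding p v = matchingEmbedding p₀ v := by
      intro p hp
      simp only [hD, mem_filter, mem_univ, true_and] at hp hp₀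
      refine mem_filter.2 ⟨hp.1, fun v hv => ?_⟩
      obtain ⟨i, -, rfl⟩ := mem_image.1 hv
      rw [hp.2 i, hp₀.2 i]
    have hX : #(univ.image x) = s := by
      rw [card_image_of_injective _ hx, card_univ, Fintype.card_fin]
    calc (#D : ℝ) ≤ _ := by exact_mod_cast card_le_card hsub
      _ ≤ (C / n) ^ #(univ.image x) * (#(perfectMatchings Adj) * n.factorial) :=
        card_matchingEmbedding_agreeing_le hn hC hle _ p₀
      _ = _ := by rw [hX, hΩcard]
end
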